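/- Let (R,m) be a Noetherian local ring, M a finitely generated R-module with r = dim_R M > 0, and Q a parameter ideal for M. Let 1 ≤ k ≤ r be an integer and assume that e_i(Q,M) = 0 for all 1 ≤ i ≤ k. Then dim_{R̂} U_{M̂}(0) ≤ r − (k+1) and H^{r−j}_m(M) = (0) for all 1 ≤ j ≤ k. In particular, if k = r, then M is a Cohen–Macaulay R-module. -/

import Mathlib

open IsLocalRing

section Defs

variable (R : Type) [CommRing R]

/-- The length of a module, as the Krull dimension of its lattice of submodules. -/
noncomputable def mLength (M : Type) [AddCommGroup M] [Module R M] : WithBot ℕ∞ :=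
  Order.krullDim (Submodule R M)

/-- The (Krull) dimension of a module. -/
noncomputable def mDim (M : Type) [AddCommGroup M] [Module R M] : WithBot ℕ∞ :=
  ringKrullDim (R ⧸ Submodule.annihilator (⊤ : Submodule R M))

/-- `f` is eventually given by the Hilbert-type polynomial of degree `t` with
coefficients `s 0, …, s t` (written in the binomial basis with alternating signs). -/
def IsHilbPolyAt (f : ℕ → WithBot ℕ∞) (t : ℕ) (s : ℕ → ℤ) : Prop :=
  ∃ N : ℕ, ∀ n ≥ N, ∃ l : ℕ, f n = (l : ℕ∞) ∧
    (l : ℤ) = ∑ i ∈ Finset.range (t + 1), (-1 : ℤ) ^ i * s i * ((n + t - i).choose (t - i) : ℤ)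

/-- `s 0, …, s t` are the Hilbert coefficients `e_i(I, M)`, i.e.
`λ(M/I^{n+1}M) = ∑ (-1)^i e_i(I,M) C(n+t-i, t-i)` for `n ≫ 0`. -/
def HasHilbCoeffs (I : Ideal R) (M : Type) [AddCommGroup M] [Module R M]
    (t : ℕ) (s : ℕ → ℤ) : Prop :=
  IsHilbPolyAt (fun n => mLength R (M ⧸ (I ^ (n + 1) • (⊤ : Submodule R M)))) t s

/-- The unmixed component `U_M(0)` of `M`: the largest submodule of dimension `< dim M`. -/
noncomputable def unmixedComp (M : Type) [AddCommGroup M] [Module R M] : Submodule R M :=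
  sSup {N : Submodule R M | mDim R ↥N < mDim R M}

/-- `x` is a d-sequence on `M`. -/
def IsDSeq {r : ℕ} (x : Fin r → R) (M : Type) [AddCommGroup M] [Module R M] : Prop :=
  ∀ i j : Fin r, i ≤ j →
    Submodule.comap (LinearMap.lsmul R M (x i * x j))
        (Ideal.span (x '' {k | k < i}) • (⊤ : Submodule R M))
      = Submodule.comap (LinearMap.lsmul R M (x j))
        (Ideal.span (x '' {k | k < i}) • (⊤ : Submodule R M))

/-- `x` is a standard (d⁺-) system: all power sequences in any order are d-sequences. -/
def IsStandardSeq {r : ℕ} (x : Fin r → R) (M : Type) [AddCommGroup M] [Module R M] : Prop :=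
  ∀ n : Fin r → ℕ, (∀ k, 1 ≤ n k) → ∀ σ : Equiv.Perm (Fin r),
    IsDSeq R (fun k => x (σ k) ^ n (σ k)) M

/-- The integral closure of an ideal, as a set. -/
def intClos (Q : Ideal R) : Set R :=
  {x : R | ∃ n : ℕ, 0 < n ∧ ∃ a : ℕ → R, (∀ i, 1 ≤ i → i ≤ n → a i ∈ Q ^ i) ∧
    x ^ n + ∑ i ∈ Finset.Icc 1 n, a i * x ^ (n - i) = 0}

variable [IsLocalRing R]

/-- `h ∈ I` is superficial for `M` with respect to `I`. -/
def IsSuperficial (I : Ideal R) (M : Type) [AddCommGroup M] [Module R M] (h : R) : Prop :=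
  h ∈ I ∧ ∃ c N : ℕ, ∀ n ≥ N,
    Submodule.comap (LinearMap.lsmul R M h) (I ^ (n + 1) • (⊤ : Submodule R M))
        ⊓ (I ^ c • (⊤ : Submodule R M))
      = I ^ n • (⊤ : Submodule R M)

/-- `Q` is a parameter ideal for `M` (`r` the dimension of `M`):
generated by `r` elements of the maximal ideal with `M/QM` of finite length. -/
def IsParamIdeal (Q : Ideal R) (M : Type) [AddCommGroup M] [Module R M] (r : ℕ) : Prop :=
  Q ≤ maximalIdeal R ∧ (∃ x : Fin r → R, Q = Ideal.span (Set.range x)) ∧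
    IsFiniteLength R (M ⧸ Q • (⊤ : Submodule R M))

/-- Local cohomology `H^i_𝔪(M)` with support in the maximal ideal. -/
noncomputable def LC (i : ℕ) (M : Type) [AddCommGroup M] [Module R M] : ModuleCat R :=
  (localCohomology (maximalIdeal R) i).obj (ModuleCat.of R M)

/-- `M` is Cohen–Macaulay: there is a regular sequence on `M` in the maximal ideal
whose length equals `dim M`. -/
def IsCM (M : Type) [AddCommGroup M] [Module R M] : Prop :=
  ∃ rs : List R, (∀ x ∈ rs, x ∈ maximalIdeal R) ∧ RingTheory.Sequence.IsRegular M rs ∧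
    (rs.length : WithBot ℕ∞) = mDim R M

/-- `M` is unmixed: `dim R̂/p = dim M` for every associated prime `p` of the completion `M̂`. -/
def IsUnmixed (M : Type) [AddCommGroup M] [Module R M] : Prop :=
  ∀ p ∈ associatedPrimes (AdicCompletion (maximalIdeal R) R)
      (AdicCompletion (maximalIdeal R) M),
    ringKrullDim ((AdicCompletion (maximalIdeal R) R) ⧸ p) = mDim R M

/-- `M` is generalized Cohen–Macaulay: `H^i_𝔪(M)` has finite length for `i < r = dim M`. -/
def IsGenCM (M : Type) [AddCommGroup M] [Module R M] (r : ℕ) : Prop :=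
  ∀ i < r, IsFiniteLength R ↥(LC R i M)

/-- The set `Λ(M)` of first Hilbert coefficients of parameter ideals for `M`. -/
def Lambda (M : Type) [AddCommGroup M] [Module R M] (r : ℕ) : Set ℤ :=
  {a : ℤ | ∃ (Q : Ideal R) (e : ℕ → ℤ),
    IsParamIdeal R Q M r ∧ HasHilbCoeffs R Q M r e ∧ e 1 = a}

/-- A standard parameter ideal: one generated by a standard system of parameters. -/
def IsStandardParamIdeal (Q : Ideal R) (M : Type) [AddCommGroup M] [Module R M]
    (r : ℕ) : Prop :=
  IsParamIdeal R Q M r ∧ ∃ x : Fin r → R, Q = Ideal.span (Set.range x) ∧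
    IsStandardSeq R x M

/-- `M` is Buchsbaum: every parameter ideal for `M` is standard. -/
def IsBuchsbaum (M : Type) [AddCommGroup M] [Module R M] (r : ℕ) : Prop :=
  ∀ Q : Ideal R, IsParamIdeal R Q M r → IsStandardParamIdeal R Q M r

/-- `M` is a Vasconcelos module. -/
def IsVasconcelos (M : Type) [AddCommGroup M] [Module R M] : Prop :=
  mDim R M ≤ 0 ∨ (0 < mDim R M ∧ ∃ (r : ℕ) (Q : Ideal R) (e : ℕ → ℤ),
    mDim R M = (r : ℕ∞) ∧ IsParamIdeal R Q M r ∧ HasHilbCoeffs R Q M r e ∧ e 1 = 0)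

/-- A Gorenstein local ring: Noetherian, Cohen–Macaulay, with an irreducible parameter ideal. -/
def IsGorensteinLocalRing : Prop :=
  IsNoetherianRing R ∧ IsCM R R ∧ ∃ (r : ℕ) (Q : Ideal R),
    mDim R R = (r : ℕ∞) ∧ IsParamIdeal R Q R r ∧
    ∀ I J : Ideal R, Q = I ⊓ J → Q = I ∨ Q = J

/-- `E` is an injective envelope of the residue field `R/𝔪`. -/
def IsInjEnvResidue (E : Type) [AddCommGroup E] [Module R E] : Prop :=
  Module.Injective R E ∧ ∃ ι : (R ⧸ maximalIdeal R) →ₗ[R] E, Function.Injective ι ∧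
    ∀ N : Submodule R E, N ⊓ LinearMap.range ι = ⊥ → N = ⊥

end Defs

/-- A (not necessarily local) Cohen–Macaulay ring: Noetherian,
with all localizations at primes Cohen–Macaulay. -/
def IsCMRing (S : Type) [CommRing S] : Prop :=
  IsNoetherianRing S ∧ ∀ (p : Ideal S) [p.IsPrime],
    IsCM (Localization.AtPrime p) (Localization.AtPrime p)

/-- A (not necessarily local) Gorenstein ring. -/
def IsGorensteinRing (S : Type) [CommRing S] : Prop :=
  IsNoetherianRing S ∧ ∀ (p : Ideal S) [p.IsPrime],
    IsGorensteinLocalRing (Localization.AtPrime p)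

/-- `HDegRel R I E M v` : `v` is the homological degree `hdeg_I(M)` computed
with Matlis duals taken relative to `E`. -/
inductive HDegRel (R : Type) [CommRing R] [IsLocalRing R] (I : Ideal R)
    (E : Type) [AddCommGroup E] [Module R E] : ModuleCat R → ℕ → Prop where
  | base : ∀ (M : ModuleCat R) (l : ℕ), mDim R M ≤ 0 → mLength R M = (l : ℕ∞) →
      HDegRel R I E M l
  | step : ∀ (M : ModuleCat R) (r : ℕ), mDim R M = (r : ℕ∞) → 0 < r →
      ∀ (e : ℕ → ℤ) (e0 : ℕ), HasHilbCoeffs R I M r e → e 0 = (e0 : ℤ) →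
      ∀ v : ℕ → ℕ,
        (∀ j < r, HDegRel R I E (ModuleCat.of R ((LC R j M) →ₗ[R] E)) (v j)) →
      HDegRel R I E M (e0 + ∑ j ∈ Finset.range r, (r - 1).choose j * v j)

namespace VanHilb

universe u v

open RingTheory.Sequence Pointwise

section NumericCM

variable {R : Type u} [CommRing R]

lemma length_quot_le_of_le {N : Type v} [AddCommGroup N] [Module R N] {P T : Submodule R N}
    (h : P ≤ T) : Module.length R (N ⧸ T) ≤ Module.length R (N ⧸ P) :=
  Module.length_le_of_surjective (Submodule.factor h) (Submodule.factor_surjective h)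

lemma eq_of_length_quot_le {N : Type v} [AddCommGroup N] [Module R N] {P T : Submodule R N}
    (h : P ≤ T) (hfin : Module.length R (N ⧸ T) ≠ ⊤)
    (hl : Module.length R (N ⧸ P) ≤ Module.length R (N ⧸ T)) : P = T := by
  rw [Module.length_quotient, Module.length_quotient] at *
  by_contra hne
  have hlt : P < T := lt_of_le_of_ne h hne
  exact absurd hl (not_le.mpr (Order.coheight_strictAnti hlt (lt_top_iff_ne_top.mpr hfin)))

/-- Splitting the length of `N / I N` along multiplication by `x`. -/
lemma length_quot_smul_eq_add (N : Type v) [AddCommGroup N] [Module R N] (x : R) (I : Ideal R) :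
    Module.length R (N ⧸ (I • ⊤ : Submodule R N)) =
      Module.length R (N ⧸ (I • ⊤ : Submodule R N).comap (LinearMap.lsmul R N x)) +
      Module.length R (QuotSMulTop x N ⧸ (I • ⊤ : Submodule R (QuotSMulTop x N))) := by
  have hle : (I • ⊤ : Submodule R N) ≤
      (I • ⊤ : Submodule R (QuotSMulTop x N)).comap (x • ⊤ : Submodule R N).mkQ := by
    rw [← Submodule.map_le_iff_le_comap, Submodule.map_smul'']
    exact smul_mono_right _ le_top
  refine Module.length_eq_add_of_exact
    (Submodule.mapQ _ _ (LinearMap.lsmul R N x) le_rfl)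
    (Submodule.mapQ _ _ (x • ⊤ : Submodule R N).mkQ hle) ?_ ?_ ?_
  · rw [← LinearMap.ker_eq_bot, Submodule.ker_mapQ]
    exact Submodule.mkQ_map_self _
  · intro y
    obtain ⟨y, rfl⟩ := Submodule.mkQ_surjective _ y
    obtain ⟨y, rfl⟩ := Submodule.mkQ_surjective _ y
    exact ⟨Submodule.Quotient.mk y, rfl⟩
  · intro y
    obtain ⟨y, rfl⟩ := Submodule.mkQ_surjective _ y
    constructor
    · intro hy
      have h1 : (x • ⊤ : Submodule R N).mkQ y ∈
          (I • ⊤ : Submodule R (QuotSMulTop x N)) := by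
        rw [← Submodule.Quotient.mk_eq_zero]; exact hy
      have h2 : (I • ⊤ : Submodule R (QuotSMulTop x N)) =
          (I • ⊤ : Submodule R N).map (x • ⊤ : Submodule R N).mkQ := by
        rw [Submodule.map_smul'', Submodule.map_top, Submodule.range_mkQ]
      rw [h2] at h1
      obtain ⟨z, hz, hzy⟩ := h1
      have h3 : y - z ∈ (x • ⊤ : Submodule R N) := by
        rw [← Submodule.Quotient.mk_eq_zero, Submodule.Quotient.mk_sub, sub_eq_zero]
        exact hzy.symm
      obtain ⟨w, -, hw⟩ := h3
      refine ⟨Submodule.Quotient.mk w, ?_⟩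
      change Submodule.Quotient.mk (x • w) = Submodule.Quotient.mk y
      rw [eq_comm, Submodule.Quotient.eq]
      have : x • w = y - z := hw
      rw [this]; simpa using hz
    · rintro ⟨w, hw⟩
      obtain ⟨w, rfl⟩ := Submodule.mkQ_surjective _ w
      rw [← hw]
      change Submodule.Quotient.mk (Submodule.Quotient.mk (x • w)) = _
      rw [(Submodule.Quotient.mk_eq_zero (x • ⊤ : Submodule R N)).mpr
        (Submodule.smul_mem_pointwise_smul _ _ _ trivial)]
      rfl

lemma ofList_cons_pow_smul_quot (N : Type v) [AddCommGroup N] [Module R N] (x : R) (rs : List R)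
    (n : ℕ) : ((Ideal.ofList (x :: rs)) ^ n • ⊤ : Submodule R (QuotSMulTop x N)) =
      (Ideal.ofList rs) ^ n • ⊤ := by
  induction n with
  | zero => simp
  | succ n ih =>
    rw [pow_succ', pow_succ', Submodule.mul_smul, Submodule.mul_smul, ih,
      Ideal.ofList_cons_smul]
    refine sup_eq_right.mpr ?_
    rintro y ⟨z, hz, rfl⟩
    obtain ⟨z, rfl⟩ := Submodule.mkQ_surjective _ z
    have : (x • (x • ⊤ : Submodule R N).mkQ z) = 0 := by
      rw [← map_smul]
      exact (Submodule.Quotient.mk_eq_zero (x • ⊤ : Submodule R N)).mpr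
        (Submodule.smul_mem_pointwise_smul _ _ _ trivial)
    change x • (x • ⊤ : Submodule R N).mkQ z ∈ _
    rw [this]; exact zero_mem _

lemma pow_smul_le_comap_lsmul (N : Type v) [AddCommGroup N] [Module R N] {x : R} {Q : Ideal R}
    (hx : x ∈ Q) (l : ℕ) :
    (Q ^ l • ⊤ : Submodule R N) ≤
      (Q ^ (l + 1) • ⊤ : Submodule R N).comap (LinearMap.lsmul R N x) := by
  intro y hy
  rw [Submodule.mem_comap, LinearMap.lsmul_apply, pow_succ', Submodule.mul_smul]
  exact Submodule.smul_mem_smul hx hy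

lemma length_quot_pow_le (rs : List R) : ∀ (N : Type v) [AddCommGroup N] [Module R N] (b : ℕ∞),
    Module.length R (N ⧸ (Ideal.ofList rs • ⊤ : Submodule R N)) ≤ b → ∀ l : ℕ,
    Module.length R (N ⧸ ((Ideal.ofList rs) ^ (l + 1) • ⊤ : Submodule R N)) ≤
      b * ((l + rs.length).choose rs.length : ℕ) := by
  induction rs with
  | nil => 
    intro N _ _ b hb l
    have : Ideal.ofList ([] : List R) ^ (l + 1) = Ideal.ofList [] := by simp
    rw [this]
    simpa using hb
  | cons x rs ih =>
    intro N _ _ b hb l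
    have hb1 : Module.length R (QuotSMulTop x N ⧸
        (Ideal.ofList rs • ⊤ : Submodule R (QuotSMulTop x N))) ≤ b := by
      have := length_quot_smul_eq_add N x (Ideal.ofList (x :: rs))
      have h1 := ofList_cons_pow_smul_quot N x rs 1
      rw [pow_one, pow_one] at h1
      rw [h1] at this
      exact le_trans (by rw [this]; exact le_add_self) hb
    induction l with
    | zero => rw [zero_add, pow_one]; simpa using hb
    | succ l ihl =>
      rw [length_quot_smul_eq_add N x, ofList_cons_pow_smul_quot]
      have e1 := (length_quot_le_of_le (pow_smul_le_comap_lsmul N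
        (Q := Ideal.ofList (x :: rs)) (x := x) (Ideal.subset_span (by simp)) (l + 1))).trans ihl
      have e2 := ih (QuotSMulTop x N) b hb1 (l + 1)
      refine (add_le_add e1 e2).trans ?_
      rw [← mul_add, List.length_cons]
      refine le_of_eq ?_
      congr 1
      norm_cast
      rw [show l + 1 + (rs.length + 1) = (l + 1 + rs.length) + 1 by ring, Nat.choose_succ_succ,
        show l + (rs.length + 1) = l + 1 + rs.length by ring, add_comm]

/-- A numerical criterion for regular sequences. -/
theorem isWeaklyRegular_of_length [IsLocalRing R] [IsNoetherianRing R] (rs : List R)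
    (hrs : ∀ x ∈ rs, x ∈ maximalIdeal R) : ∀ (N : Type v) [AddCommGroup N] [Module R N]
    [Module.Finite R N] (b : ℕ),
    Module.length R (N ⧸ (Ideal.ofList rs • ⊤ : Submodule R N)) ≤ b → (∀ l : ℕ,
    (b * (l + rs.length).choose rs.length : ℕ) ≤
    Module.length R (N ⧸ ((Ideal.ofList rs) ^ (l + 1) • ⊤ : Submodule R N))) →
    IsWeaklyRegular N rs := by
  induction rs with
  | nil => intro N _ _ _ b _ _; exact IsWeaklyRegular.nil R N
  | cons x rs ih =>
    intro N _ _ _ b hb hlow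
    have hup := length_quot_pow_le _ N _ hb
    have h1 := ofList_cons_pow_smul_quot N x rs 1
    rw [pow_one, pow_one] at h1
    have hxQ : x ∈ Ideal.ofList (x :: rs) := Ideal.subset_span (by simp)
    have hb1 : Module.length R (QuotSMulTop x N ⧸
        (Ideal.ofList rs • ⊤ : Submodule R (QuotSMulTop x N))) ≤ b := by
      have := length_quot_smul_eq_add N x (Ideal.ofList (x :: rs))
      rw [h1] at this
      exact le_trans (by rw [this]; exact le_add_self) hb
    have hup1 := length_quot_pow_le _ (QuotSMulTop x N) _ hb1
    have pascal : ∀ l : ℕ, b * (l + 1 + (x :: rs).length).choose (x :: rs).length =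
        b * (l + (x :: rs).length).choose (x :: rs).length +
        b * (l + 1 + rs.length).choose rs.length := by
      intro l
      rw [← mul_add, List.length_cons, show l + 1 + (rs.length + 1) = (l + 1 + rs.length) + 1 by
        ring, Nat.choose_succ_succ, show l + (rs.length + 1) = l + 1 + rs.length by ring, add_comm]
    have key : ∀ l : ℕ,
        (b * (l + (x :: rs).length).choose (x :: rs).length : ℕ) ≤ Module.length R (N ⧸
          ((Ideal.ofList (x :: rs)) ^ (l + 2) • ⊤ : Submodule R N).comap
            (LinearMap.lsmul R N x)) ∧
        (b * (l + 1 + rs.length).choose rs.length : ℕ) ≤ Module.length R (QuotSMulTop x N ⧸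
          ((Ideal.ofList rs) ^ (l + 2) • ⊤ : Submodule R (QuotSMulTop x N))) := by
      intro l
      have a1 := hlow (l + 1)
      rw [pascal, length_quot_smul_eq_add N x, ofList_cons_pow_smul_quot] at a1
      have a2 := (length_quot_le_of_le (pow_smul_le_comap_lsmul N
        (Q := Ideal.ofList (x :: rs)) hxQ (l + 1))).trans (hup l)
      have a3 := hup1 (l + 1)
      obtain ⟨p, hp⟩ := ENat.ne_top_iff_exists.mp (ne_top_of_le_ne_top
        (by rw [← Nat.cast_mul]; exact ENat.natCast_ne_top _) a2)
      obtain ⟨q, hq⟩ := ENat.ne_top_iff_exists.mp (ne_top_of_le_ne_top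
        (by rw [← Nat.cast_mul]; exact ENat.natCast_ne_top _) a3)
      rw [show l + 2 = l + 1 + 1 by ring]
      rw [← hp, ← hq] at a1 ⊢
      rw [← hp] at a2
      rw [← hq] at a3
      norm_cast at a1 a2 a3 ⊢
      omega
    have hcomap : ∀ l : ℕ, ((Ideal.ofList (x :: rs)) ^ (l + 1) • ⊤ : Submodule R N) =
        ((Ideal.ofList (x :: rs)) ^ (l + 2) • ⊤ : Submodule R N).comap
            (LinearMap.lsmul R N x) := by
      intro l
      have hle := pow_smul_le_comap_lsmul N (Q := Ideal.ofList (x :: rs)) hxQ (l + 1)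
      refine eq_of_length_quot_le hle ?_ ?_
      · exact ne_top_of_le_ne_top (by rw [← Nat.cast_mul]; exact ENat.natCast_ne_top _)
          ((length_quot_le_of_le hle).trans (hup l))
      · refine (hup l).trans ?_
        exact_mod_cast (key l).1
    have hQm : Ideal.ofList (x :: rs) ≤ maximalIdeal R := Ideal.span_le.mpr hrs
    refine IsWeaklyRegular.cons ?_ ?_
    · rw [isSMulRegular_iff_right_eq_zero_of_smul]
      intro n hn
      have hmem : ∀ l : ℕ, n ∈ ((Ideal.ofList (x :: rs)) ^ (l + 1) • ⊤ : Submodule R N) := by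
        intro l
        rw [hcomap, Submodule.mem_comap, LinearMap.lsmul_apply, hn]
        exact zero_mem _
      have hinf := Ideal.iInf_pow_smul_eq_bot_of_isLocalRing (M := N)
        (Ideal.ofList (x :: rs)) (ne_top_of_le_ne_top (Ideal.IsPrime.ne_top inferInstance) hQm)
      rw [← Submodule.mem_bot (R := R), ← hinf, Submodule.mem_iInf]
      intro l
      exact Submodule.smul_mono_left (Ideal.pow_le_pow_right (Nat.le_succ l)) (hmem l)
    · refine ih (fun y hy => hrs y (List.mem_cons_of_mem _ hy)) (QuotSMulTop x N) b hb1 ?_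
      intro l
      cases l with
      | zero =>
        have a1 := hlow 0
        rw [length_quot_smul_eq_add N x, ofList_cons_pow_smul_quot] at a1
        have : (((Ideal.ofList (x :: rs)) ^ (0 + 1) • ⊤ : Submodule R N).comap
            (LinearMap.lsmul R N x)) = ⊤ := by
          refine eq_top_iff.mpr (le_trans ?_ (pow_smul_le_comap_lsmul N hxQ 0))
          simp
        rw [this, Module.length_eq_zero (M := N ⧸ (⊤ : Submodule R N)), zero_add] at a1
        simpa using a1
      | succ l => exact (key l).2

end NumericCM

end VanHilb

namespace VanHilb

section Bridge

open CategoryTheory Opposite Limits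

variable {R : Type} [CommRing R]

lemma extMk_zero_degree_eq_zero {X Y : ModuleCat.{0} R} (P : ProjectiveResolution X)
    (f : P.complex.X 0 ⟶ Y) (hf : P.complex.d 1 0 ≫ f = 0)
    (h : P.extMk f 1 rfl hf = (0 : Abelian.Ext.{0} X Y 0)) : f = 0 := by
  simp only [← P.extEquivCohomologyClass.apply_eq_iff_eq,
    ProjectiveResolution.extEquivCohomologyClass_extMk,
    ProjectiveResolution.extEquivCohomologyClass_zero,
    CochainComplex.HomComplex.CohomologyClass.mk_eq_zero_iff] at h
  rw [CochainComplex.HomComplex.Cocycle.toSingleMk_mem_coboundaries_iff _ _ _ _ _ 1 (by simp)] at h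
  obtain ⟨g, hg⟩ := h
  have : P.cochainComplex.d (-(0 : ℕ)) 1 = 0 := by
    refine (P.cochainComplex.isZero_of_isStrictlyLE 0 1 (by lia)).eq_of_tgt _ _
  rw [this, zero_comp] at hg
  rw [← cancel_epi (P.cochainComplexXIso (-(0 : ℕ)) 0 rfl).hom, ← hg, comp_zero]

lemma ext_map_eq_zero {X Y : ModuleCat.{0} R} (n : ℕ)
    (x : ((_root_.Ext R (ModuleCat.{0} R) n).obj (op X)).obj Y) :
    ∃ z : Abelian.Ext.{0} X Y n, ∀ (X' : ModuleCat.{0} R) (g : X' ⟶ X),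
      (Abelian.Ext.mk₀ g).comp z (zero_add n) = 0 →
      ((((_root_.Ext R (ModuleCat.{0} R) n).map g.op).app Y).hom x) = 0 := by
  let F := ((linearYoneda R (ModuleCat.{0} R)).obj Y).rightOp
  let P := projectiveResolution X
  let K := (F.mapHomologicalComplex _).obj P.complex
  let iX := P.isoLeftDerivedObj F n
  let x1 : (K.homology n).unop := iX.inv.unop.hom x
  have hx1 : iX.hom.unop.hom x1 = x := by
    change (iX.inv.unop ≫ iX.hom.unop).hom x = x
    rw [← unop_comp, Iso.hom_inv_id]; rfl
  obtain ⟨w, hw⟩ := (ModuleCat.epi_iff_surjective (K.homologyι n).unop).mp inferInstance x1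
  let f : P.complex.X n ⟶ Y := ((K.pOpcycles n).unop.hom w : (K.X n).unop)
  have hf : P.complex.d (n + 1) n ≫ f = 0 := by
    have h1 : (K.pOpcycles n).unop ≫ (K.d (n + 1) n).unop = 0 := by
      rw [← unop_comp, K.d_pOpcycles, unop_zero]
    exact congrArg (fun h => h.hom w) h1
  refine ⟨P.extMk f (n + 1) rfl hf, fun X' g hg => ?_⟩
  let P' := projectiveResolution X'
  let φ : ProjectiveResolution.Hom P' P g := ⟨ProjectiveResolution.lift g P' P, by
    simpa using ProjectiveResolution.lift_commutes_zero g P' P⟩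
  have hφ : φ.hom.f 0 ≫ P.π.f 0 = P'.π.f 0 ≫ g := by
    simpa using φ.hom_f_zero_comp_π_f_zero
  rw [ProjectiveResolution.mk₀_comp_extMk _ _ _ _ φ] at hg
  let K' := (F.mapHomologicalComplex _).obj P'.complex
  let iX' := P'.isoLeftDerivedObj F n
  let ψ : K' ⟶ K := (F.mapHomologicalComplex _).map φ.hom
  have nat := ProjectiveResolution.isoLeftDerivedObj_hom_naturality g P' P φ.hom hφ F n
  have key : (HomologicalComplex.homologyMap ψ n).unop.hom x1 = 0 := by
    rw [← hw]
    have e1 : (K.homologyι n).unop ≫ (HomologicalComplex.homologyMap ψ n).unop =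
        (HomologicalComplex.opcyclesMap ψ n).unop ≫ (K'.homologyι n).unop := by
      rw [← unop_comp, ← unop_comp, HomologicalComplex.homologyι_naturality]
    have e2 : (K.pOpcycles n).unop ≫ (ψ.f n).unop =
        (HomologicalComplex.opcyclesMap ψ n).unop ≫ (K'.pOpcycles n).unop := by
      rw [← unop_comp, ← unop_comp, HomologicalComplex.p_opcyclesMap]
    have e3 : (K'.pOpcycles n).unop.hom ((HomologicalComplex.opcyclesMap ψ n).unop.hom w) =
        (φ.hom.f n ≫ f : P'.complex.X n ⟶ Y) :=
      (congrArg (fun h => h.hom w) e2).symm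
    have inj := (ModuleCat.mono_iff_injective (K'.pOpcycles n).unop).mp inferInstance
    refine (congrArg (fun h => h.hom w) e1).trans ?_
    change (K'.homologyι n).unop.hom ((HomologicalComplex.opcyclesMap ψ n).unop.hom w) = 0
    cases n with
    | zero =>
      have h0 := extMk_zero_degree_eq_zero P' _ _ hg
      rw [h0] at e3
      have : (HomologicalComplex.opcyclesMap ψ 0).unop.hom w = 0 := inj (e3.trans (map_zero _).symm)
      rw [this, map_zero]
    | succ n =>
      rw [P'.extMk_eq_zero_iff _ _ _ _ n rfl] at hg
      obtain ⟨u, hu⟩ := hg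
      have e4 : (K'.fromOpcycles (n + 1) n).unop ≫ (K'.pOpcycles (n + 1)).unop =
        (K'.d (n + 1) n).unop := by
        rw [← unop_comp, HomologicalComplex.p_fromOpcycles]
      have e5 : (HomologicalComplex.opcyclesMap ψ (n + 1)).unop.hom w =
          (K'.fromOpcycles (n + 1) n).unop.hom u := by
        apply inj
        refine e3.trans ?_
        rw [← hu]
        exact (congrArg (fun h => h.hom u) e4).symm
      have e6 : (K'.fromOpcycles (n + 1) n).unop ≫ (K'.homologyι (n + 1)).unop = 0 := by
        rw [← unop_comp, HomologicalComplex.homologyι_comp_fromOpcycles, unop_zero]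
      rw [e5]
      exact congrArg (fun h => h.hom u) e6
  have nat' : (P.isoLeftDerivedObj F n).hom.unop ≫ ((F.leftDerived n).map g).unop =
      (HomologicalComplex.homologyMap ψ n).unop ≫ iX'.hom.unop := by
    rw [← unop_comp, nat]; rfl
  rw [← hx1]
  refine (congrArg (fun h => h.hom x1) nat').trans ?_
  change iX'.hom.unop.hom ((HomologicalComplex.homologyMap ψ n).unop.hom x1) = 0
  rw [key]
  exact map_zero _

/-- Every class in `Ext^i(R/I^n, Y)` dies in some `Ext^i(R/I^n', Y)`. -/
def LCVan (I : Ideal R) (i : ℕ) (Y : Type) [AddCommGroup Y] [Module R Y] : Prop :=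
  ∀ (n : ℕ) (z : Abelian.Ext.{0} (ModuleCat.of R (R ⧸ I ^ n)) (ModuleCat.of R Y) i),
    ∃ (n' : ℕ) (h : I ^ n' ≤ I ^ n),
      (Abelian.Ext.mk₀ (ModuleCat.ofHom (Submodule.factor h))).comp z (zero_add i) = 0

lemma mk₀_factor_comp_eq_zero {I J K : Ideal R} (hJ : J ≤ I) (hK : K ≤ J)
    {Y : ModuleCat.{0} R} {i : ℕ} {z : Abelian.Ext.{0} (ModuleCat.of R (R ⧸ I)) Y i}
    (hz : (Abelian.Ext.mk₀ (ModuleCat.ofHom (Submodule.factor hJ))).comp z (zero_add i) = 0) :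
    (Abelian.Ext.mk₀ (ModuleCat.ofHom (Submodule.factor (hK.trans hJ)))).comp z (zero_add i) =
      0 := by
  have : (ModuleCat.ofHom (Submodule.factor (hK.trans hJ)) : ModuleCat.of R (R ⧸ K) ⟶ _) =
      ModuleCat.ofHom (Submodule.factor hK) ≫ ModuleCat.ofHom (Submodule.factor hJ) := by
    rw [← ModuleCat.ofHom_comp, Submodule.factor_comp]
  rw [this, ← Abelian.Ext.mk₀_comp_mk₀, Abelian.Ext.comp_assoc (a₁₂ := 0) (a₂₃ := i), hz, Abelian.Ext.comp_zero]
  · simp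
  · simp

lemma subsingleton_localCohomology_of_lcVan (I : Ideal R) (i : ℕ) (Y : Type) [AddCommGroup Y]
    [Module R Y] (h : LCVan I i Y) :
    Subsingleton ((localCohomology I i).obj (ModuleCat.of R Y)) := by
  let D := localCohomology.diagram (localCohomology.idealPowersDiagram I) i
  let c := ((evaluation _ _).obj (ModuleCat.of R Y)).mapCocone (colimit.cocone D)
  have hc : IsColimit c := isColimitOfPreserves _ (colimit.isColimit D)
  refine subsingleton_of_forall_eq 0 (fun y => ?_)
  obtain ⟨j, x, hx⟩ := Concrete.isColimit_exists_rep _ hc y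
  obtain ⟨z, hz⟩ := ext_map_eq_zero i x
  obtain ⟨n', hn, h0⟩ := h j.unop.unop z
  have hle : j.unop.unop ≤ max n' j.unop.unop := le_max_right _ _
  let j' : (ℕᵒᵖ)ᵒᵖ := op (op (max n' j.unop.unop))
  let q : j ⟶ j' := (homOfLE hle).op.op
  have h1 : ((((_root_.Ext R (ModuleCat.{0} R) i).map
      ((localCohomology.ringModIdeals (localCohomology.idealPowersDiagram I)).map
        q.unop).op).app (ModuleCat.of R Y)).hom x) = 0 :=
    hz _ _ (mk₀_factor_comp_eq_zero hn (Ideal.pow_le_pow_right (le_max_left _ _)) h0)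
  have h2 := ConcreteCategory.congr_hom (c.w q) x
  rw [← hx, ← h2]
  refine (congrArg (c.ι.app j').hom h1).trans (map_zero _)

end Bridge

section ExtVanishing

open CategoryTheory Limits RingTheory.Sequence Pointwise

variable {R : Type} [CommRing R]

/-- Pullback of an extension class along the projection `R/J → R/I`. -/
noncomputable def extPullback {I J : Ideal R} (h : J ≤ I) {Y : ModuleCat.{0} R} {i : ℕ}
    (z : Abelian.Ext.{0} (ModuleCat.of R (R ⧸ I)) Y i) :
    Abelian.Ext.{0} (ModuleCat.of R (R ⧸ J)) Y i :=
  (Abelian.Ext.mk₀ (ModuleCat.ofHom (Submodule.factor h))).comp z (zero_add i)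

lemma extPullback_extPullback {I J K : Ideal R} (hJ : J ≤ I) (hK : K ≤ J)
    {Y : ModuleCat.{0} R} {i : ℕ} (z : Abelian.Ext.{0} (ModuleCat.of R (R ⧸ I)) Y i) :
    extPullback hK (extPullback hJ z) = extPullback (hK.trans hJ) z := by
  have : (ModuleCat.ofHom (Submodule.factor (hK.trans hJ)) : ModuleCat.of R (R ⧸ K) ⟶ _) =
      ModuleCat.ofHom (Submodule.factor hK) ≫ ModuleCat.ofHom (Submodule.factor hJ) := by
    rw [← ModuleCat.ofHom_comp, Submodule.factor_comp]
  simp only [extPullback]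
  rw [this, Abelian.Ext.mk₀_comp_mk₀_assoc]

lemma extPullback_comp {I J : Ideal R} (h : J ≤ I) {Y Z : ModuleCat.{0} R} {i j l : ℕ}
    (z : Abelian.Ext.{0} (ModuleCat.of R (R ⧸ I)) Y i) (w : Abelian.Ext.{0} Y Z j)
    (e : i + j = l) : extPullback h (z.comp w e) = (extPullback h z).comp w e := by
  simp only [extPullback]
  rw [Abelian.Ext.comp_assoc (a₁₂ := i) (a₂₃ := l)]
  simpa using e

lemma extPullback_smul {I J : Ideal R} (h : J ≤ I) {Y : ModuleCat.{0} R} {i : ℕ}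
    (z : Abelian.Ext.{0} (ModuleCat.of R (R ⧸ I)) Y i) (a : R) :
    extPullback h (a • z) = a • extPullback h z := by
  simp only [extPullback, Abelian.Ext.comp_smul]

lemma extPullback_zero {I J : Ideal R} (h : J ≤ I) {Y : ModuleCat.{0} R} {i : ℕ} :
    extPullback h (0 : Abelian.Ext.{0} (ModuleCat.of R (R ⧸ I)) Y i) = 0 := by
  simp only [extPullback, Abelian.Ext.comp_zero]

lemma lcVan_of_shortExact {I : Ideal R} {i : ℕ} {A B C : Type} [AddCommGroup A] [Module R A]
    [AddCommGroup B] [Module R B] [AddCommGroup C] [Module R C] (f : A →ₗ[R] B) (g : B →ₗ[R] C)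
    (hf : Function.Injective f) (hg : Function.Surjective g) (hfg : Function.Exact f g)
    (hA : LCVan I i A) (hC : LCVan I i C) : LCVan I i B := by
  intro n z
  let S : ShortComplex (ModuleCat.{0} R) :=
    ShortComplex.mk (ModuleCat.ofHom f) (ModuleCat.ofHom g) (by
      ext x; exact hfg.apply_apply_eq_zero x)
  have hS : S.ShortExact := ModuleCat.shortComplex_shortExact S hfg hf hg
  obtain ⟨n₁, h₁, e₁⟩ := hC n (z.comp (Abelian.Ext.mk₀ S.g) (add_zero i))
  change extPullback h₁ _ = 0 at e₁
  rw [extPullback_comp] at e₁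
  obtain ⟨w, hw⟩ := Abelian.Ext.covariant_sequence_exact₂ _ hS _ e₁
  obtain ⟨n₂, h₂, e₂⟩ := hA n₁ w
  refine ⟨n₂, h₂.trans h₁, ?_⟩
  change extPullback _ z = 0
  change extPullback _ w = 0 at e₂
  rw [← extPullback_extPullback h₁ h₂, ← hw, extPullback_comp, e₂, Abelian.Ext.zero_comp]

lemma ext_smul_eq_zero_of_mem {I : Ideal R} {Y : ModuleCat.{0} R} {i : ℕ} {a : R} (ha : a ∈ I)
    (z : Abelian.Ext.{0} (ModuleCat.of R (R ⧸ I)) Y i) : a • z = 0 := by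
  have h1 : a • 𝟙 (ModuleCat.of R (R ⧸ I)) = 0 := by
    ext
    change a • (Ideal.Quotient.mk I 1) = 0
    rw [← Ideal.Quotient.mk_eq_mk, ← Submodule.Quotient.mk_smul, Submodule.Quotient.mk_eq_zero]
    simpa using ha
  have h2 := Abelian.Ext.mk₀_id_comp z
  rw [← h2, ← Abelian.Ext.smul_comp, ← Abelian.Ext.mk₀_smul, h1]
  simp

lemma lcVan_of_exists_extPullback_smul {I : Ideal R} {i : ℕ} {Y : Type} [AddCommGroup Y]
    [Module R Y] {x : R} (hx : x ∈ I)
    (H : ∀ (n : ℕ) (z : Abelian.Ext.{0} (ModuleCat.of R (R ⧸ I ^ n)) (ModuleCat.of R Y) i),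
      x • z = 0 → ∃ (n' : ℕ) (h : I ^ n' ≤ I ^ n), extPullback h z = 0) : LCVan I i Y := by
  have key : ∀ (m n : ℕ) (z : Abelian.Ext.{0} (ModuleCat.of R (R ⧸ I ^ n)) (ModuleCat.of R Y) i),
      x ^ m • z = 0 → ∃ (n' : ℕ) (h : I ^ n' ≤ I ^ n), extPullback h z = 0 := by
    intro m
    induction m with
    | zero =>
      intro n z hz
      rw [pow_zero, one_smul] at hz
      exact ⟨n, le_rfl, by rw [hz, extPullback_zero]⟩
    | succ m ih =>
      intro n z hz
      obtain ⟨n₁, h₁, e₁⟩ := H n (x ^ m • z) (by rwa [smul_smul, ← pow_succ'])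
      rw [extPullback_smul] at e₁
      obtain ⟨n₂, h₂, e₂⟩ := ih n₁ _ e₁
      exact ⟨n₂, h₂.trans h₁, by rw [← e₂, extPullback_extPullback]⟩
  intro n z
  exact key n n z (ext_smul_eq_zero_of_mem (Ideal.pow_mem_pow hx n) z)

lemma ext_comp_mk₀_lsmul {X : ModuleCat.{0} R} {U : Type} [AddCommGroup U] [Module R U] {i : ℕ}
    (x : R) (z : Abelian.Ext.{0} X (ModuleCat.of R U) i) :
    z.comp (Abelian.Ext.mk₀ (ModuleCat.ofHom (LinearMap.lsmul R U x))) (add_zero i) = x • z := by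
  have : (ModuleCat.ofHom (LinearMap.lsmul R U x) : ModuleCat.of R U ⟶ ModuleCat.of R U) =
      x • 𝟙 (ModuleCat.of R U) := rfl
  rw [this, Abelian.Ext.mk₀_smul, Abelian.Ext.comp_smul, Abelian.Ext.comp_mk₀_id]

lemma lcVan_zero_of_isSMulRegular {I : Ideal R} {U : Type} [AddCommGroup U] [Module R U] {x : R}
    (hx : x ∈ I) (hreg : IsSMulRegular U x) : LCVan I 0 U := by
  refine lcVan_of_exists_extPullback_smul hx (fun n z hz => ⟨n, le_rfl, ?_⟩)
  have : Mono (ModuleCat.ofHom (LinearMap.lsmul R U x)) :=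
    (ModuleCat.mono_iff_injective _).mpr hreg
  have inj := Abelian.Ext.postcomp_mk₀_injective_of_mono (ModuleCat.of R (R ⧸ I ^ n))
    (ModuleCat.ofHom (LinearMap.lsmul R U x))
  have : z = 0 := by
    apply inj
    simp only [Abelian.Ext.postcomp]
    simpa using (ext_comp_mk₀_lsmul x z).trans hz
  rw [this, extPullback_zero]

lemma lcVan_succ_of_isSMulRegular {I : Ideal R} {U : Type} [AddCommGroup U] [Module R U] {x : R}
    (hx : x ∈ I) (hreg : IsSMulRegular U x) {i : ℕ} (h : LCVan I i (QuotSMulTop x U)) :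
    LCVan I (i + 1) U := by
  refine lcVan_of_exists_extPullback_smul hx (fun n z hz => ?_)
  let S : ShortComplex (ModuleCat.{0} R) :=
    ShortComplex.mk (ModuleCat.ofHom (LinearMap.lsmul R U x))
      (ModuleCat.ofHom (Submodule.mkQ (x • (⊤ : Submodule R U)))) (by
      ext u
      exact (Submodule.Quotient.mk_eq_zero _).mpr (Submodule.smul_mem_pointwise_smul u x ⊤ trivial))
  have hS : S.ShortExact := ModuleCat.shortComplex_shortExact S (by
    intro u
    change Submodule.Quotient.mk u = 0 ↔ _
    rw [Submodule.Quotient.mk_eq_zero, Submodule.mem_smul_pointwise_iff_exists]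
    simp [S]) hreg (Submodule.mkQ_surjective _)
  obtain ⟨w, hw⟩ := Abelian.Ext.covariant_sequence_exact₁ _ hS z
    ((ext_comp_mk₀_lsmul x z).trans hz) (n₀ := i) rfl
  obtain ⟨n', h', e'⟩ := h n w
  change extPullback _ w = 0 at e'
  exact ⟨n', h', by rw [← hw, extPullback_comp, e', Abelian.Ext.zero_comp]⟩

lemma lcVan_of_isWeaklyRegular {I : Ideal R} (rs : List R) (hrs : ∀ x ∈ rs, x ∈ I) :
    ∀ (N : Type) [AddCommGroup N] [Module R N], IsWeaklyRegular N rs →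
    ∀ i < rs.length, LCVan I i N := by
  induction rs with
  | nil => intro N _ _ _ i hi; simp at hi
  | cons x xs ih =>
    intro N _ _ hN i hi
    rw [isWeaklyRegular_cons_iff] at hN
    cases i with
    | zero => exact lcVan_zero_of_isSMulRegular (hrs x (by simp)) hN.1
    | succ i =>
      exact lcVan_succ_of_isSMulRegular (hrs x (by simp)) hN.1
        (ih (fun y hy => hrs y (by simp [hy])) _ hN.2 i (by simpa using hi))

end ExtVanishing

section Torsion

open CategoryTheory Limits

variable {R : Type} [CommRing R]

/-- The `I`-power torsion submodule. -/
def powTors (I : Ideal R) (E : Type*) [AddCommGroup E] [Module R E] : Submodule R E where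
  carrier := {e | ∃ n : ℕ, ∀ a ∈ I ^ n, a • e = 0}
  zero_mem' := ⟨0, fun a _ => smul_zero a⟩
  add_mem' := by
    rintro u v ⟨m, hm⟩ ⟨n, hn⟩
    refine ⟨m + n, fun a ha => ?_⟩
    rw [smul_add, hm a (Ideal.pow_le_pow_right (by lia) ha),
      hn a (Ideal.pow_le_pow_right (by lia) ha), add_zero]
  smul_mem' := by
    rintro c u ⟨m, hm⟩
    exact ⟨m, fun a ha => by rw [smul_comm, hm a ha, smul_zero]⟩

lemma injective_powTors [IsNoetherianRing R] (I : Ideal R) (E : Type) [AddCommGroup E]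
    [Module R E] [hE : Module.Injective R E] : Module.Injective R (powTors I E) := by
  refine Module.Baer.injective (fun J f => ?_)
  obtain ⟨n, hn⟩ : ∃ n : ℕ, ∀ a ∈ I ^ n, ∀ j : J, a • f j = 0 := by
    obtain ⟨s, hs⟩ := (inferInstance : Module.Finite R J)
    have h1 : ∀ j : J, ∃ n : ℕ, ∀ a ∈ I ^ n, a • f j = 0 := fun j => by
      obtain ⟨n, hn⟩ := (f j).2
      exact ⟨n, fun a ha => Subtype.ext (hn a ha)⟩
    choose N hN using h1
    refine ⟨s.sup N, fun a ha j => ?_⟩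
    have : j ∈ Submodule.span R (s : Set J) := hs ▸ Submodule.mem_top
    induction this using Submodule.span_induction with
    | mem x hx => exact hN x a (Ideal.pow_le_pow_right (Finset.le_sup hx) ha)
    | zero => rw [map_zero, smul_zero]
    | add x y _ _ hx hy => rw [map_add, smul_add, hx, hy, add_zero]
    | smul c x _ hx => rw [map_smul, smul_comm, hx, smul_zero]
  obtain ⟨k, hk⟩ := Ideal.exists_pow_inf_eq_pow_smul I (J : Submodule R R)
  have hle : I ^ (n + k) ⊓ J ≤ I ^ n • J := by
    have := (hk (n + k) (by lia)).le
    rw [Ideal.smul_eq_mul, Ideal.mul_top, Nat.add_sub_cancel] at this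
    exact this.trans (Submodule.smul_mono le_rfl inf_le_right)
  have hker : Submodule.comap (Submodule.subtype J) (I ^ (n + k)) ≤ LinearMap.ker f := by
    intro j hj
    have hj' : (j : R) ∈ I ^ n • J := hle ⟨hj, j.2⟩
    have : j ∈ I ^ n • (⊤ : Submodule R J) := by
      rw [← Submodule.comap_map_eq_of_injective J.injective_subtype (I ^ n • ⊤),
        Submodule.map_smul'', Submodule.map_top, Submodule.range_subtype]
      exact hj'
    rw [LinearMap.mem_ker]
    refine Submodule.smul_induction_on this (fun a ha x _ => ?_) (fun x y hx hy => ?_)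
    · rw [map_smul, hn a ha]
    · rw [map_add, hx, hy, add_zero]
  let K : Submodule R J := Submodule.comap (Submodule.subtype J) (I ^ (n + k))
  let φ : (J ⧸ K) →ₗ[R] (R ⧸ I ^ (n + k)) := K.mapQ (I ^ (n + k)) J.subtype le_rfl
  have hφ : Function.Injective φ := by
    rw [← LinearMap.ker_eq_bot, Submodule.ker_mapQ]
    exact K.mkQ_map_self
  obtain ⟨h, hh⟩ := hE.out φ hφ ((powTors I E).subtype ∘ₗ K.liftQ f hker)
  refine ⟨LinearMap.codRestrict (powTors I E) (h ∘ₗ Submodule.mkQ (I ^ (n + k)))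
    (fun c => ⟨n + k, fun a ha => ?_⟩), fun x hx => ?_⟩
  · rw [← map_smul]
    have : (Submodule.mkQ (I ^ (n + k))) (a • c) = 0 := by
      rw [Submodule.mkQ_apply, Submodule.Quotient.mk_eq_zero]
      exact Ideal.mul_mem_right _ _ ha
    rw [LinearMap.comp_apply, this, map_zero]
  · apply Subtype.ext
    exact hh (K.mkQ ⟨x, hx⟩)

lemma exists_torsion_injective [IsNoetherianRing R] (I : Ideal R) (T : Type) [AddCommGroup T]
    [Module R T] (hT : powTors I T = ⊤) :
    ∃ (G : ModuleCat.{0} R) (f : T →ₗ[R] G), Function.Injective f ∧ Injective G ∧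
      powTors I G = ⊤ := by
  obtain ⟨⟨E, hE, j, hj⟩⟩ := EnoughInjectives.presentation (ModuleCat.of R T)
  have hE' := Module.injective_module_of_injective_object R E
  have hinj := injective_powTors I E
  refine ⟨ModuleCat.of R (powTors I E), LinearMap.codRestrict _ j.hom (fun t => ?_), ?_,
    Module.injective_object_of_injective_module R _, ?_⟩
  · obtain ⟨n, hn⟩ : t ∈ powTors I T := hT ▸ Submodule.mem_top
    exact ⟨n, fun a ha => by rw [← map_smul]; exact (congrArg _ (hn a ha)).trans (map_zero _)⟩
  · intro a b hab
    exact (ModuleCat.mono_iff_injective j).mp hj (congrArg Subtype.val hab)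
  · rw [eq_top_iff]
    rintro ⟨u, n, hn⟩ -
    exact ⟨n, fun a ha => Subtype.ext (hn a ha)⟩

lemma powTors_quotient_eq_top (I : Ideal R) {G : Type} [AddCommGroup G] [Module R G]
    (hG : powTors I G = ⊤) (K : Submodule R G) : powTors I (G ⧸ K) = ⊤ := by
  rw [eq_top_iff]
  intro x _
  obtain ⟨g, rfl⟩ := K.mkQ_surjective x
  obtain ⟨n, hn⟩ : g ∈ powTors I G := hG ▸ Submodule.mem_top
  exact ⟨n, fun a ha => by rw [← map_smul, hn a ha, map_zero]⟩

lemma lcVan_succ_of_powTors_eq_top [IsNoetherianRing R] (I : Ideal R) (i : ℕ) :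
    ∀ (T : Type) [AddCommGroup T] [Module R T], powTors I T = ⊤ → LCVan I (i + 1) T := by
  induction i with
  | zero =>
    intro T _ _ hT n z
    obtain ⟨G, f, hf, hGinj, hG⟩ := exists_torsion_injective I T hT
    let S : ShortComplex (ModuleCat.{0} R) :=
      ShortComplex.mk (ModuleCat.ofHom f : ModuleCat.of R T ⟶ G)
        (ModuleCat.ofHom (LinearMap.range f).mkQ : G ⟶ ModuleCat.of R (G ⧸ LinearMap.range f)) (by
        ext x
        exact (Submodule.Quotient.mk_eq_zero _).mpr ⟨x, rfl⟩)
    have hS : S.ShortExact := ModuleCat.shortComplex_shortExact S (by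
      intro u
      exact Submodule.Quotient.mk_eq_zero _) hf (Submodule.mkQ_surjective _)
    obtain ⟨w, hw⟩ := Abelian.Ext.covariant_sequence_exact₁ _ hS z
      (Abelian.Ext.eq_zero_of_injective _) (n₀ := 0) rfl
    obtain ⟨φ, rfl⟩ : ∃ φ, Abelian.Ext.mk₀ φ = w := ⟨_, Abelian.Ext.mk₀_homEquiv₀_apply w⟩
    obtain ⟨g, hg⟩ := (LinearMap.range f).mkQ_surjective (φ.hom (Submodule.Quotient.mk 1))
    obtain ⟨m, hm⟩ : g ∈ powTors I G := hG ▸ Submodule.mem_top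
    have hle : I ^ (max m n) ≤ I ^ n := Ideal.pow_le_pow_right (le_max_right _ _)
    let ψ : (R ⧸ I ^ (max m n)) →ₗ[R] G := Submodule.liftQ _ (LinearMap.toSpanSingleton R G g)
      (fun a ha => hm a (Ideal.pow_le_pow_right (le_max_left _ _) ha))
    refine ⟨max m n, hle, ?_⟩
    have hcomm : ModuleCat.ofHom (Submodule.factor hle) ≫ φ = ModuleCat.ofHom ψ ≫ S.g := by
      ext
      change φ.hom (Submodule.Quotient.mk 1) = (LinearMap.range f).mkQ ((1 : R) • g)
      rw [one_smul, hg]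
    change extPullback hle z = 0
    rw [← hw, extPullback_comp, extPullback, Abelian.Ext.mk₀_comp_mk₀, hcomm,
      ← Abelian.Ext.mk₀_comp_mk₀, Abelian.Ext.comp_assoc (a₁₂ := 0) (a₂₃ := 1),
      hS.comp_extClass, Abelian.Ext.comp_zero]
    all_goals rfl
  | succ i ih =>
    intro T _ _ hT n z
    obtain ⟨G, f, hf, hGinj, hG⟩ := exists_torsion_injective I T hT
    let S : ShortComplex (ModuleCat.{0} R) :=
      ShortComplex.mk (ModuleCat.ofHom f : ModuleCat.of R T ⟶ G)
        (ModuleCat.ofHom (LinearMap.range f).mkQ : G ⟶ ModuleCat.of R (G ⧸ LinearMap.range f)) (by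
        ext x
        exact (Submodule.Quotient.mk_eq_zero _).mpr ⟨x, rfl⟩)
    have hS : S.ShortExact := ModuleCat.shortComplex_shortExact S (by
      intro u
      exact Submodule.Quotient.mk_eq_zero _) hf (Submodule.mkQ_surjective _)
    obtain ⟨w, hw⟩ := Abelian.Ext.covariant_sequence_exact₁ _ hS z
      (Abelian.Ext.eq_zero_of_injective _) (n₀ := i + 1) rfl
    obtain ⟨n', h', e'⟩ := ih (G ⧸ LinearMap.range f) (powTors_quotient_eq_top I hG _) n w
    change extPullback _ w = 0 at e'
    refine ⟨n', h', ?_⟩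
    change extPullback h' z = 0
    rw [← hw, extPullback_comp, e', Abelian.Ext.zero_comp]

end Torsion

section Grothendieck

open Pointwise

lemma lt_of_add_one_lt_natCast_add_one {d : WithBot ℕ∞} {t : ℕ}
    (h : d + 1 < ((t + 1 : ℕ) : WithBot ℕ∞)) : d < (t : WithBot ℕ∞) := by
  induction d with
  | bot => exact WithBot.bot_lt_coe _
  | coe d =>
    induction d with
    | top =>
      have h2 : (⊤ : ℕ∞) + 1 < ((t + 1 : ℕ) : ℕ∞) := by exact_mod_cast h
      simp at h2
    | coe d =>
      have : ((d + 1 : ℕ) : WithBot ℕ∞) < ((t + 1 : ℕ) : WithBot ℕ∞) := by exact_mod_cast h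
      have h2 : d + 1 < t + 1 := by exact_mod_cast this
      exact_mod_cast (by lia : d < t)

lemma eq_bot_of_lt_natCast_zero {d : WithBot ℕ∞} (h : d < ((0 : ℕ) : WithBot ℕ∞)) : d = ⊥ := by
  induction d with
  | bot => rfl
  | coe d =>
    have h2 : d < ((0 : ℕ) : ℕ∞) := by exact_mod_cast h
    simp at h2

lemma lcVan_of_subsingleton {R : Type} [CommRing R] [IsNoetherianRing R] (I : Ideal R) (i : ℕ)
    (U : Type) [AddCommGroup U] [Module R U] [Subsingleton U] : LCVan I i U := by
  cases i with
  | zero => exact lcVan_zero_of_isSMulRegular I.zero_mem (fun a b _ => Subsingleton.elim a b)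
  | succ i =>
    exact lcVan_succ_of_powTors_eq_top I i U (Subsingleton.elim _ _)

lemma lcVan_congr {R : Type} [CommRing R] [IsNoetherianRing R] {I : Ideal R} {i : ℕ} {U V : Type}
    [AddCommGroup U] [Module R U] [AddCommGroup V] [Module R V] (e : U ≃ₗ[R] V)
    (h : LCVan I i U) : LCVan I i V :=
  lcVan_of_shortExact e.toLinearMap (0 : V →ₗ[R] PUnit.{1}) e.injective
    (fun _ => ⟨0, Subsingleton.elim _ _⟩)
    (fun v => ⟨fun _ => e.surjective v, fun _ => rfl⟩) h (lcVan_of_subsingleton I i _)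

variable {R S : Type} [CommRing R] [CommRing S] [IsLocalRing R] [IsLocalRing S]
  [IsNoetherianRing S] [Algebra R S]

lemma exists_mem_maximalIdeal_isSMulRegular
    (hRS : (maximalIdeal R).map (algebraMap R S) = maximalIdeal S)
    (U : Type) [AddCommGroup U] [Module S U] [Module.Finite S U] :
    ∃ x ∈ maximalIdeal R, IsSMulRegular (U ⧸ powTors (maximalIdeal S) U) (algebraMap R S x) := by
  by_contra! hcon
  set V := U ⧸ powTors (maximalIdeal S) U
  have hsub : ((maximalIdeal R : Ideal R) : Set R) ⊆
      ⋃ p ∈ associatedPrimes S V, ((p.comap (algebraMap R S) : Ideal R) : Set R) := by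
    intro x hx
    have h1 : algebraMap R S x ∈ ⋃ p ∈ associatedPrimes S V, (p : Set S) := by
      rw [biUnion_associatedPrimes_eq_compl_regular]
      exact hcon x hx
    simpa using h1
  rw [Ideal.subset_union_prime_finite (associatedPrimes.finite S V) ⊥ ⊥
    (fun p hp _ _ => (hp.isPrime).comap (algebraMap R S))] at hsub
  obtain ⟨p, hp, hle⟩ := hsub
  have hpm : p = maximalIdeal S := by
    refine le_antisymm (le_maximalIdeal hp.isPrime.ne_top) ?_
    rw [← hRS]
    exact Ideal.map_le_iff_le_comap.mpr hle
  obtain ⟨hp1, f, hf⟩ := (isAssociatedPrime_iff_exists_injective_linearMap p V).mp hp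
  obtain ⟨u, hu⟩ := Submodule.Quotient.mk_surjective _ (f (Submodule.Quotient.mk 1))
  have hmem : ∀ a ∈ maximalIdeal S, a • u ∈ powTors (maximalIdeal S) U := by
    intro a ha
    rw [← Submodule.Quotient.mk_eq_zero, Submodule.Quotient.mk_smul, hu, ← map_smul]
    have : a • (Submodule.Quotient.mk 1 : S ⧸ p) = 0 := by
      rw [← Submodule.Quotient.mk_smul, Submodule.Quotient.mk_eq_zero, hpm]
      simpa using ha
    rw [this, map_zero]
  obtain ⟨s, hs⟩ := (IsNoetherian.noetherian (maximalIdeal S) : (maximalIdeal S).FG)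
  have hu0 : u ∈ powTors (maximalIdeal S) U := by
    have : ∀ a : S, ∃ n : ℕ, a ∈ s → ∀ b ∈ maximalIdeal S ^ n, b • (a • u) = 0 := by
      intro a
      by_cases ha : a ∈ s
      · obtain ⟨n, hn⟩ := hmem a (hs ▸ Ideal.subset_span ha)
        exact ⟨n, fun _ => hn⟩
      · exact ⟨0, fun h => absurd h ha⟩
    choose N hN using this
    refine ⟨s.sup N + 1, fun b hb => ?_⟩
    rw [pow_succ] at hb
    refine Submodule.mul_induction_on hb (fun c hc d hd => ?_) (fun x y hx hy => ?_)
    · rw [mul_smul]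
      rw [← hs] at hd
      induction hd using Submodule.span_induction with
      | mem x hx => exact hN x hx c (Ideal.pow_le_pow_right (Finset.le_sup hx) hc)
      | zero => simp
      | add x y _ _ hx hy => rw [add_smul, smul_add, hx, hy, add_zero]
      | smul e x _ hx => rw [smul_assoc, smul_comm, hx, smul_zero]
    · rw [add_smul, hx, hy, add_zero]
  rw [← Submodule.Quotient.mk_eq_zero, hu] at hu0
  have h3 := hf (hu0.trans (map_zero f).symm)
  rw [Submodule.Quotient.mk_eq_zero] at h3
  exact hp1.ne_top ((Ideal.eq_top_iff_one _).mpr h3)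

lemma lcVan_of_supportDim_lt [IsNoetherianRing R]
    (hRS : (maximalIdeal R).map (algebraMap R S) = maximalIdeal S) (t : ℕ) :
    ∀ (U : Type) [AddCommGroup U] [Module R U] [Module S U] [IsScalarTower R S U]
      [Module.Finite S U], Module.supportDim S U < (t : WithBot ℕ∞) → ∀ i ≥ t,
      LCVan (maximalIdeal R) i U := by
  induction t with
  | zero =>
    intro U _ _ _ _ _ hU i _
    have : Subsingleton U :=
      (Module.supportDim_eq_bot_iff_subsingleton S U).mp (eq_bot_of_lt_natCast_zero hU)
    exact lcVan_of_subsingleton _ i U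
  | succ t ih =>
    intro U _ _ _ _ _ hU i hi
    obtain ⟨i, rfl⟩ : ∃ j, i = j + 1 := ⟨i - 1, by lia⟩
    set T := powTors (maximalIdeal S) U with hT
    have hT' : powTors (maximalIdeal R) T = ⊤ := by
      rw [eq_top_iff]
      rintro ⟨u, n, hn⟩ -
      refine ⟨n, fun a ha => Subtype.ext ?_⟩
      change a • u = 0
      rw [← algebraMap_smul S a u]
      apply hn
      rw [← hRS, ← Ideal.map_pow]
      exact Ideal.mem_map_of_mem _ ha
    obtain ⟨x, hx, hreg⟩ := exists_mem_maximalIdeal_isSMulRegular hRS U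
    have hregR : IsSMulRegular (U ⧸ T) x := by
      intro a b hab
      apply hreg
      simpa only [algebraMap_smul] using hab
    have hxS : algebraMap R S x ∈ maximalIdeal S := hRS ▸ Ideal.mem_map_of_mem _ hx
    have hdim : Module.supportDim S (QuotSMulTop (algebraMap R S x) (U ⧸ T)) < (t : WithBot ℕ∞) := by
      apply lt_of_add_one_lt_natCast_add_one
      rw [Module.supportDim_quotSMulTop_succ_eq_supportDim hreg hxS]
      exact (Module.supportDim_le_of_surjective T.mkQ T.mkQ_surjective).trans_lt hU
    have hV := ih (QuotSMulTop (algebraMap R S x) (U ⧸ T)) hdim i (by lia)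
    let e : QuotSMulTop (algebraMap R S x) (U ⧸ T) ≃ₗ[R] QuotSMulTop x (U ⧸ T) :=
      Submodule.Quotient.equiv
        (((algebraMap R S x) • (⊤ : Submodule S (U ⧸ T))).restrictScalars R) _
        (LinearEquiv.refl R _) (by
        ext v
        simp [Submodule.mem_smul_pointwise_iff_exists])
    exact lcVan_of_shortExact (T.subtype.restrictScalars R) (T.mkQ.restrictScalars R)
      T.injective_subtype T.mkQ_surjective (by
        intro u
        simp) (lcVan_succ_of_powTors_eq_top _ i T hT')
      (lcVan_succ_of_isSMulRegular hx hregR (lcVan_congr e hV))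

end Grothendieck

section Purity

open CategoryTheory Limits

lemma mem_of_forall_mem_sup_pow_smul {R : Type*} [CommRing R] [IsLocalRing R] [IsNoetherianRing R]
    {N : Type*} [AddCommGroup N] [Module R N] [Module.Finite R N] {I : Ideal R} (hI : I ≠ ⊤)
    (B : Submodule R N) {x : N} (h : ∀ l : ℕ, x ∈ B ⊔ I ^ l • (⊤ : Submodule R N)) : x ∈ B := by
  have h0 := Ideal.iInf_pow_smul_eq_bot_of_isLocalRing (M := N ⧸ B) I hI
  rw [← Submodule.Quotient.mk_eq_zero, ← Submodule.mem_bot R, ← h0, Submodule.mem_iInf]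
  intro l
  obtain ⟨b, hb, y, hy, rfl⟩ := Submodule.mem_sup.mp (h l)
  have : (Submodule.Quotient.mk (b + y) : N ⧸ B) = B.mkQ y := by
    rw [Submodule.Quotient.mk_add, (Submodule.Quotient.mk_eq_zero B).mpr hb, zero_add]; rfl
  rw [this]
  have h2 := Submodule.mem_map_of_mem (f := B.mkQ) hy
  rw [Submodule.map_smul''] at h2
  exact Submodule.smul_mono le_rfl le_top h2

lemma pi_mem_smul_top {R : Type*} [CommRing R] {ι : Type*} [Finite ι] {N : Type*} [AddCommGroup N]
    [Module R N] (I : Ideal R) (x : ι → N) (h : ∀ i, x i ∈ I • (⊤ : Submodule R N)) :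
    x ∈ I • (⊤ : Submodule R (ι → N)) := by
  classical
  have := Fintype.ofFinite ι
  rw [← Finset.univ_sum_single x]
  refine Submodule.sum_mem _ (fun i _ => ?_)
  have h2 := Submodule.mem_map_of_mem (f := LinearMap.single R (fun _ : ι => N) i) (h i)
  rw [Submodule.map_smul''] at h2
  exact Submodule.smul_mono le_rfl le_top h2

variable {R : Type} [CommRing R] [IsLocalRing R] [IsNoetherianRing R]

lemma exists_extend_of_extend_completion {M : Type} [AddCommGroup M] [Module R M]
    [Module.Finite R M] {a : ℕ} (K : Submodule R (Fin a → R)) (φ : K →ₗ[R] M)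
    (h : (Fin a → R) →ₗ[R] AdicCompletion (maximalIdeal R) M)
    (hφ : ∀ k : K, h k = AdicCompletion.of (maximalIdeal R) M (φ k)) :
    ∃ g : (Fin a → R) →ₗ[R] M, ∀ k : K, g k = φ k := by
  obtain ⟨s, f, hf⟩ := Module.Finite.exists_fin' R K
  let κ : Fin s → K := fun i => f (Pi.single i 1)
  let ev : (K →ₗ[R] M) →ₗ[R] (Fin s → M) :=
    { toFun := fun ψ i => ψ (κ i), map_add' := fun _ _ => rfl, map_smul' := fun _ _ => rfl }
  have hev : Function.Injective ev := by
    intro ψ ψ' hψ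
    have : ψ ∘ₗ f = ψ' ∘ₗ f := by
      refine LinearMap.pi_ext' (fun i => LinearMap.ext_ring ?_)
      exact congrFun hψ i
    ext k
    obtain ⟨v, rfl⟩ := hf k
    exact LinearMap.congr_fun this v
  let ρ : ((Fin a → R) →ₗ[R] M) →ₗ[R] (Fin s → M) := ev ∘ₗ LinearMap.lcomp R M K.subtype
  have hmem : ev φ ∈ LinearMap.range ρ := by
    refine mem_of_forall_mem_sup_pow_smul (I := maximalIdeal R) Ideal.IsPrime.ne_top' _ (fun l => ?_)
    have hlift : ∀ i, ∃ m : M, AdicCompletion.eval (maximalIdeal R) M l (h (Pi.single i 1)) =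
        Submodule.mkQ _ m := fun i => by
      obtain ⟨m, hm⟩ := Submodule.mkQ_surjective _
        (AdicCompletion.eval (maximalIdeal R) M l (h (Pi.single i 1)))
      exact ⟨m, hm.symm⟩
    choose m hm using hlift
    let g : (Fin a → R) →ₗ[R] M := Fintype.linearCombination R m
    have hg : (AdicCompletion.eval (maximalIdeal R) M l) ∘ₗ h = Submodule.mkQ _ ∘ₗ g := by
      refine LinearMap.pi_ext' (fun i => LinearMap.ext_ring ?_)
      simpa [g, Fintype.linearCombination_apply_single] using hm i
    rw [← sub_add_cancel (ev φ) (ρ g), add_comm]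
    refine Submodule.add_mem_sup ⟨g, rfl⟩ (pi_mem_smul_top _ _ (fun i => ?_))
    rw [← Submodule.Quotient.mk_eq_zero]
    change Submodule.Quotient.mk (φ (κ i) - g (κ i)) = 0
    rw [Submodule.Quotient.mk_sub, sub_eq_zero]
    have h1 := LinearMap.congr_fun hg (κ i)
    rw [LinearMap.comp_apply, hφ, AdicCompletion.eval_of] at h1
    exact h1
  obtain ⟨g, hg⟩ := hmem
  have hg' : LinearMap.lcomp R M K.subtype g = φ := hev hg
  exact ⟨g, fun k => LinearMap.congr_fun hg' k⟩

lemma ext_eq_zero_of_comp_completion {M : Type} [AddCommGroup M] [Module R M]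
    [Module.Finite R M] (i : ℕ) : ∀ (F : Type) [AddCommGroup F] [Module R F] [Module.Finite R F]
    (z : Abelian.Ext.{0} (ModuleCat.of R F) (ModuleCat.of R M) i),
    z.comp (Abelian.Ext.mk₀ (ModuleCat.ofHom (AdicCompletion.of (maximalIdeal R) M)))
      (add_zero i) = 0 → z = 0 := by
  have hinj : Function.Injective (AdicCompletion.of (maximalIdeal R) M) := by
    have : IsHausdorff (maximalIdeal R) M := inferInstance
    exact AdicCompletion.of_injective _ _
  induction i with
  | zero =>
    intro F _ _ _ z hz
    have : Mono (ModuleCat.ofHom (AdicCompletion.of (maximalIdeal R) M)) :=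
      (ModuleCat.mono_iff_injective _).mpr hinj
    apply Abelian.Ext.postcomp_mk₀_injective_of_mono (ModuleCat.of R F)
      (ModuleCat.ofHom (AdicCompletion.of (maximalIdeal R) M))
    simpa [Abelian.Ext.postcomp] using hz
  | succ i ih =>
    intro F _ _ _ z hz
    obtain ⟨a, p, hp⟩ := Module.Finite.exists_fin' R F
    let S : ShortComplex (ModuleCat.{0} R) :=
      ShortComplex.mk (ModuleCat.ofHom (LinearMap.ker p).subtype) (ModuleCat.ofHom p) (by
        ext x; exact x.2)
    have hS : S.ShortExact := ModuleCat.shortComplex_shortExact S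
      (LinearMap.exact_subtype_ker_map p) (LinearMap.ker p).injective_subtype hp
    have hproj : Projective S.X₂ := (IsProjective.iff_projective (R := R) (Fin a → R)).mp inferInstance
    obtain ⟨w, rfl⟩ := Abelian.Ext.contravariant_sequence_exact₃ hS _ z
      (Abelian.Ext.eq_zero_of_projective _) (n₀ := i) (add_comm _ _)
    rw [Abelian.Ext.comp_assoc (a₁₂ := i + 1) (a₂₃ := i)] at hz
    · obtain ⟨v, hv⟩ := Abelian.Ext.contravariant_sequence_exact₁ hS _ _ _ hz
      cases i with
      | zero =>
        obtain ⟨φ, rfl⟩ : ∃ φ, Abelian.Ext.mk₀ φ = w := ⟨_, Abelian.Ext.mk₀_homEquiv₀_apply w⟩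
        obtain ⟨h, rfl⟩ : ∃ φ, Abelian.Ext.mk₀ φ = v := ⟨_, Abelian.Ext.mk₀_homEquiv₀_apply v⟩
        rw [Abelian.Ext.mk₀_comp_mk₀, Abelian.Ext.mk₀_comp_mk₀] at hv
        have hv' := Abelian.Ext.homEquiv₀.symm.injective hv
        obtain ⟨g, hg⟩ := exists_extend_of_extend_completion (LinearMap.ker p) φ.hom h.hom
          (fun k => ConcreteCategory.congr_hom hv' k)
        have : φ = S.f ≫ ModuleCat.ofHom g := by
          ext k
          exact (hg k).symm
        rw [this, ← Abelian.Ext.mk₀_comp_mk₀, hS.extClass_comp_assoc]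
      | succ i =>
        rw [Abelian.Ext.eq_zero_of_projective v, Abelian.Ext.comp_zero] at hv
        rw [ih _ w hv.symm, Abelian.Ext.comp_zero]
    all_goals lia

lemma lcVan_of_lcVan_completion {M : Type} [AddCommGroup M] [Module R M]
    [Module.Finite R M] (I : Ideal R) (i : ℕ)
    (h : LCVan I i (AdicCompletion (maximalIdeal R) M)) : LCVan I i M := by
  intro n z
  obtain ⟨n', h', e'⟩ := h n (z.comp (Abelian.Ext.mk₀ (ModuleCat.ofHom
    (AdicCompletion.of (maximalIdeal R) M))) (add_zero i))
  refine ⟨n', h', ext_eq_zero_of_comp_completion i _ _ ?_⟩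
  change extPullback h' _ = 0 at e'
  rwa [extPullback_comp] at e'

end Purity

section Growth

open Pointwise

variable {R : Type} [CommRing R]

lemma length_quot_le_add_length {U : Type} [AddCommGroup U] [Module R U] (P T : Submodule R U) :
    Module.length R (U ⧸ P) ≤ Module.length R (U ⧸ (P ⊔ T)) + Module.length R T := by
  rw [← (Submodule.quotientQuotientEquivQuotientSup P T).length_eq,
    Module.length_eq_add_of_exact (T.map P.mkQ).subtype (T.map P.mkQ).mkQ
      (Submodule.injective_subtype _) (Submodule.mkQ_surjective _)
      (LinearMap.exact_subtype_mkQ _), add_comm]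
  refine add_le_add le_rfl ?_
  exact Module.length_le_of_surjective (P.mkQ.submoduleMap T) (P.mkQ.submoduleMap_surjective T)

lemma exists_pow_smul_eq_zero_of_powTors {I : Ideal R} {U : Type} [AddCommGroup U] [Module R U]
    [IsNoetherian R U] : ∃ n : ℕ, ∀ a ∈ I ^ n, ∀ u ∈ powTors I U, a • u = 0 := by
  obtain ⟨s, hs⟩ := IsNoetherian.noetherian (powTors I U)
  have : ∀ u : U, ∃ n : ℕ, u ∈ s → ∀ b ∈ I ^ n, b • u = 0 := by
    intro u
    by_cases hu : u ∈ s
    · obtain ⟨n, hn⟩ : u ∈ powTors I U := hs ▸ Submodule.subset_span hu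
      exact ⟨n, fun _ => hn⟩
    · exact ⟨0, fun h => absurd h hu⟩
  choose N hN using this
  refine ⟨s.sup N, fun a ha u hu => ?_⟩
  rw [← hs] at hu
  induction hu using Submodule.span_induction with
  | mem x hx => exact hN x hx a (Ideal.pow_le_pow_right (Finset.le_sup hx) ha)
  | zero => simp
  | add x y _ _ hx hy => rw [smul_add, hx, hy, add_zero]
  | smul e x _ hx => rw [smul_comm, hx, smul_zero]

lemma exists_comap_lsmul_le_sup [IsNoetherianRing R] {U : Type} [AddCommGroup U] [Module R U] [Module.Finite R U]
    (I : Ideal R) (T : Submodule R U) {x : R} (hreg : IsSMulRegular (U ⧸ T) x) :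
    ∃ c : ℕ, ∀ l, (I ^ (l + c) • ⊤ : Submodule R U).comap (LinearMap.lsmul R U x) ≤
      I ^ l • ⊤ ⊔ T := by
  obtain ⟨c, hc⟩ := Ideal.exists_pow_inf_eq_pow_smul I (x • ⊤ : Submodule R (U ⧸ T))
  refine ⟨c, fun l u hu => ?_⟩
  have h1 : x • T.mkQ u ∈ I ^ l • (x • ⊤ : Submodule R (U ⧸ T)) := by
    have h2 : x • T.mkQ u ∈ I ^ (l + c) • ⊤ ⊓ (x • ⊤ : Submodule R (U ⧸ T)) := by
      refine ⟨?_, Submodule.smul_mem_pointwise_smul _ _ _ trivial⟩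
      have h3 := Submodule.mem_map_of_mem (f := T.mkQ) (Submodule.mem_comap.mp hu)
      rw [Submodule.map_smul''] at h3
      simpa using Submodule.smul_mono le_rfl le_top h3
    rw [hc (l + c) (by lia), Nat.add_sub_cancel] at h2
    exact Submodule.smul_mono le_rfl inf_le_right h2
  have h4 : (I ^ l • (x • ⊤ : Submodule R (U ⧸ T))) = x • (I ^ l • ⊤ : Submodule R (U ⧸ T)) := by
    rw [← Submodule.ideal_span_singleton_smul, ← Submodule.ideal_span_singleton_smul,
      ← mul_smul, ← mul_smul, mul_comm]
  rw [h4, Submodule.mem_smul_pointwise_iff_exists] at h1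
  obtain ⟨v, hv, hvu⟩ := h1
  have h5 : T.mkQ u ∈ I ^ l • (⊤ : Submodule R (U ⧸ T)) := hreg hvu ▸ hv
  have h6 : (I ^ l • ⊤ : Submodule R (U ⧸ T)) = (I ^ l • ⊤ : Submodule R U).map T.mkQ := by
    rw [Submodule.map_smul'', Submodule.map_top, Submodule.range_mkQ]
  rw [h6, ← Submodule.mem_comap, Submodule.comap_map_mkQ] at h5
  rwa [sup_comm]

/-- The lengths of `U / m ^ l U` grow at most like a polynomial of degree `t - 1`. -/
def GrowthLe (R : Type) [CommRing R] [IsLocalRing R] (t : ℕ) (U : Type) [AddCommGroup U]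
    [Module R U] : Prop :=
  ∃ C N : ℕ, ∀ l ≥ N,
    Module.length R (U ⧸ (maximalIdeal R ^ l • ⊤ : Submodule R U)) * ((l + 1 : ℕ) : ℕ∞) ≤
      ((C * (l + 1) ^ t : ℕ) : ℕ∞)

lemma length_quot_pow_smul_mono (I : Ideal R) (U : Type) [AddCommGroup U] [Module R U] {a b : ℕ}
    (h : a ≤ b) : Module.length R (U ⧸ (I ^ a • ⊤ : Submodule R U)) ≤
      Module.length R (U ⧸ (I ^ b • ⊤ : Submodule R U)) :=
  length_quot_le_of_le (Submodule.smul_mono_left (Ideal.pow_le_pow_right h))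

variable [IsLocalRing R]

lemma GrowthLe.length_ne_top {t : ℕ} {U : Type} [AddCommGroup U] [Module R U]
    (h : GrowthLe R t U) (l : ℕ) :
    Module.length R (U ⧸ (maximalIdeal R ^ l • ⊤ : Submodule R U)) ≠ ⊤ := by
  obtain ⟨C, N, h⟩ := h
  have h1 := h (max N l) (le_max_left _ _)
  have h2 : Module.length R (U ⧸ (maximalIdeal R ^ (max N l) • ⊤ : Submodule R U)) ≠ ⊤ := by
    intro h2
    rw [h2, ENat.top_mul (by simp)] at h1
    exact absurd h1 (not_le.mpr (ENat.natCast_lt_top _))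
  exact ne_top_of_le_ne_top h2 (length_quot_pow_smul_mono _ _ (le_max_right _ _))

variable [IsNoetherianRing R]

lemma GrowthLe.quotSMulTop {t : ℕ} {U : Type} [AddCommGroup U] [Module R U] [Module.Finite R U]
    (h : GrowthLe R (t + 2) U) {x : R}
    (hreg : IsSMulRegular (U ⧸ powTors (maximalIdeal R) U) x) :
    GrowthLe R (t + 1) (QuotSMulTop x U) := by
  set m := maximalIdeal R with hm
  have hfin := h.length_ne_top
  obtain ⟨c, hc⟩ := exists_comap_lsmul_le_sup m _ hreg
  set T := powTors m U with hT
  have hD : Module.length R T ≠ ⊤ := by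
    obtain ⟨n, hn⟩ := exists_pow_smul_eq_zero_of_powTors (I := m) (U := U)
    obtain ⟨k, hk⟩ := Ideal.exists_pow_inf_eq_pow_smul m T
    have h0 : m ^ (n + k) • ⊤ ⊓ T = ⊥ := by
      rw [hk (n + k) (by lia), Nat.add_sub_cancel, eq_bot_iff, Submodule.smul_le]
      intro a ha u hu
      simp [hn a ha u hu.2]
    refine ne_top_of_le_ne_top (hfin (n + k))
      (Module.length_le_of_injective ((Submodule.mkQ _).comp T.subtype) ?_)
    rw [← LinearMap.ker_eq_bot, eq_bot_iff]
    rintro ⟨u, hu⟩ hu'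
    have : u ∈ m ^ (n + k) • ⊤ ⊓ T := ⟨by simpa using hu', hu⟩
    rw [h0] at this
    exact Subtype.ext this
  have hle : ∀ l, Module.length R (QuotSMulTop x U ⧸
      (m ^ l • ⊤ : Submodule R (QuotSMulTop x U))) ≤
      Module.length R (U ⧸ (m ^ l • ⊤ : Submodule R U)) := fun l => by
    rw [length_quot_smul_eq_add U x (m ^ l)]; exact le_add_self
  have hfin' : ∀ l, Module.length R (QuotSMulTop x U ⧸
      (m ^ l • ⊤ : Submodule R (QuotSMulTop x U))) ≠ ⊤ :=
    fun l => ne_top_of_le_ne_top (hfin l) (hle l)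
  obtain ⟨C, N, h⟩ := h
  choose a ha using fun l => ENat.ne_top_iff_exists.mp (hfin l)
  choose b hb using fun l => ENat.ne_top_iff_exists.mp (hfin' l)
  obtain ⟨D, hD⟩ := ENat.ne_top_iff_exists.mp hD
  have hbmono : ∀ i j, i ≤ j → b i ≤ b j := fun i j hij => by
    have := length_quot_pow_smul_mono m (QuotSMulTop x U) hij
    rw [← hb, ← hb] at this
    exact_mod_cast this
  have hba : ∀ l, b l ≤ a l := fun l => by
    have := hle l
    rw [← ha, ← hb] at this
    exact_mod_cast this
  have hstep : ∀ l, b (l + c) + a l ≤ a (l + c) + D := fun l => by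
    have h1 := length_quot_smul_eq_add U x (m ^ (l + c))
    have h2 := length_quot_le_add_length (m ^ l • ⊤) T
    have h3 := length_quot_le_of_le (hc l)
    rw [← ha, ← hb] at h1
    rw [← ha, ← hD] at h2
    have h4 : ((b (l + c) + a l : ℕ) : ℕ∞) ≤ ((a (l + c) + D : ℕ) : ℕ∞) := by
      push_cast
      rw [h1]
      calc (b (l + c) : ℕ∞) + a l ≤ b (l + c) + (Module.length R (U ⧸ (m ^ l • ⊤ ⊔ T)) + D) := by
            gcongr
        _ ≤ b (l + c) + (Module.length R (U ⧸
            (m ^ (l + c) • ⊤ : Submodule R U).comap (LinearMap.lsmul R U x)) + D) := by gcongr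
        _ = _ := by ring
    exact_mod_cast h4
  have hiter : ∀ l j, j * b l + a l ≤ a (l + c * j) + j * D := by
    intro l j
    induction j with
    | zero => simp
    | succ j ih =>
      have h1 := hstep (l + c * j)
      have h2 := hbmono l (l + c * j + c) (by lia)
      have h3 : l + c * (j + 1) = l + c * j + c := by ring
      rw [h3, add_mul, add_mul]
      lia
  have hbound : ∀ l ≥ N, a l ≤ C * (l + 1) ^ (t + 1) := by
    intro l hl
    have h1 := h l hl
    rw [← ha] at h1
    have h2 : a l * (l + 1) ≤ C * (l + 1) ^ (t + 2) := by exact_mod_cast h1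
    refine le_of_mul_le_mul_right (a := l + 1) ?_ (by lia)
    calc _ ≤ _ := h2
      _ = _ := by ring
  refine ⟨C * (c + 1) ^ (t + 1) + D + C, N, fun l hl => ?_⟩
  rw [← hb]
  have h1 := hiter l l
  have h2 := hbound (l + c * l) (by nlinarith)
  have h3 := hbound l hl
  have h4 := hba l
  have h5 : (l + c * l + 1) ^ (t + 1) ≤ ((c + 1) * (l + 1)) ^ (t + 1) :=
    Nat.pow_le_pow_left (by nlinarith) _
  rw [mul_pow] at h5
  have h6 : l * D ≤ D * (l + 1) ^ (t + 1) := by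
    rw [mul_comm]
    refine Nat.mul_le_mul_left _ ?_
    calc l ≤ (l + 1) ^ 1 := by simp
      _ ≤ _ := Nat.pow_le_pow_right (by lia) (by lia)
  have h7 : C * (l + c * l + 1) ^ (t + 1) ≤ C * ((c + 1) ^ (t + 1) * (l + 1) ^ (t + 1)) :=
    Nat.mul_le_mul_left _ h5
  have h8 : b l * (l + 1) ≤ (C * (c + 1) ^ (t + 1) + D + C) * (l + 1) ^ (t + 1) := by
    nlinarith
  exact_mod_cast h8

lemma supportDim_lt_of_growthLe (t : ℕ) :
    ∀ (U : Type) [AddCommGroup U] [Module R U] [Module.Finite R U],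
      GrowthLe R t U → Module.supportDim R U < (t : WithBot ℕ∞) := by
  induction t with
  | zero =>
    rintro U _ _ _ ⟨C, N, h⟩
    have h1 := h (max C 1 + N) (by lia)
    have h2 : Module.length R (U ⧸ (maximalIdeal R ^ (max C 1 + N) • ⊤ : Submodule R U)) = 0 := by
      by_contra hne
      have h3 := Order.one_le_iff_ne_zero.mpr hne
      have h4 : ((max C 1 + N + 1 : ℕ) : ℕ∞) ≤ ((C * (max C 1 + N + 1) ^ 0 : ℕ) : ℕ∞) :=
        (le_mul_of_one_le_left' h3).trans h1
      have h5 : max C 1 + N + 1 ≤ C * (max C 1 + N + 1) ^ 0 := by exact_mod_cast h4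
      rw [pow_zero, mul_one] at h5
      lia
    rw [Module.length_eq_zero_iff, Submodule.Quotient.subsingleton_iff] at h2
    have h6 : (⊤ : Submodule R U) = ⊥ := by
      refine Submodule.eq_bot_of_le_smul_of_le_jacobson_bot (maximalIdeal R ^ (max C 1 + N)) ⊤
        Module.Finite.fg_top h2.ge ?_
      exact (Ideal.pow_le_self (by lia)).trans (maximalIdeal_le_jacobson _)
    have : Subsingleton U := (Submodule.subsingleton_iff R).mp (subsingleton_of_bot_eq_top h6.symm)
    rw [(Module.supportDim_eq_bot_iff_subsingleton R U).mpr this]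
    exact WithBot.bot_lt_coe _
  | succ t ih =>
    intro U _ _ _ h
    cases t with
    | zero =>
      have hfin := h.length_ne_top
      obtain ⟨C, N, h⟩ := h
      choose a ha using fun l => ENat.ne_top_iff_exists.mp (hfin l)
      have hC : ∀ l ≥ N, a l ≤ C := fun l hl => by
        have h1 := h l hl
        rw [← ha] at h1
        have h2 : a l * (l + 1) ≤ C * (l + 1) ^ (0 + 1) := by exact_mod_cast h1
        rw [zero_add, pow_one] at h2
        exact le_of_mul_le_mul_right h2 (by lia)
      have hmono : ∀ l, a l ≤ a (l + 1) := fun l => by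
        have := length_quot_pow_smul_mono (maximalIdeal R) U (Nat.le_succ l)
        rw [← ha, ← ha] at this
        exact_mod_cast this
      obtain ⟨l, hl⟩ : ∃ l, a (l + 1) ≤ a l := by
        by_contra! hcon
        have : ∀ l, l ≤ a l := fun l => by
          induction l with
          | zero => lia
          | succ l ih => have := hcon l; lia
        have h1 := this (C + N + 1)
        have h2 := hC (C + N + 1) (by lia)
        lia
      have h1 : (maximalIdeal R ^ (l + 1) • ⊤ : Submodule R U) = maximalIdeal R ^ l • ⊤ := by
        refine eq_of_length_quot_le
          (Submodule.smul_mono_left (Ideal.pow_le_pow_right (Nat.le_succ l))) (hfin l) ?_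
        rw [← ha, ← ha]
        exact_mod_cast hl
      have h2 : (maximalIdeal R ^ l • ⊤ : Submodule R U) = ⊥ := by
        refine Submodule.eq_bot_of_le_smul_of_le_jacobson_bot (maximalIdeal R) _
          (IsNoetherian.noetherian _) ?_ (maximalIdeal_le_jacobson _)
        rw [← mul_smul, ← pow_succ', h1]
      have h3 : ∀ p ∈ Module.support R U, p = closedPoint R := by
        intro p hp
        rw [Module.mem_support_iff_of_finite] at hp
        have h4 : maximalIdeal R ^ l ≤ Module.annihilator R U := fun b hb => by
          rw [Module.mem_annihilator]
          intro u
          have := Submodule.smul_mem_smul hb (Submodule.mem_top (R := R) (x := u))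
          rwa [h2] at this
        have h5 := p.2.le_of_pow_le (h4.trans hp)
        exact PrimeSpectrum.ext (le_antisymm (le_maximalIdeal p.2.ne_top) h5)
      have : Subsingleton (Module.support R U) :=
        ⟨fun p q => Subtype.ext ((h3 p p.2).trans (h3 q q.2).symm)⟩
      exact (Order.krullDim_nonpos_of_subsingleton).trans_lt (by norm_num)
    | succ t =>
      obtain ⟨x, hx, hreg⟩ := exists_mem_maximalIdeal_isSMulRegular (R := R) (S := R)
        (by simp) U
      have h1 := ih (QuotSMulTop x U) (h.quotSMulTop hreg)
      refine (Module.supportDim_le_supportDim_quotSMulTop_succ hx).trans_lt ?_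
      generalize Module.supportDim R (QuotSMulTop x U) = d at h1
      induction d with
      | bot => exact WithBot.bot_lt_coe _
      | coe d =>
        induction d with
        | top => exact absurd h1 (by simp)
        | coe d =>
          have h2 : d < t + 1 := by exact_mod_cast h1
          exact_mod_cast (by lia : d + 1 < t + 1 + 1)

end Growth

section RegularSubmodule

open RingTheory.Sequence Pointwise

variable {R : Type} [CommRing R] [IsLocalRing R] [IsNoetherianRing R]

/-- The saturation of a submodule with respect to the powers of an element. -/
def powSaturation (x : R) {N : Type} [AddCommGroup N] [Module R N] (N' : Submodule R N) :
    Submodule R N where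
  carrier := {n | ∃ a : ℕ, x ^ a • n ∈ N'}
  zero_mem' := ⟨0, by simp⟩
  add_mem' := by
    rintro u v ⟨a, ha⟩ ⟨b, hb⟩
    refine ⟨a + b, ?_⟩
    rw [smul_add]
    refine add_mem ?_ ?_
    · rw [pow_add, mul_comm, mul_smul]
      exact N'.smul_mem _ ha
    · rw [pow_add, mul_smul]
      exact N'.smul_mem _ hb
  smul_mem' := by
    rintro c u ⟨a, ha⟩
    exact ⟨a, by rw [smul_comm]; exact N'.smul_mem _ ha⟩

omit [IsLocalRing R] in
lemma exists_pow_smul_powSaturation_le (x : R) {N : Type} [AddCommGroup N] [Module R N]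
    [Module.Finite R N] (N' : Submodule R N) :
    ∃ a : ℕ, ∀ n ∈ powSaturation x N', x ^ a • n ∈ N' := by
  obtain ⟨s, hs⟩ := IsNoetherian.noetherian (powSaturation x N')
  have : ∀ u : N, ∃ n : ℕ, u ∈ s → x ^ n • u ∈ N' := by
    intro u
    by_cases hu : u ∈ s
    · obtain ⟨n, hn⟩ : u ∈ powSaturation x N' := hs ▸ Submodule.subset_span hu
      exact ⟨n, fun _ => hn⟩
    · exact ⟨0, fun h => absurd h hu⟩
  choose k hk using this
  refine ⟨s.sup k, fun u hu => ?_⟩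
  rw [← hs] at hu
  induction hu using Submodule.span_induction with
  | mem u hu =>
    obtain ⟨d, hd⟩ := Nat.exists_eq_add_of_le (Finset.le_sup (f := k) hu)
    rw [hd, pow_add, mul_comm, mul_smul]
    exact N'.smul_mem _ (hk u hu)
  | zero => simp
  | add u v _ _ hu hv => rw [smul_add]; exact add_mem hu hv
  | smul e u _ hu => rw [smul_comm]; exact N'.smul_mem _ hu

lemma natCast_length_le_supportDim_of_isWeaklyRegular (rs : List R)
    (hrs : ∀ x ∈ rs, x ∈ maximalIdeal R) :
    ∀ (N : Type) [AddCommGroup N] [Module R N] [Module.Finite R N], IsWeaklyRegular N rs →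
      ∀ N' : Submodule R N, N' ≠ ⊥ → ((rs.length : ℕ) : WithBot ℕ∞) ≤ Module.supportDim R N' := by
  induction rs with
  | nil =>
    intro N _ _ _ _ N' hN'
    have : Nontrivial N' := (Submodule.nontrivial_iff_ne_bot).mpr hN'
    have h := Module.supportDim_ne_bot_of_nontrivial R N'
    obtain ⟨d, hd⟩ := WithBot.ne_bot_iff_exists.mp h
    rw [← hd]
    simp only [List.length_nil]
    exact WithBot.coe_le_coe.mpr (by simp)
  | cons x rs ih =>
    intro N _ _ _ hreg N' hN'
    rw [isWeaklyRegular_cons_iff] at hreg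
    obtain ⟨hx, hreg⟩ := hreg
    have hxm := hrs x (by simp)
    set P := powSaturation x N' with hP
    have hNP : N' ≤ P := fun n hn => ⟨0, by simpa using hn⟩
    obtain ⟨a, ha⟩ := exists_pow_smul_powSaturation_le x N'
    have h1 : Module.supportDim R P ≤ Module.supportDim R N' := by
      refine Module.supportDim_le_of_injective
        (LinearMap.codRestrict N' ((LinearMap.lsmul R N (x ^ a)).comp P.subtype)
          (fun n => ha n n.2)) ?_
      intro u v huv
      have h2 : x ^ a • (u : N) = x ^ a • (v : N) := congrArg Subtype.val huv
      exact Subtype.ext (hx.pow a h2)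
    have hxP : IsSMulRegular P x := fun u v huv =>
      Subtype.ext (hx (congrArg Subtype.val huv))
    let f : QuotSMulTop x P →ₗ[R] QuotSMulTop x N := QuotSMulTop.map x P.subtype
    have hf : LinearMap.range f ≠ ⊥ := by
      intro hbot
      apply hN'
      rw [eq_bot_iff]
      refine hNP.trans ?_
      have h2 : ∀ n ∈ P, n ∈ x • (⊤ : Submodule R N) := by
        intro n hn
        have h3 : f (Submodule.Quotient.mk ⟨n, hn⟩) = 0 := by
          rw [LinearMap.range_eq_bot] at hbot
          rw [hbot]; rfl
        exact (Submodule.Quotient.mk_eq_zero _).mp h3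
      refine (Submodule.eq_bot_of_le_smul_of_le_jacobson_bot (maximalIdeal R) P
        (IsNoetherian.noetherian _) ?_ (maximalIdeal_le_jacobson _)).le
      intro n hn
      obtain ⟨w, -, rfl⟩ := (Submodule.mem_smul_pointwise_iff_exists _ _ _).mp (h2 n hn)
      refine Submodule.smul_mem_smul hxm ?_
      obtain ⟨b, hb⟩ := hn
      exact ⟨b + 1, by rwa [pow_succ, mul_smul]⟩
    have h4 := ih (fun y hy => hrs y (by simp [hy])) (QuotSMulTop x N) hreg _ hf
    have h5 : Module.supportDim R (LinearMap.range f) ≤ Module.supportDim R (QuotSMulTop x P) :=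
      Module.supportDim_le_of_surjective f.rangeRestrict f.surjective_rangeRestrict
    refine le_trans ?_ h1
    rw [← Module.supportDim_quotSMulTop_succ_eq_supportDim hxP hxm]
    rw [List.length_cons, Nat.cast_add, Nat.cast_one]
    gcongr
    exact h4.trans h5

end RegularSubmodule

section CompletionNoetherian

variable (R : Type) [CommRing R] [IsNoetherianRing R]

lemma isNoetherianRing_adicCompletion_idealOfVars (σ : Type) [Finite σ] :
    IsNoetherianRing (AdicCompletion (MvPolynomial.idealOfVars σ R) (MvPolynomial σ R)) :=
  isNoetherianRing_of_ringEquiv (MvPowerSeries σ R)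
    (MvPowerSeries.toAdicCompletionAlgEquiv σ R).toRingEquiv

instance isNoetherianRing_adicCompletion [IsLocalRing R] :
    IsNoetherianRing (AdicCompletion (maximalIdeal R) R) := by
  set m := maximalIdeal R with hm
  obtain ⟨n, x, hx⟩ := Submodule.fg_iff_exists_fin_generating_family.mp
    (IsNoetherian.noetherian m)
  set J := MvPolynomial.idealOfVars (Fin n) R with hJ
  let φ : MvPolynomial (Fin n) R →+* R := (MvPolynomial.aeval x).toRingHom
  have hφX : ∀ i, φ (MvPolynomial.X i) = x i := fun i => by simp [φ]
  have hJm : J.map φ = m := by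
    rw [hJ, MvPolynomial.idealOfVars, Ideal.map_span, ← hx, ← Set.range_comp]
    congr 2
    ext i
    exact hφX i
  have hle : ∀ k, J ^ k ≤ (m ^ k).comap φ := fun k => by
    rw [← Ideal.map_le_iff_le_comap, Ideal.map_pow, hJm]
  let f : (k : ℕ) → AdicCompletion J (MvPolynomial (Fin n) R) →+* R ⧸ m ^ k := fun k =>
    (Ideal.quotientMap (m ^ k) φ (hle k)).comp (AdicCompletion.evalₐ J k).toRingHom
  have hf : ∀ {a b : ℕ} (h : a ≤ b), (Ideal.Quotient.factorPow m h).comp (f b) = f a := by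
    intro a b h
    ext y
    obtain ⟨z, rfl⟩ := AdicCompletion.mk_surjective J _ y
    simp only [f, RingHom.comp_apply, AlgHom.toRingHom_eq_coe, RingHom.coe_coe,
      AdicCompletion.evalₐ_mk, Ideal.quotientMap_mk]
    refine Ideal.Quotient.eq.mpr ?_
    rw [← map_sub]
    exact hle a (Ideal.Quotient.eq.mp (AdicCompletion.Ideal.mk_eq_mk J h z))
  let ψ := AdicCompletion.liftRingHom m f hf
  have hψ : ∀ p : MvPolynomial (Fin n) R, ψ (algebraMap _ _ p) = algebraMap R _ (φ p) := by
    intro p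
    refine AdicCompletion.ext_evalₐ fun k => ?_
    rw [AdicCompletion.evalₐ_liftRingHom]
    simp only [f, RingHom.comp_apply, AlgHom.toRingHom_eq_coe, RingHom.coe_coe]
    rw [AdicCompletion.algebraMap_apply, AdicCompletion.algebraMap_apply]
    simp
  have hcomp : ψ.comp (algebraMap _ (AdicCompletion J (MvPolynomial (Fin n) R))) =
      (algebraMap R (AdicCompletion m R)).comp φ := RingHom.ext hψ
  set J' := J.map (algebraMap _ (AdicCompletion J (MvPolynomial (Fin n) R))) with hJ'
  have hJψ : J'.map ψ = maximalIdeal (AdicCompletion m R) := by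
    rw [hJ', Ideal.map_map, hcomp, ← Ideal.map_map, hJm, AdicCompletion.maximalIdeal_eq_map]
  have hcompl : IsAdicComplete J' (AdicCompletion J (MvPolynomial (Fin n) R)) :=
    AdicCompletion.isAdicComplete_self J (MvPolynomial.idealOfVars_fg _ R)
  have : IsNoetherianRing (AdicCompletion J (MvPolynomial (Fin n) R)) :=
    isNoetherianRing_adicCompletion_idealOfVars R (Fin n)
  refine isNoetherianRing_of_surjective _ _ ψ ?_
  have hhaus : IsHausdorff (J'.map ψ) (AdicCompletion m R) := by
    rw [hJψ]; infer_instance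
  refine surjective_of_mk_map_comp_surjective (I := J') ψ fun y => ?_
  obtain ⟨y, rfl⟩ := Ideal.Quotient.mk_surjective y
  obtain ⟨r, hr⟩ := Ideal.Quotient.mk_surjective (y.1 1)
  refine ⟨algebraMap (MvPolynomial (Fin n) R) _ (MvPolynomial.C r), ?_⟩
  rw [RingHom.comp_apply, hψ, Ideal.Quotient.mk_eq_mk_iff_sub_mem, hJψ,
    AdicCompletion.mem_maximalIdeal_iff_eval_one_eq_zero]
  have h1 : φ (MvPolynomial.C r) = r := by simp [φ]
  rw [h1]
  change (algebraMap R (AdicCompletion m R) r).1 1 - y.1 1 = 0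
  rw [← hr, sub_eq_zero]
  rfl

end CompletionNoetherian

section CompletionLength

lemma length_eq_of_forall_smul_eq {R S : Type} [CommRing R] [CommRing S] [Algebra R S] {X : Type}
    [AddCommGroup X] [Module R X] [Module S X] [IsScalarTower R S X]
    (h : ∀ s : S, ∃ r : R, ∀ x : X, s • x = r • x) : Module.length R X = Module.length S X := by
  let e : Submodule S X ≃o Submodule R X :=
    { toFun := Submodule.restrictScalars R
      invFun := fun N =>
        { N with
          smul_mem' := fun s x hx => by
            obtain ⟨r, hr⟩ := h s
            rw [hr]
            exact N.smul_mem r hx }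
      left_inv := fun _ => rfl
      right_inv := fun _ => rfl
      map_rel_iff' := Iff.rfl }
  rw [← WithBot.coe_inj, Module.coe_length, Module.coe_length]
  exact (Order.krullDim_eq_of_orderIso e).symm

variable {R : Type} [CommRing R] [IsLocalRing R] [IsNoetherianRing R]
  {M : Type} [AddCommGroup M] [Module R M] [Module.Finite R M]

instance finite_adicCompletion : Module.Finite (AdicCompletion (maximalIdeal R) R)
    (AdicCompletion (maximalIdeal R) M) :=
  Module.Finite.of_surjective _
    (AdicCompletion.ofTensorProduct_surjective_of_finite (maximalIdeal R) M)

omit [IsNoetherianRing R] in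
lemma span_range_of_eq_top : Submodule.span (AdicCompletion (maximalIdeal R) R)
    (Set.range (AdicCompletion.of (maximalIdeal R) M)) = ⊤ := by
  rw [eq_top_iff]
  rintro y -
  obtain ⟨t, rfl⟩ := AdicCompletion.ofTensorProduct_surjective_of_finite (maximalIdeal R) M y
  induction t with
  | zero => simp
  | tmul r x =>
    rw [AdicCompletion.ofTensorProduct_tmul]
    exact Submodule.smul_mem _ _ (Submodule.subset_span ⟨x, rfl⟩)
  | add a b ha hb => rw [map_add]; exact add_mem ha hb

lemma length_completion_quot_map_smul (Q : Ideal R) (n : ℕ)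
    (hn : (maximalIdeal R ^ n • ⊤ : Submodule R M) ≤ Q • ⊤) :
    Module.length (AdicCompletion (maximalIdeal R) R) (AdicCompletion (maximalIdeal R) M ⧸
      (Q.map (algebraMap R (AdicCompletion (maximalIdeal R) R)) • ⊤ :
        Submodule (AdicCompletion (maximalIdeal R) R) (AdicCompletion (maximalIdeal R) M))) =
    Module.length R (M ⧸ (Q • ⊤ : Submodule R M)) := by
  set m := maximalIdeal R with hm
  set S := AdicCompletion m R
  set X := AdicCompletion m M
  set P : Submodule S X := Q.map (algebraMap R S) • ⊤ with hP
  have hfg : m.FG := m.fg_of_isNoetherianRing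
  have hmP : ∀ a ∈ m ^ n, ∀ y : X, a • y ∈ P := by
    intro a ha y
    have hy : y ∈ Submodule.span S (Set.range (AdicCompletion.of m M)) := by
      rw [span_range_of_eq_top]; trivial
    induction hy using Submodule.span_induction with
    | mem y hy =>
      obtain ⟨u, rfl⟩ := hy
      rw [← map_smul]
      have hu : a • u ∈ (Q • ⊤ : Submodule R M) :=
        hn (Submodule.smul_mem_smul ha trivial)
      refine Submodule.smul_induction_on hu (fun q hq v _ => ?_) (fun v w hv hw => ?_)
      · rw [map_smul, ← algebraMap_smul S]
        exact Submodule.smul_mem_smul (Ideal.mem_map_of_mem _ hq) trivial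
      · rw [map_add]; exact add_mem hv hw
    | zero => simp
    | add y z _ _ hy hz => rw [smul_add]; exact add_mem hy hz
    | smul s y _ hy => rw [smul_comm]; exact P.smul_mem s hy
  have hker : ∀ y : X, AdicCompletion.eval m M n y = 0 → y ∈ P := by
    intro y hy
    have h1 : y ∈ (m ^ n • ⊤ : Submodule R X) := by
      rw [AdicCompletion.pow_smul_top_eq_ker_eval hfg]; exact hy
    exact Submodule.smul_induction_on h1 (fun a ha y _ => hmP a ha y) (fun _ _ => add_mem)
  have hact : ∀ s : S, ∃ r : R, ∀ x : X ⧸ P, s • x = r • x := by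
    intro s
    obtain ⟨r, hr⟩ := Submodule.mkQ_surjective _ (AdicCompletion.eval m R n s)
    refine ⟨r, fun x => ?_⟩
    obtain ⟨x, rfl⟩ := P.mkQ_surjective x
    have h1 : s - algebraMap R S r ∈ (m ^ n • ⊤ : Submodule R S) := by
      rw [AdicCompletion.pow_smul_top_eq_ker_eval hfg, LinearMap.mem_ker, map_sub, ← hr, sub_eq_zero]
      rfl
    have h2 : (s - algebraMap R S r) • x ∈ P := by
      refine Submodule.smul_induction_on h1 (fun a ha y _ => ?_) (fun y z hy hz => ?_)
      · rw [smul_assoc]; exact hmP a ha _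
      · rw [add_smul]; exact add_mem hy hz
    rw [← map_smul, ← LinearMap.map_smul_of_tower, ← sub_eq_zero, ← map_sub, ← algebraMap_smul S r x,
      ← sub_smul]
    exact (Submodule.Quotient.mk_eq_zero P).mpr h2
  rw [← length_eq_of_forall_smul_eq hact]
  let g : M →ₗ[R] X ⧸ P := (P.mkQ.restrictScalars R).comp (AdicCompletion.of m M)
  have hg : Function.Surjective g := by
    intro y
    obtain ⟨y, rfl⟩ := P.mkQ_surjective y
    obtain ⟨u, hu⟩ := Submodule.mkQ_surjective _ (AdicCompletion.eval m M n y)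
    refine ⟨u, ?_⟩
    change P.mkQ _ = P.mkQ y
    rw [← sub_eq_zero, ← map_sub, ← LinearMap.mem_ker, Submodule.ker_mkQ]
    apply hker
    rw [map_sub, ← hu, sub_eq_zero]
    rfl
  have hgk : LinearMap.ker g = Q • ⊤ := by
    ext u
    constructor
    · intro hu
      have h1 : AdicCompletion.of m M u ∈ P := by simpa [g] using hu
      have h2 : ∀ y ∈ P, AdicCompletion.eval m M n y ∈
          (Q • ⊤ : Submodule R M).map (m ^ n • ⊤ : Submodule R M).mkQ := by
        intro y hy
        rw [Submodule.map_smul'', Submodule.map_top, Submodule.range_mkQ]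
        refine Submodule.smul_induction_on hy (fun a ha y _ => ?_) (fun y z hy hz => ?_)
        · induction ha using Submodule.span_induction generalizing y with
          | mem a ha =>
            obtain ⟨q, hq, rfl⟩ := ha
            change AdicCompletion.eval m M n (algebraMap R S q • y) ∈ _
            rw [algebraMap_smul, map_smul]
            exact Submodule.smul_mem_smul hq trivial
          | zero => simp
          | add a b _ _ ha hb => rw [add_smul, map_add]; exact add_mem (ha _ trivial) (hb _ trivial)
          | smul c a _ ha => rw [smul_assoc, smul_comm]; exact ha _ trivial
        · rw [map_add]; exact add_mem hy hz
      obtain ⟨v, hv, hvu⟩ := h2 _ h1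
      rw [AdicCompletion.eval_of] at hvu
      have h3 : u - v ∈ (m ^ n • ⊤ : Submodule R M) := by
        rw [← Submodule.ker_mkQ (m ^ n • ⊤ : Submodule R M), LinearMap.mem_ker, map_sub, sub_eq_zero]
        exact hvu.symm
      simpa using add_mem (hn h3) hv
    · intro hu
      refine Submodule.smul_induction_on hu (fun q hq y _ => ?_) (fun y z hy hz => add_mem hy hz)
      have : q • AdicCompletion.of m M y ∈ P := by
        rw [← algebraMap_smul S]
        exact Submodule.smul_mem_smul (Ideal.mem_map_of_mem _ hq) trivial
      exact (Submodule.Quotient.mk_eq_zero P).mpr this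
  rw [← hgk]
  exact (g.quotKerEquivOfSurjective hg).length_eq.symm

instance isAdicComplete_adicCompletion : IsAdicComplete
    (maximalIdeal (AdicCompletion (maximalIdeal R) R)) (AdicCompletion (maximalIdeal R) M) := by
  rw [AdicCompletion.maximalIdeal_eq_map]
  exact (IsAdicComplete.map_algebraMap_iff _ _).mpr
    (AdicCompletion.isAdicComplete (maximalIdeal R).fg_of_isNoetherianRing)

end CompletionLength

section Graded

open MvPolynomial Finset

variable {σ A B : Type*} [CommRing A] [CommRing B] [Algebra A B]

/-- The homogenised evaluation `Xⱼ ↦ xⱼ T`. -/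
noncomputable def gradeHom (x : σ → B) : MvPolynomial σ A →ₐ[A] Polynomial B :=
  aeval fun j ↦ Polynomial.C (x j) * Polynomial.X

theorem gradeHom_of_isHomogeneous (x : σ → B) {f : MvPolynomial σ A} {d : ℕ}
    (hf : f.IsHomogeneous d) :
    gradeHom x f = Polynomial.C (aeval x f) * Polynomial.X ^ d := by
  conv_lhs => rw [f.as_sum]
  conv_rhs => rw [f.as_sum]
  simp only [map_sum, Finset.sum_mul]
  refine Finset.sum_congr rfl fun s hs ↦ ?_
  have hd : s.degree = d := by
    by_contra h
    exact (mem_support_iff.1 hs) (hf.coeff_eq_zero h)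
  rw [gradeHom, aeval_monomial, aeval_monomial, Finsupp.prod, Finsupp.prod]
  simp only [mul_pow, Finset.prod_mul_distrib, map_mul, map_prod, map_pow]
  rw [Finset.prod_pow_eq_pow_sum, ← hd, Finsupp.degree_apply, ← mul_assoc]
  rfl

theorem coeff_gradeHom_of_isHomogeneous (x : σ → B) {f : MvPolynomial σ A} {d : ℕ}
    (hf : f.IsHomogeneous d) (l : ℕ) :
    (gradeHom x f).coeff l = if l = d then aeval x f else 0 := by
  rw [gradeHom_of_isHomogeneous x hf, Polynomial.coeff_C_mul_X_pow]

theorem coeff_gradeHom (x : σ → B) (f : MvPolynomial σ A) (l : ℕ) :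
    (gradeHom x f).coeff l = aeval x (homogeneousComponent l f) := by
  conv_lhs => rw [← sum_homogeneousComponent f]
  rw [map_sum, Polynomial.finsetSum_coeff]
  simp_rw [coeff_gradeHom_of_isHomogeneous x (homogeneousComponent_isHomogeneous _ f)]
  rw [Finset.sum_ite_eq]
  split_ifs with h
  · rfl
  · rw [homogeneousComponent_eq_zero, map_zero]
    simp at h
    omega

theorem coeff_gradeHom_mem (x : σ → A) (f : MvPolynomial σ A) (l : ℕ) :
    (gradeHom x f).coeff l ∈ Ideal.span (Set.range x) ^ l := by
  rw [coeff_gradeHom, Ideal.mem_span_pow_iff_exists_isHomogeneous]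
  exact ⟨_, homogeneousComponent_isHomogeneous l f, by rw [aeval_eq_eval]⟩

theorem coeff_gradeHom_mul_of_isHomogeneous (x : σ → B) {f : MvPolynomial σ A} {d : ℕ}
    (hf : f.IsHomogeneous d) (h : MvPolynomial σ A) (l : ℕ) :
    (gradeHom x (f * h)).coeff (d + l) = aeval x f * (gradeHom x h).coeff l := by
  rw [map_mul, gradeHom_of_isHomogeneous x hf, mul_assoc, Polynomial.coeff_C_mul, mul_comm,
    add_comm d l, mul_comm (Polynomial.X ^ d), Polynomial.coeff_mul_X_pow, mul_comm]

end Graded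

section Dimension

open MvPolynomial Module

variable {K : Type*} [Field K] {r : ℕ}

instance finite_homogeneousSubmodule (l : ℕ) : Module.Finite K (homogeneousSubmodule (Fin r) K l) :=
  Module.Finite.iff_fg.2 (homogeneousSubmodule_fg _ _ l)

theorem finrank_homogeneousSubmodule (hr : 1 ≤ r) (l : ℕ) :
    finrank K (homogeneousSubmodule (Fin r) K l) = (l + (r - 1)).choose (r - 1) := by
  have h1 : {d : Fin r →₀ ℕ | d.degree = l} = ((Finset.finsuppAntidiag Finset.univ l : Finset (Fin r →₀ ℕ)) :
      Set (Fin r →₀ ℕ)) := by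
    ext d
    simp [Finset.mem_finsuppAntidiag, Finsupp.degree_eq_sum]
  rw [homogeneousSubmodule_eq_finsupp_supported, h1]
  rw [LinearEquiv.finrank_eq (AddMonoidAlgebra.supportedEquivFinsupp _), finrank_finsupp_self]
  simp only [Fintype.card_coe, Finset.coe_sort_coe]
  rw [Finset.card_finsuppAntidiag_nat_eq_choose, Finset.card_univ, Fintype.card_fin]
  rw [show r + l - 1 = l + (r - 1) by omega, Nat.choose_symm_add]

theorem sum_finrank_homogeneousSubmodule (hr : 1 ≤ r) (L : ℕ) :
    ∑ l ∈ Finset.range (L + 1), finrank K (homogeneousSubmodule (Fin r) K l) =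
      (L + r).choose r := by
  simp_rw [finrank_homogeneousSubmodule hr]
  obtain ⟨s, rfl⟩ : ∃ s, r = s + 1 := ⟨r - 1, by omega⟩
  simp only [Nat.add_sub_cancel]
  rw [Nat.sum_range_add_choose]
  rfl

theorem finrank_homogeneousSubmodule_mono (hr : 1 ≤ r) {a b : ℕ} (hab : a ≤ b) :
    finrank K (homogeneousSubmodule (Fin r) K a) ≤
      finrank K (homogeneousSubmodule (Fin r) K b) := by
  simp_rw [finrank_homogeneousSubmodule hr]
  exact Nat.choose_le_choose _ (by omega)

/-- The degree `l` part of an ideal. -/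
noncomputable def gradedPart (J : Ideal (MvPolynomial (Fin r) K)) (l : ℕ) :
    Submodule K (MvPolynomial (Fin r) K) :=
  J.restrictScalars K ⊓ homogeneousSubmodule (Fin r) K l

theorem mem_gradedPart {J : Ideal (MvPolynomial (Fin r) K)} {l : ℕ}
    {f : MvPolynomial (Fin r) K} : f ∈ gradedPart J l ↔ f ∈ J ∧ f.IsHomogeneous l := by
  simp [gradedPart]

instance finite_gradedPart (J : Ideal (MvPolynomial (Fin r) K)) (l : ℕ) :
    Module.Finite K (gradedPart J l) :=
  Module.Finite.of_injective (Submodule.inclusion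
    (inf_le_right : gradedPart J l ≤ homogeneousSubmodule (Fin r) K l))
    (Submodule.inclusion_injective _)

theorem finrank_map_mul (g : MvPolynomial (Fin r) K) (hg : g ≠ 0) (l : ℕ) :
    finrank K ((homogeneousSubmodule (Fin r) K l).map (LinearMap.mulLeft K g)) =
      finrank K (homogeneousSubmodule (Fin r) K l) :=
  (LinearEquiv.finrank_eq (Submodule.equivMapOfInjective _ (fun a b h ↦ by
    simpa [hg] using h) _)).symm

theorem finrank_le_gradedPart {J : Ideal (MvPolynomial (Fin r) K)}
    {g : MvPolynomial (Fin r) K} (hg0 : g ≠ 0) (hg : g ∈ J) {d : ℕ} (hd : g.IsHomogeneous d)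
    (l : ℕ) :
    finrank K (homogeneousSubmodule (Fin r) K l) ≤ finrank K (gradedPart J (d + l)) := by
  rw [← finrank_map_mul g hg0 l]
  refine Submodule.finrank_mono ?_
  rintro _ ⟨f, hf, rfl⟩
  exact mem_gradedPart.2 ⟨J.mul_mem_right _ hg, hd.mul hf⟩

theorem aeval_X_eq (f : MvPolynomial (Fin r) K) :
    aeval (X : Fin r → MvPolynomial (Fin r) K) f = f := by
  simp

/-- A nonunit has a nonzero homogeneous component of positive degree dividing every homogeneous
multiple. -/
theorem exists_isHomogeneous_dvd {p : MvPolynomial (Fin r) K} (hp0 : p ≠ 0) (hp : ¬ IsUnit p) :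
    ∃ (d : ℕ) (g : MvPolynomial (Fin r) K), 1 ≤ d ∧ g ≠ 0 ∧ g.IsHomogeneous d ∧
      ∀ (l : ℕ) (h : MvPolynomial (Fin r) K), h.IsHomogeneous l → h ≠ 0 → p ∣ h →
        d ≤ l ∧ ∃ q : MvPolynomial (Fin r) K, q.IsHomogeneous (l - d) ∧ h = g * q := by
  set x : Fin r → MvPolynomial (Fin r) K := X with hx
  have hc (f : MvPolynomial (Fin r) K) (l : ℕ) :
      (gradeHom (A := K) x f).coeff l = homogeneousComponent l f := by
    rw [coeff_gradeHom, hx, aeval_X_eq]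
  have hne (f : MvPolynomial (Fin r) K) (hf : f ≠ 0) : gradeHom (A := K) x f ≠ 0 := by
    intro h
    apply hf
    rw [← sum_homogeneousComponent f]
    refine Finset.sum_eq_zero fun i _ ↦ ?_
    rw [← hc, h, Polynomial.coeff_zero]
  have hlead (f : MvPolynomial (Fin r) K) :
      (gradeHom (A := K) x f).leadingCoeff =
        homogeneousComponent (gradeHom (A := K) x f).natDegree f := by
    rw [← hc]
    rfl
  refine ⟨(gradeHom (A := K) x p).natDegree, (gradeHom (A := K) x p).leadingCoeff, ?_, ?_, ?_, ?_⟩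
  · by_contra h
    have h0 : (gradeHom (A := K) x p).natDegree = 0 := by omega
    have h1 : p = homogeneousComponent 0 p := by
      conv_lhs => rw [← sum_homogeneousComponent p]
      refine Finset.sum_eq_single 0 (fun i _ hi ↦ ?_) (by simp)
      rw [← hc]
      exact Polynomial.coeff_eq_zero_of_natDegree_lt (by omega)
    rw [homogeneousComponent_zero] at h1
    apply hp
    rw [h1]
    refine (IsUnit.mk0 _ fun h2 ↦ hp0 ?_).map C
    rw [h1, h2, map_zero]
  · exact Polynomial.leadingCoeff_ne_zero.2 (hne p hp0)
  · rw [hlead]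
    exact homogeneousComponent_isHomogeneous _ _
  · rintro l h hh h0 ⟨q, rfl⟩
    have hq0 : q ≠ 0 := right_ne_zero_of_mul h0
    have e := gradeHom_of_isHomogeneous (A := K) x hh
    rw [hx, aeval_X_eq, ← hx] at e
    have e1 : (gradeHom (A := K) x (p * q)).natDegree = l := by
      rw [e]
      exact Polynomial.natDegree_C_mul_X_pow l _ h0
    have e2 : (gradeHom (A := K) x (p * q)).leadingCoeff = p * q := by
      rw [e, Polynomial.leadingCoeff_C_mul_X_pow]
    rw [map_mul, Polynomial.natDegree_mul (hne p hp0) (hne q hq0)] at e1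
    rw [map_mul, Polynomial.leadingCoeff_mul] at e2
    refine ⟨by omega, _, ?_, e2.symm⟩
    rw [hlead, show l - (gradeHom (A := K) x p).natDegree =
      (gradeHom (A := K) x q).natDegree by omega]
    exact homogeneousComponent_isHomogeneous _ _

theorem finrank_gradedPart_le (hr : 1 ≤ r) {J : Ideal (MvPolynomial (Fin r) K)}
    {p : MvPolynomial (Fin r) K} (hp0 : p ≠ 0) (hp : ¬ IsUnit p) (hJ : ∀ f ∈ J, p ∣ f) (l : ℕ) :
    finrank K (gradedPart J (l + 1)) ≤ finrank K (homogeneousSubmodule (Fin r) K l) := by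
  obtain ⟨d, g, hd, hg0, hg, H⟩ := exists_isHomogeneous_dvd hp0 hp
  refine le_trans ?_ (finrank_homogeneousSubmodule_mono hr (show l + 1 - d ≤ l by omega))
  rw [← finrank_map_mul g hg0]
  refine Submodule.finrank_mono fun f hf ↦ ?_
  obtain ⟨hf1, hf2⟩ := mem_gradedPart.1 hf
  by_cases h0 : f = 0
  · rw [h0]; exact zero_mem _
  obtain ⟨-, q, hq, rfl⟩ := H _ f hf2 h0 (hJ f hf1)
  exact ⟨q, hq, rfl⟩

theorem finrank_gradedPart_zero {J : Ideal (MvPolynomial (Fin r) K)}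
    {p : MvPolynomial (Fin r) K} (hp0 : p ≠ 0) (hp : ¬ IsUnit p) (hJ : ∀ f ∈ J, p ∣ f) :
    finrank K (gradedPart J 0) = 0 := by
  obtain ⟨d, g, hd, hg0, hg, H⟩ := exists_isHomogeneous_dvd hp0 hp
  rw [Submodule.finrank_eq_zero, Submodule.eq_bot_iff]
  intro f hf
  obtain ⟨hf1, hf2⟩ := mem_gradedPart.1 hf
  by_contra h0
  have := (H _ f hf2 h0 (hJ f hf1)).1
  omega

end Dimension

section Forms

open MvPolynomial Module

theorem length_quot_eq_add_length_map {A M : Type} [CommRing A] [AddCommGroup M] [Module A M]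
    {P T : Submodule A M} (h : P ≤ T) :
    length A (M ⧸ P) = length A (M ⧸ T) + length A (T.map P.mkQ) := by
  rw [Module.length_eq_add_of_exact (T.map P.mkQ).subtype (T.map P.mkQ).mkQ
    (Submodule.subtype_injective _) (Submodule.mkQ_surjective _)
    (LinearMap.exact_subtype_mkQ _),
    (Submodule.quotientQuotientEquivQuotient P T h).length_eq, add_comm]

variable {A M : Type} [CommRing A] [AddCommGroup M] [Module A M] {r : ℕ}

theorem smul_mem_pow_smul {I : Ideal A} {a b : ℕ} {c : A} {B : Submodule A M} {u : M}
    (hc : c ∈ I ^ a) (hu : u ∈ I ^ b • B) : c • u ∈ I ^ (a + b) • B := by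
  rw [pow_add, mul_smul]
  exact Submodule.smul_mem_smul hc hu

/-- The polynomials all of whose homogeneous components `f` satisfy
`f(x) • γ ∈ (x) ^ deg f • B`. -/
noncomputable def annForms (x : Fin r → A) (γ : M) (B : Submodule A M) :
    Ideal (MvPolynomial (Fin r) A) where
  carrier := {f | ∀ l, (gradeHom x f).coeff l • γ ∈ Ideal.span (Set.range x) ^ l • B}
  zero_mem' := by simp
  add_mem' := by
    intro f g hf hg l
    rw [map_add, Polynomial.coeff_add, add_smul]
    exact add_mem (hf l) (hg l)
  smul_mem' := by
    intro p f hf l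
    rw [smul_eq_mul, map_mul, Polynomial.coeff_mul, Finset.sum_smul]
    refine sum_mem fun c hc ↦ ?_
    rw [mul_smul, ← Finset.HasAntidiagonal.mem_antidiagonal.1 hc]
    exact smul_mem_pow_smul (coeff_gradeHom_mem x p _) (hf _)

theorem mem_annForms {x : Fin r → A} {γ : M} {B : Submodule A M} {f : MvPolynomial (Fin r) A} :
    f ∈ annForms x γ B ↔
      ∀ l, (gradeHom x f).coeff l • γ ∈ Ideal.span (Set.range x) ^ l • B := Iff.rfl

theorem mem_annForms_of_isHomogeneous {x : Fin r → A} {γ : M} {B : Submodule A M}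
    {f : MvPolynomial (Fin r) A} {d : ℕ} (hf : f.IsHomogeneous d) :
    f ∈ annForms x γ B ↔ aeval x f • γ ∈ Ideal.span (Set.range x) ^ d • B := by
  rw [mem_annForms]
  simp_rw [coeff_gradeHom_of_isHomogeneous x hf]
  constructor
  · intro h
    simpa using h d
  · intro h l
    split_ifs with hl
    · rwa [hl]
    · simp

theorem homogeneousComponent_mem_annForms {x : Fin r → A} {γ : M} {B : Submodule A M}
    {f : MvPolynomial (Fin r) A} (hf : f ∈ annForms x γ B) (d : ℕ) :
    homogeneousComponent d f ∈ annForms x γ B := by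
  rw [mem_annForms_of_isHomogeneous (homogeneousComponent_isHomogeneous d f), ← coeff_gradeHom]
  exact hf d

/-- Evaluating forms of degree `l` at `x` and multiplying with `γ`, modulo `B`. -/
noncomputable def formMap (x : Fin r → A) (γ : M) (B : Submodule A M) (l : ℕ) :
    homogeneousSubmodule (Fin r) A l →ₗ[A] M ⧸ B :=
  B.mkQ ∘ₗ (LinearMap.toSpanSingleton A M γ) ∘ₗ (aeval x).toLinearMap ∘ₗ Submodule.subtype _

theorem formMap_eq_zero {x : Fin r → A} {γ : M} {B : Submodule A M} {l : ℕ}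
    (f : homogeneousSubmodule (Fin r) A l) :
    formMap x γ B l f = 0 ↔ aeval x f.1 • γ ∈ B := by
  change B.mkQ (aeval x f.1 • γ) = 0 ↔ _
  rw [Submodule.mkQ_apply, Submodule.Quotient.mk_eq_zero]

theorem range_formMap (x : Fin r → A) (γ : M) (B : Submodule A M) (l : ℕ) :
    LinearMap.range (formMap x γ B l) =
      (Ideal.span (Set.range x) ^ l • Submodule.span A {γ}).map B.mkQ := by
  rw [formMap, LinearMap.range_comp, LinearMap.range_comp, LinearMap.range_comp,
    Submodule.range_subtype, ← Ideal.span_pow_eq_map_homogeneousSubmodule]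
  congr 1
  ext u
  rw [Submodule.mem_smul_span_singleton]
  simp [Submodule.mem_map]

variable [IsLocalRing A]

theorem exists_isHomogeneous_map_residue {l : ℕ} {g : MvPolynomial (Fin r) (ResidueField A)}
    (hg : g.IsHomogeneous l) :
    ∃ f : MvPolynomial (Fin r) A, f.IsHomogeneous l ∧ MvPolynomial.map (residue A) f = g := by
  obtain ⟨f, rfl⟩ := MvPolynomial.map_surjective (residue A) residue_surjective g
  refine ⟨homogeneousComponent l f, homogeneousComponent_isHomogeneous l f, ?_⟩
  rw [← homogeneousComponent_eq_self hg]
  ext d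
  simp only [coeff_map, coeff_homogeneousComponent]
  split_ifs <;> simp

theorem length_range_add_finrank {X : Type} [AddCommGroup X] [Module A X] {l : ℕ}
    (Φ : homogeneousSubmodule (Fin r) A l →ₗ[A] X)
    (J : Ideal (MvPolynomial (Fin r) (ResidueField A)))
    (h : ∀ f, Φ f = 0 ↔ MvPolynomial.map (residue A) f.1 ∈ J) :
    length A (LinearMap.range Φ) + (finrank (ResidueField A) (gradedPart J l) : ℕ∞) =
      finrank (ResidueField A) (homogeneousSubmodule (Fin r) (ResidueField A) l) := by
  set k := ResidueField A with hk
  set S := homogeneousSubmodule (Fin r) k l with hS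
  set T : Submodule k S := (J.restrictScalars k).comap S.subtype with hT
  have hTf : finrank k T = finrank k (gradedPart J l) := by
    rw [← Submodule.finrank_map_subtype_eq S T, hT, Submodule.map_comap_subtype, inf_comm]
    rfl
  let π : homogeneousSubmodule (Fin r) A l →ₗ[A] S :=
    { toFun f := ⟨MvPolynomial.map (residue A) f.1, IsHomogeneous.map f.2 _⟩
      map_add' f g := by ext; simp
      map_smul' a f := by
        ext d
        change MvPolynomial.coeff d (MvPolynomial.map (residue A) (a • f.1)) =
          MvPolynomial.coeff d (a • MvPolynomial.map (residue A) f.1)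
        rw [coeff_map, coeff_smul, coeff_smul, coeff_map, smul_eq_mul, map_mul,
          Algebra.smul_def]
        rfl }
  let ψ : homogeneousSubmodule (Fin r) A l →ₗ[A] S ⧸ T := (T.mkQ.restrictScalars A) ∘ₗ π
  have hψs : LinearMap.range ψ = ⊤ := by
    rw [LinearMap.range_eq_top]
    refine (Submodule.mkQ_surjective T).comp fun g ↦ ?_
    obtain ⟨f, hf, hfg⟩ := exists_isHomogeneous_map_residue g.2
    exact ⟨⟨f, hf⟩, Subtype.ext hfg⟩
  have hker : LinearMap.ker Φ = LinearMap.ker ψ := by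
    ext f
    rw [LinearMap.mem_ker, LinearMap.mem_ker, h]
    change _ ↔ T.mkQ (π f) = 0
    rw [Submodule.mkQ_apply, Submodule.Quotient.mk_eq_zero]
    rfl
  have e1 : length A (LinearMap.range Φ) = length A (S ⧸ T) := by
    rw [← Φ.quotKerEquivRange.length_eq, hker, ψ.quotKerEquivRange.length_eq, hψs]
    exact Module.length_top
  have e2 : length A (S ⧸ T) = length k (S ⧸ T) :=
    Module.length_eq_of_surjective residue_surjective
  rw [e1, e2, Module.length_eq_finrank, ← hTf, ← Nat.cast_add, Submodule.finrank_quotient_add_finrank]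

end Forms

section Chain

open MvPolynomial Module

variable {A M : Type} [CommRing A] [IsLocalRing A] [AddCommGroup M] [Module A M]

theorem exists_pow_smul_top_eq_bot [IsNoetherianRing A] (X : Type) [AddCommGroup X] [Module A X]
    (hX : IsFiniteLength A X) : ∃ n : ℕ, maximalIdeal A ^ n • (⊤ : Submodule A X) = ⊥ := by
  obtain ⟨_, _⟩ := isFiniteLength_iff_isNoetherian_isArtinian.1 hX
  obtain ⟨n, hn⟩ := IsArtinian.monotone_stabilizes
    (⟨fun n ↦ OrderDual.toDual (maximalIdeal A ^ n • (⊤ : Submodule A X)), fun a b hab ↦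
      Submodule.smul_mono_left (Ideal.pow_le_pow_right hab)⟩ : ℕ →o (Submodule A X)ᵒᵈ)
  refine ⟨n, Submodule.eq_bot_of_le_smul_of_le_jacobson_bot (maximalIdeal A) _
    (IsNoetherian.noetherian _) ?_ (maximalIdeal_le_jacobson _)⟩
  rw [← mul_smul, ← pow_succ']
  exact (OrderDual.toDual_inj.1 (hn (n + 1) (Nat.le_succ n))).le

theorem exists_pow_smul_top_le [IsNoetherianRing A] (B : Submodule A M)
    (hB : IsFiniteLength A (M ⧸ B)) : ∃ n : ℕ, maximalIdeal A ^ n • (⊤ : Submodule A M) ≤ B := by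
  obtain ⟨n, hn⟩ := exists_pow_smul_top_eq_bot _ hB
  refine ⟨n, ?_⟩
  have h : (maximalIdeal A ^ n • (⊤ : Submodule A M)).map B.mkQ ≤ ⊥ := by
    rw [Submodule.map_smul'', Submodule.map_top, Submodule.range_mkQ, hn]
  rwa [Submodule.map_le_iff_le_comap, Submodule.comap_bot, Submodule.ker_mkQ] at h

/-- A finite chain of submodules from `⊤` down to `B` whose factors are cyclic and annihilated by
the maximal ideal. -/
structure SocleChain (B : Submodule A M) where
  /-- the number of steps -/
  len : ℕ
  /-- the members of the chain -/
  sub : ℕ → Submodule A M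
  /-- the generators of the factors -/
  gen : ℕ → M
  sub_zero : sub 0 = ⊤
  sub_len : sub len = B
  sub_eq : ∀ i < len, sub i = Submodule.span A {gen i} ⊔ sub (i + 1)
  smul_gen : ∀ i < len, ∀ a ∈ maximalIdeal A, a • gen i ∈ sub (i + 1)

theorem nonempty_socleChain [IsNoetherian A M] (B : Submodule A M) {n : ℕ}
    (hB : maximalIdeal A ^ n • (⊤ : Submodule A M) ≤ B) : Nonempty (SocleChain B) := by
  induction B using IsNoetherian.induction with
  | hgt B ih =>
  by_cases hT : B = ⊤
  · exact ⟨⟨0, fun _ ↦ ⊤, fun _ ↦ 0, rfl, hT.symm, by simp, by simp⟩⟩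
  classical
  have hex : ∃ n, maximalIdeal A ^ n • (⊤ : Submodule A M) ≤ B := ⟨n, hB⟩
  obtain ⟨m, hm⟩ : ∃ m, Nat.find hex = m + 1 := by
    refine ⟨Nat.find hex - 1, ?_⟩
    have : Nat.find hex ≠ 0 := by
      intro h0
      have := Nat.find_spec hex
      rw [h0, pow_zero, Ideal.one_eq_top, Submodule.top_smul] at this
      exact hT (top_le_iff.1 this)
    omega
  have h1 := Nat.find_spec hex
  have h2 := Nat.find_min hex (show m < Nat.find hex by omega)
  rw [hm] at h1
  obtain ⟨γ, hγ, hγB⟩ := SetLike.not_le_iff_exists.1 h2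
  obtain ⟨S⟩ := ih (Submodule.span A {γ} ⊔ B)
    (lt_of_le_of_ne le_sup_right fun h ↦ hγB (h ▸ Submodule.mem_sup_left
      (Submodule.mem_span_singleton_self γ))) (hB.trans le_sup_right)
  refine ⟨⟨S.len + 1, fun i ↦ if i ≤ S.len then S.sub i else B,
    fun i ↦ if i < S.len then S.gen i else γ, by simp [S.sub_zero], by simp, ?_, ?_⟩⟩
  · intro i hi
    rcases Nat.lt_succ_iff_lt_or_eq.1 hi with h | rfl
    · simp only [h, h.le, Nat.succ_le_of_lt h, if_true]
      exact S.sub_eq i h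
    · simp [S.sub_len]
  · intro i hi a ha
    rcases Nat.lt_succ_iff_lt_or_eq.1 hi with h | rfl
    · simp only [h, Nat.succ_le_of_lt h, if_true]
      exact S.smul_gen i h a ha
    · simp only [lt_irrefl, if_false, Nat.not_succ_le_self]
      refine h1 ?_
      rw [pow_succ', mul_smul]
      exact Submodule.smul_mem_smul ha hγ

variable {r : ℕ}

theorem ker_map_residue_le_annForms (x : Fin r → A) {γ : M} {B : Submodule A M}
    (h : ∀ a ∈ maximalIdeal A, a • γ ∈ B) :
    RingHom.ker (MvPolynomial.map (σ := Fin r) (residue A)) ≤ annForms x γ B := by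
  rw [MvPolynomial.ker_map, IsLocalRing.ker_residue, Ideal.map_le_iff_le_comap]
  intro a ha
  rw [Ideal.mem_comap, mem_annForms_of_isHomogeneous (isHomogeneous_C _ a), pow_zero,
    Ideal.one_eq_top, Submodule.top_smul]
  simpa using h a ha

/-- The image of `annForms` in the polynomial ring over the residue field. -/
noncomputable def residueForms (x : Fin r → A) (γ : M) (B : Submodule A M) :
    Ideal (MvPolynomial (Fin r) (ResidueField A)) :=
  (annForms x γ B).map (MvPolynomial.map (residue A))

theorem map_mem_residueForms {x : Fin r → A} {γ : M} {B : Submodule A M}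
    (h : ∀ a ∈ maximalIdeal A, a • γ ∈ B) {f : MvPolynomial (Fin r) A} :
    MvPolynomial.map (residue A) f ∈ residueForms x γ B ↔ f ∈ annForms x γ B := by
  rw [residueForms, ← Ideal.mem_comap,
    Ideal.comap_map_of_surjective' _ (MvPolynomial.map_surjective _ residue_surjective),
    sup_eq_left.2 (ker_map_residue_le_annForms x h)]

theorem length_quot_add_finrank_residueForms (x : Fin r → A) {γ : M} {B T : Submodule A M}
    (hT : T = Submodule.span A {γ} ⊔ B) (h : ∀ a ∈ maximalIdeal A, a • γ ∈ B) (l : ℕ) :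
    length A (M ⧸ (Ideal.span (Set.range x) ^ l • B)) +
        (finrank (ResidueField A) (gradedPart (residueForms x γ B) l) : ℕ∞) =
      length A (M ⧸ (Ideal.span (Set.range x) ^ l • T)) +
        (finrank (ResidueField A) (homogeneousSubmodule (Fin r) (ResidueField A) l) : ℕ∞) := by
  have hle : Ideal.span (Set.range x) ^ l • B ≤ Ideal.span (Set.range x) ^ l • T :=
    Submodule.smul_mono le_rfl (hT ▸ le_sup_right)
  rw [length_quot_eq_add_length_map hle, add_assoc,
    ← length_range_add_finrank (formMap x γ (Ideal.span (Set.range x) ^ l • B) l)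
      (residueForms x γ B), range_formMap, hT, Submodule.smul_sup, Submodule.map_sup,
    Submodule.mkQ_map_self, sup_bot_eq]
  intro f
  rw [formMap_eq_zero, map_mem_residueForms h, mem_annForms_of_isHomogeneous f.2]

theorem length_quot_pow_add_sum (x : Fin r → A)
    (S : SocleChain (Ideal.span (Set.range x) • (⊤ : Submodule A M))) (l : ℕ) :
    length A (M ⧸ (Ideal.span (Set.range x) ^ (l + 1) • (⊤ : Submodule A M))) +
        ((∑ i ∈ Finset.range S.len, finrank (ResidueField A)
          (gradedPart (residueForms x (S.gen i) (S.sub (i + 1))) l) : ℕ) : ℕ∞) =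
      length A (M ⧸ (Ideal.span (Set.range x) ^ l • (⊤ : Submodule A M))) +
        ((S.len * finrank (ResidueField A)
          (homogeneousSubmodule (Fin r) (ResidueField A) l) : ℕ) : ℕ∞) := by
  have key (n : ℕ) (hn : n ≤ S.len) :
      length A (M ⧸ (Ideal.span (Set.range x) ^ l • S.sub n)) +
        ((∑ i ∈ Finset.range n, finrank (ResidueField A)
          (gradedPart (residueForms x (S.gen i) (S.sub (i + 1))) l) : ℕ) : ℕ∞) =
      length A (M ⧸ (Ideal.span (Set.range x) ^ l • (⊤ : Submodule A M))) +
        ((n * finrank (ResidueField A)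
          (homogeneousSubmodule (Fin r) (ResidueField A) l) : ℕ) : ℕ∞) := by
    induction n with
    | zero => rw [S.sub_zero]; simp
    | succ n ih =>
      have h1 := length_quot_add_finrank_residueForms x (S.sub_eq n hn) (S.smul_gen n hn) l
      rw [Finset.sum_range_succ, Nat.cast_add, add_comm (Nat.cast _) (Nat.cast _), ← add_assoc,
        h1, add_right_comm, ih (by omega), add_mul, one_mul, Nat.cast_add, add_assoc]
  have := key S.len le_rfl
  rwa [S.sub_len, ← mul_smul, ← pow_succ] at this

theorem length_quot_pow_add_sum_sum (hr : 1 ≤ r) (x : Fin r → A)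
    (S : SocleChain (Ideal.span (Set.range x) • (⊤ : Submodule A M))) (L : ℕ) :
    length A (M ⧸ (Ideal.span (Set.range x) ^ (L + 1) • (⊤ : Submodule A M))) +
        ((∑ i ∈ Finset.range S.len, ∑ l ∈ Finset.range (L + 1), finrank (ResidueField A)
          (gradedPart (residueForms x (S.gen i) (S.sub (i + 1))) l) : ℕ) : ℕ∞) =
        ((S.len * (L + r).choose r : ℕ) : ℕ∞) := by
  rw [Finset.sum_comm, ← sum_finrank_homogeneousSubmodule (K := ResidueField A) hr]
  generalize hn : L + 1 = n
  clear hn L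
  induction n with
  | zero =>
    have : Subsingleton (M ⧸ (Ideal.span (Set.range x) ^ 0 • (⊤ : Submodule A M))) := by
      rw [pow_zero, Ideal.one_eq_top, Submodule.top_smul]
      infer_instance
    simp [Module.length_eq_zero]
  | succ n ih =>
    rw [Finset.sum_range_succ, Finset.sum_range_succ, Nat.cast_add,
      add_comm (Nat.cast _) (Nat.cast _), ← add_assoc, length_quot_pow_add_sum, add_right_comm, ih,
      mul_add, Nat.cast_add]

end Chain

section Asymptotics

theorem choose_add_le_pow (L s : ℕ) : (L + s).choose s ≤ (L + 1) ^ s := by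
  induction s with
  | zero => simp
  | succ s ih =>
    have h := Nat.add_one_mul_choose_eq (L + s) s
    have h2 : (L + (s + 1)).choose (s + 1) * (s + 1) ≤ (L + 1) ^ (s + 1) * (s + 1) := by
      calc (L + (s + 1)).choose (s + 1) * (s + 1) = (L + s + 1) * (L + s).choose s := by
            rw [h]; rfl
        _ ≤ ((L + 1) * (s + 1)) * (L + 1) ^ s := Nat.mul_le_mul (by nlinarith) ih
        _ = _ := by ring
    exact Nat.le_of_mul_le_mul_right h2 (by omega)

theorem pow_le_factorial_mul_choose (L s : ℕ) :
    (L + 1) ^ s ≤ s.factorial * (L + s).choose s := by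
  induction s with
  | zero => simp
  | succ s ih =>
    have h := Nat.add_one_mul_choose_eq (L + s) s
    calc (L + 1) ^ (s + 1) = (L + 1) * (L + 1) ^ s := by ring
      _ ≤ (L + s + 1) * (s.factorial * (L + s).choose s) := Nat.mul_le_mul (by omega) ih
      _ = s.factorial * ((L + s + 1) * (L + s).choose s) := by ring
      _ = s.factorial * ((L + s + 1).choose (s + 1) * (s + 1)) := by rw [h]
      _ = _ := by rw [Nat.factorial_succ]; ring_nf

theorem choose_add_add_le (n δ s : ℕ) :
    (n + δ).choose (s + 1) ≤ n.choose (s + 1) + δ * (n + δ).choose s := by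
  induction δ with
  | zero => simp
  | succ δ ih =>
    rw [← add_assoc, Nat.choose_succ_succ]
    have := Nat.choose_le_choose s (show n + δ ≤ n + δ + 1 by omega)
    nlinarith

theorem eq_zero_of_mul_choose_le (α : ℤ) (r N : ℕ) (K : ℤ)
    (h : ∀ L ≥ N, |α| * ((L + r).choose r : ℕ) * (L + 1) ≤ K * ((L : ℤ) + 1) ^ r) : α = 0 := by
  by_contra h0
  have h1 : (1 : ℤ) ≤ |α| := Int.one_le_abs h0
  set L := N + (r.factorial * K.natAbs) with hL
  have h2 := h L (by omega)
  have h3 : ((L : ℤ) + 1) ^ r ≤ (r.factorial : ℤ) * ((L + r).choose r : ℕ) := by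
    exact_mod_cast pow_le_factorial_mul_choose L r
  have hK : K ≤ (K.natAbs : ℤ) := Int.le_natAbs
  have hpos : (0 : ℤ) < ((L : ℤ) + 1) ^ r := by positivity
  have h4 : ((L : ℤ) + 1) ^ r * (L + 1) ≤ ((L : ℤ) + 1) ^ r * (r.factorial * K.natAbs) := by
    calc ((L : ℤ) + 1) ^ r * (L + 1) ≤ (r.factorial : ℤ) * ((L + r).choose r : ℕ) * (L + 1) := by
          gcongr
      _ ≤ (r.factorial : ℤ) * (|α| * ((L + r).choose r : ℕ) * (L + 1)) := by
          have : (0 : ℤ) ≤ ((L + r).choose r : ℕ) * ((L : ℤ) + 1) := by positivity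
          have h5 : (0 : ℤ) ≤ r.factorial := by positivity
          nlinarith [mul_le_mul_of_nonneg_right h1 this,
            mul_nonneg h5 (sub_nonneg.2 (mul_le_mul_of_nonneg_right h1 this))]
      _ ≤ (r.factorial : ℤ) * (K * ((L : ℤ) + 1) ^ r) := by gcongr
      _ ≤ (r.factorial : ℤ) * (K.natAbs * ((L : ℤ) + 1) ^ r) := by gcongr
      _ = _ := by ring
  have h5 := le_of_mul_le_mul_left h4 hpos
  have : (L : ℤ) = N + (r.factorial * K.natAbs) := by rw [hL]; push_cast; ring
  have : (0 : ℤ) ≤ N := by positivity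
  linarith

theorem card_eq_of_asymptotic {c s : ℕ} (e : ℤ) (G : Finset ℕ) (hG : G ⊆ Finset.range c)
    (w : ℕ → ℕ → ℕ) (len : ℕ → ℕ) (N : ℕ) (K : ℤ)
    (hlen : ∀ L ≥ N, |(len L : ℤ) - e * ((L + (s + 1)).choose (s + 1) : ℕ)| * ((L : ℤ) + 1) ^ 2 ≤
      K * ((L : ℤ) + 1) ^ (s + 1))
    (hw : ∀ L ≥ N, len L + ∑ i ∈ Finset.range c, w i L = c * (L + (s + 1)).choose (s + 1))
    (hgood : ∀ i ∈ G, ∀ L, w i L = 0)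
    (hle : ∀ i L, w i L ≤ (L + (s + 1)).choose (s + 1))
    (hbad : ∀ i ∈ Finset.range c \ G,
      ∃ δ, ∀ L ≥ δ, (L - δ + (s + 1)).choose (s + 1) ≤ w i L) :
    (G.card : ℤ) = e ∧ ∀ i ∈ Finset.range c \ G,
      ¬ ∀ L, w i (L + 1) ≤ (L + (s + 1)).choose (s + 1) := by
  choose! δ hδ using hbad
  set d := ∑ i ∈ Finset.range c \ G, δ i with hd
  have hcard : c = G.card + (Finset.range c \ G).card := by
    have := Finset.card_sdiff_add_card_eq_card hG
    rw [Finset.card_range] at this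
    omega
  have hsum (L : ℕ) : ∑ i ∈ Finset.range c, w i L = ∑ i ∈ Finset.range c \ G, w i L := by
    rw [← Finset.sum_sdiff hG, Finset.sum_eq_zero (s := G) fun i hi ↦ hgood i hi L, add_zero]
  have hup (L : ℕ) : ∑ i ∈ Finset.range c \ G, w i L ≤
      (Finset.range c \ G).card * (L + (s + 1)).choose (s + 1) := by
    rw [← smul_eq_mul]
    exact Finset.sum_le_card_nsmul _ _ _ fun i _ ↦ hle i L
  have hlow (L : ℕ) (hL : d ≤ L) : (Finset.range c \ G).card *
      (L - d + (s + 1)).choose (s + 1) ≤ ∑ i ∈ Finset.range c \ G, w i L := by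
    rw [← smul_eq_mul]
    refine Finset.card_nsmul_le_sum _ _ _ fun i hi ↦ ?_
    have h1 : δ i ≤ d := Finset.single_le_sum (f := δ) (fun _ _ ↦ Nat.zero_le _) hi
    exact (Nat.choose_le_choose _ (by omega)).trans (hδ i hi L (h1.trans hL))
  set q := (Finset.range c \ G).card with hq
  have he : (G.card : ℤ) = e := by
    rw [← sub_eq_zero]
    refine eq_zero_of_mul_choose_le _ (s + 1) (N + d) (K + q * d * 2 ^ s) fun L hL ↦ ?_
    have h1 := hlen L (by omega)
    have h2 := hw L (by omega)
    rw [hsum] at h2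
    have h3 := hup L
    have h4 := hlow L (by omega)
    have h5 := choose_add_add_le (L - d + (s + 1)) d s
    rw [show L - d + (s + 1) + d = L + (s + 1) by omega] at h5
    have h6 : (L + (s + 1)).choose s ≤ 2 ^ s * (L + 1) ^ s := by
      rw [← mul_pow, show L + (s + 1) = L + 1 + s by omega]
      exact (choose_add_le_pow (L + 1) s).trans (Nat.pow_le_pow_left (by omega) s)
    set C := (L + (s + 1)).choose (s + 1) with hC
    set W := ∑ i ∈ Finset.range c \ G, w i L with hW
    have h7 : len L ≤ G.card * C + q * (d * (2 ^ s * (L + 1) ^ s)) := by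
      have : q * C ≤ W + q * (d * (2 ^ s * (L + 1) ^ s)) := by
        calc q * C ≤ q * ((L - d + (s + 1)).choose (s + 1) + d * (L + (s + 1)).choose s) := by
              gcongr
          _ ≤ q * ((L - d + (s + 1)).choose (s + 1) + d * (2 ^ s * (L + 1) ^ s)) := by gcongr
          _ = q * (L - d + (s + 1)).choose (s + 1) + q * (d * (2 ^ s * (L + 1) ^ s)) := by ring
          _ ≤ _ := by gcongr
      rw [hcard, add_mul] at h2
      omega
    have h8 : G.card * C ≤ len L := by
      rw [hcard, add_mul] at h2
      omega
    have h7' : (len L : ℤ) ≤ G.card * C + q * (d * (2 ^ s * ((L : ℤ) + 1) ^ s)) := by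
      exact_mod_cast h7
    have h8' : (G.card * C : ℤ) ≤ len L := by exact_mod_cast h8
    have h9 : |(G.card : ℤ) - e| * C ≤
        |(len L : ℤ) - e * C| + q * (d * (2 ^ s * ((L : ℤ) + 1) ^ s)) := by
      rw [← Nat.abs_cast C, ← abs_mul, Nat.abs_cast C]
      have e1 : ((G.card : ℤ) - e) * C = (len L - e * C) + (G.card * C - len L) := by ring
      rw [e1]
      refine (abs_add_le _ _).trans (add_le_add le_rfl ?_)
      rw [abs_le]
      constructor
      · linarith
      · have : (0 : ℤ) ≤ ((q * (d * (2 ^ s * (L + 1) ^ s)) : ℕ) : ℤ) := Int.natCast_nonneg _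
        push_cast at this
        linarith
    have h10 : |(len L : ℤ) - e * C| * ((L : ℤ) + 1) ≤ K * ((L : ℤ) + 1) ^ (s + 1) := by
      refine le_trans ?_ h1
      refine mul_le_mul_of_nonneg_left ?_ (abs_nonneg _)
      have : (0 : ℤ) ≤ L := by positivity
      nlinarith
    calc |(G.card : ℤ) - e| * C * ((L : ℤ) + 1) ≤
        (|(len L : ℤ) - e * C| + q * (d * (2 ^ s * ((L : ℤ) + 1) ^ s))) * ((L : ℤ) + 1) := by
          gcongr
      _ = |(len L : ℤ) - e * C| * ((L : ℤ) + 1) + q * d * 2 ^ s * ((L : ℤ) + 1) ^ (s + 1) := by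
          ring
      _ ≤ K * ((L : ℤ) + 1) ^ (s + 1) + q * d * 2 ^ s * ((L : ℤ) + 1) ^ (s + 1) := by gcongr
      _ = _ := by ring
  refine ⟨he, fun i hi hcon ↦ ?_⟩
  suffices h : (1 : ℤ) = 0 by norm_num at h
  refine eq_zero_of_mul_choose_le 1 s (N + 1) (K * 2 ^ (s + 1)) fun L hL ↦ ?_
  obtain ⟨L, rfl⟩ : ∃ k, L = k + 1 := ⟨L - 1, by omega⟩
  have h1 := hlen (L + 1) (by omega)
  have h2 := hw (L + 1) (by omega)
  rw [hsum] at h2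
  have h3 : ∑ i ∈ Finset.range c \ G, w i (L + 1) + (L + (s + 1)).choose s ≤
      q * (L + 1 + (s + 1)).choose (s + 1) := by
    rw [← Finset.add_sum_erase _ _ hi]
    have e1 : ∑ j ∈ (Finset.range c \ G).erase i, w j (L + 1) ≤
        ((Finset.range c \ G).erase i).card * (L + 1 + (s + 1)).choose (s + 1) := by
      rw [← smul_eq_mul]
      exact Finset.sum_le_card_nsmul _ _ _ fun i _ ↦ hle i _
    have e2 := Finset.card_erase_add_one hi
    rw [← hq] at e2
    rw [← e2, add_mul, one_mul]
    have e3 := hcon L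
    have e4 : (L + 1 + (s + 1)).choose (s + 1) =
        (L + (s + 1)).choose s + (L + (s + 1)).choose (s + 1) := by
      rw [show L + 1 + (s + 1) = L + (s + 1) + 1 by omega, Nat.choose_succ_succ]
    omega
  have h4 : G.card * (L + 1 + (s + 1)).choose (s + 1) + (L + (s + 1)).choose s ≤ len (L + 1) := by
    have e1 : c * (L + 1 + (s + 1)).choose (s + 1) = G.card * (L + 1 + (s + 1)).choose (s + 1) +
        q * (L + 1 + (s + 1)).choose (s + 1) := by rw [← add_mul, ← hcard]
    omega
  have h5 : (((L + 1 + s).choose s : ℕ) : ℤ) ≤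
      |(len (L + 1) : ℤ) - e * ((L + 1 + (s + 1)).choose (s + 1) : ℕ)| := by
    refine le_trans ?_ (le_abs_self _)
    rw [← he, show L + 1 + s = L + (s + 1) by omega, le_sub_iff_add_le, add_comm]
    exact_mod_cast h4
  have hp : (0 : ℤ) < ((L + 1 : ℕ) : ℤ) + 1 := by positivity
  set y : ℤ := ((L + 1 : ℕ) : ℤ) + 1 with hy
  have h6 : (((L + 1 + s).choose s : ℕ) : ℤ) * y ^ 2 ≤ K * y ^ (s + 1) :=
    (mul_le_mul_of_nonneg_right h5 (by positivity)).trans h1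
  have hK : 0 ≤ K := by
    by_contra hK
    have : K * y ^ (s + 1) < 0 := mul_neg_of_neg_of_pos (by omega) (by positivity)
    have : (0 : ℤ) ≤ (((L + 1 + s).choose s : ℕ) : ℤ) * y ^ 2 := by positivity
    linarith
  have h7 : (((L + 1 + s).choose s : ℕ) : ℤ) * y ≤ K * y ^ s := by
    refine le_of_mul_le_mul_right ?_ hp
    calc _ = (((L + 1 + s).choose s : ℕ) : ℤ) * y ^ 2 := by ring
      _ ≤ K * y ^ (s + 1) := h6
      _ = _ := by ring
  rw [abs_one, one_mul]
  refine h7.trans ?_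
  have : (1 : ℤ) ≤ 2 ^ (s + 1) := one_le_pow₀ (by norm_num)
  have : 0 ≤ K * y ^ s := by positivity
  nlinarith

end Asymptotics

section Divisibility

theorem dvd_of_forall_dvd_pow_mul {S : Type*} [CommRing S] [IsDomain S]
    [UniqueFactorizationMonoid S] {F : Set S} (hF : ∀ p : S, Prime p → ∃ f ∈ F, ¬ p ∣ f)
    (a : S) (ha : a ≠ 0) (h : S) (hdvd : ∀ f ∈ F, ∃ n : ℕ, a ∣ f ^ n * h) : a ∣ h := by
  induction a using UniqueFactorizationMonoid.induction_on_prime generalizing h with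
  | h₁ => exact absurd rfl ha
  | h₂ a hu => exact hu.dvd
  | h₃ a p ha0 hp ih =>
    obtain ⟨h', rfl⟩ := ih ha0 h fun f hf ↦
      (hdvd f hf).imp fun n hn ↦ (Dvd.intro_left p rfl).trans hn
    obtain ⟨f, hf, hpf⟩ := hF p hp
    obtain ⟨n, hn⟩ := hdvd f hf
    rw [mul_comm p a, show f ^ n * (a * h') = a * (f ^ n * h') by ring,
      mul_dvd_mul_iff_left ha0] at hn
    rw [mul_comm p a]
    exact mul_dvd_mul_left a ((hp.dvd_or_dvd hn).resolve_left fun h ↦ hpf (hp.dvd_of_dvd_pow h))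

end Divisibility

section Saturation

open MvPolynomial Module

variable {A M : Type} [CommRing A] [AddCommGroup M] [Module A M] {r : ℕ}

theorem pow_smul_mem_of_le {x : Fin r → A} {f : MvPolynomial (Fin r) A} {d : ℕ}
    (hf : f.IsHomogeneous d) {l n m : ℕ} (hnm : n ≤ m) {u : M} {B : Submodule A M}
    (h : aeval x f ^ n • u ∈ Ideal.span (Set.range x) ^ (n * d + l) • B) :
    aeval x f ^ m • u ∈ Ideal.span (Set.range x) ^ (m * d + l) • B := by
  obtain ⟨k, rfl⟩ := Nat.exists_eq_add_of_le' hnm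
  have h1 : aeval x f ^ k ∈ Ideal.span (Set.range x) ^ (k * d) := by
    rw [mul_comm, pow_mul]
    refine Ideal.pow_mem_pow ?_ k
    exact (Ideal.mem_span_pow_iff_exists_isHomogeneous x _).2 ⟨f, hf, by rw [aeval_eq_eval]⟩
  rw [pow_add (aeval x f), mul_smul, show (k + n) * d + l = k * d + (n * d + l) by ring]
  exact smul_mem_pow_smul h1 h

/-- The elements `u` such that every form `f ∈ F` has a power with
`f(x) ^ n • u ∈ (x) ^ (n * deg f + l) • B`. -/
def formSaturation (x : Fin r → A) (F : Set (ℕ × MvPolynomial (Fin r) A))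
    (hF : ∀ p ∈ F, p.2.IsHomogeneous p.1) (l : ℕ) (B : Submodule A M) : Submodule A M where
  carrier := {u | ∀ p ∈ F, ∃ n : ℕ,
    aeval x p.2 ^ n • u ∈ Ideal.span (Set.range x) ^ (n * p.1 + l) • B}
  zero_mem' := fun p _ ↦ ⟨0, by simp⟩
  add_mem' := by
    intro u v hu hv p hp
    obtain ⟨n, hn⟩ := hu p hp
    obtain ⟨m, hm⟩ := hv p hp
    refine ⟨n + m, ?_⟩
    rw [smul_add]
    exact add_mem (pow_smul_mem_of_le (hF p hp) (Nat.le_add_right n m) hn)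
      (pow_smul_mem_of_le (hF p hp) (Nat.le_add_left m n) hm)
  smul_mem' := by
    intro a u hu p hp
    obtain ⟨n, hn⟩ := hu p hp
    refine ⟨n, ?_⟩
    rw [smul_comm]
    exact Submodule.smul_mem _ _ hn

variable {x : Fin r → A} {F : Set (ℕ × MvPolynomial (Fin r) A)}
  {hF : ∀ p ∈ F, p.2.IsHomogeneous p.1}

theorem mem_formSaturation {l : ℕ} {B : Submodule A M} {u : M} :
    u ∈ formSaturation x F hF l B ↔ ∀ p ∈ F, ∃ n : ℕ,
      aeval x p.2 ^ n • u ∈ Ideal.span (Set.range x) ^ (n * p.1 + l) • B := Iff.rfl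

theorem pow_smul_le_formSaturation (l : ℕ) (B : Submodule A M) :
    Ideal.span (Set.range x) ^ l • B ≤ formSaturation x F hF l B :=
  fun u hu p _ ↦ ⟨0, by simpa using hu⟩

theorem formSaturation_mono (l : ℕ) {B B' : Submodule A M} (h : B ≤ B') :
    formSaturation x F hF l B ≤ formSaturation x F hF l B' :=
  fun _ hu p hp ↦ (hu p hp).imp fun _ hn ↦ Submodule.smul_mono le_rfl h hn

theorem formSaturation_antitone {l l' : ℕ} (h : l ≤ l') (B : Submodule A M) :
    formSaturation x F hF l' B ≤ formSaturation x F hF l B :=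
  fun _ hu p hp ↦ (hu p hp).imp fun _ hn ↦
    Submodule.smul_mono_left (Ideal.pow_le_pow_right (by omega)) hn

theorem formSaturation_smul_top (l : ℕ) :
    formSaturation x F hF l (Ideal.span (Set.range x) • (⊤ : Submodule A M)) =
      formSaturation x F hF (l + 1) ⊤ := by
  ext u
  simp_rw [mem_formSaturation, ← mul_smul, ← pow_succ, add_assoc]

theorem formSaturation_zero_top : formSaturation x F hF 0 (⊤ : Submodule A M) = ⊤ := by
  refine top_le_iff.1 (le_trans ?_ (pow_smul_le_formSaturation 0 _))
  rw [pow_zero, Ideal.one_eq_top, Submodule.top_smul]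

theorem formSaturation_le_of_forall_mem_annForms {γ : M} {B T : Submodule A M}
    (hT : T = Submodule.span A {γ} ⊔ B) (hK : ∀ p ∈ F, p.2 ∈ annForms x γ B) (l : ℕ) :
    formSaturation x F hF l T ≤ formSaturation x F hF l B := by
  intro u hu p hp
  obtain ⟨n, hn⟩ := hu p hp
  refine ⟨n + 1, ?_⟩
  have h1 : T ≤ (Ideal.span (Set.range x) ^ p.1 • B).comap
      (LinearMap.lsmul A M (aeval x p.2)) := by
    rw [hT, sup_le_iff, Submodule.span_singleton_le_iff_mem]
    refine ⟨(mem_annForms_of_isHomogeneous (hF p hp)).1 (hK p hp), fun b hb ↦ ?_⟩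
    exact Submodule.smul_mem_smul ((Ideal.mem_span_pow_iff_exists_isHomogeneous x _).2
      ⟨p.2, hF p hp, by rw [aeval_eq_eval]⟩) hb
  have h2 : Ideal.span (Set.range x) ^ (n * p.1 + l) • T ≤
      (Ideal.span (Set.range x) ^ ((n + 1) * p.1 + l) • B).comap
        (LinearMap.lsmul A M (aeval x p.2)) := by
    refine (Submodule.smul_mono le_rfl h1).trans ?_
    refine (Submodule.smul_comap_le_comap_smul _ _ _).trans ?_
    rw [← mul_smul, ← pow_add, show n * p.1 + l + p.1 = (n + 1) * p.1 + l by ring]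
  have := h2 hn
  rwa [Submodule.mem_comap, LinearMap.lsmul_apply, ← mul_smul, ← pow_succ'] at this

variable [IsLocalRing A]

theorem formSaturation_le_sup {γ : M} {B T : Submodule A M}
    (hT : T = Submodule.span A {γ} ⊔ B)
    (hK : ∀ f, f ∈ annForms x γ B ↔ MvPolynomial.map (residue A) f = 0)
    (hp : ∀ p : MvPolynomial (Fin r) (ResidueField A), Prime p →
      ∃ q ∈ F, ¬ p ∣ MvPolynomial.map (residue A) q.2)
    (h0 : ∃ q ∈ F, MvPolynomial.map (residue A) q.2 ≠ 0) (l : ℕ) :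
    formSaturation x F hF l T ≤
      Ideal.span (Set.range x) ^ l • Submodule.span A {γ} ⊔ formSaturation x F hF l B := by
  intro u hu
  have key (p) (hp : p ∈ F) : ∃ (n : ℕ) (h : MvPolynomial (Fin r) A),
      h.IsHomogeneous (n * p.1 + l) ∧
        aeval x p.2 ^ n • u - aeval x h • γ ∈ Ideal.span (Set.range x) ^ (n * p.1 + l) • B := by
    obtain ⟨n, hn⟩ := hu p hp
    rw [hT, Submodule.smul_sup, Submodule.mem_sup] at hn
    obtain ⟨y, hy, z, hz, hyz⟩ := hn
    obtain ⟨q, hq, rfl⟩ := Submodule.mem_smul_span_singleton.1 hy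
    obtain ⟨h, hh, rfl⟩ := (Ideal.mem_span_pow_iff_exists_isHomogeneous x _).1 hq
    refine ⟨n, h, hh, ?_⟩
    rw [← hyz, aeval_eq_eval, add_sub_cancel_left]
    exact hz
  choose! n h hh hmem using key
  set π := MvPolynomial.map (σ := Fin r) (residue A) with hπ
  have hcross (p) (hp : p ∈ F) (q) (hq : q ∈ F) :
      π q.2 ^ n q * π (h p) = π p.2 ^ n p * π (h q) := by
    rw [← map_pow, ← map_pow, ← map_mul, ← map_mul, ← sub_eq_zero, ← map_sub, ← hK]
    have e1 : (q.2 ^ n q * h p).IsHomogeneous (n p * p.1 + n q * q.1 + l) := by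
      have := ((hF q hq).pow (n q)).mul (hh p hp)
      rwa [show q.1 * n q + (n p * p.1 + l) = n p * p.1 + n q * q.1 + l by ring] at this
    have e2 : (p.2 ^ n p * h q).IsHomogeneous (n p * p.1 + n q * q.1 + l) := by
      have := ((hF p hp).pow (n p)).mul (hh q hq)
      rwa [show p.1 * n p + (n q * q.1 + l) = n p * p.1 + n q * q.1 + l by ring] at this
    have hpow (p) (hp : p ∈ F) : aeval x p.2 ^ n p ∈ Ideal.span (Set.range x) ^ (n p * p.1) := by
      refine (Ideal.mem_span_pow_iff_exists_isHomogeneous x _).2 ⟨p.2 ^ n p, ?_, ?_⟩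
      · rw [mul_comm]; exact (hF p hp).pow _
      · rw [map_pow, aeval_eq_eval]
    rw [mem_annForms_of_isHomogeneous (e1.sub e2)]
    have m1 := smul_mem_pow_smul (hpow q hq) (hmem p hp)
    have m2 := smul_mem_pow_smul (hpow p hp) (hmem q hq)
    rw [show n q * q.1 + (n p * p.1 + l) = n p * p.1 + n q * q.1 + l by ring] at m1
    rw [← add_assoc] at m2
    have := sub_mem m2 m1
    convert this using 1
    simp only [map_sub, map_mul, map_pow, smul_sub, sub_smul, mul_smul]
    rw [smul_comm (aeval x q.2 ^ n q) (aeval x p.2 ^ n p) u]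
    abel
  obtain ⟨q₀, hq₀, hne⟩ := h0
  obtain ⟨c, hc⟩ : π q₀.2 ^ n q₀ ∣ π (h q₀) := by
    refine dvd_of_forall_dvd_pow_mul (F := (fun q ↦ π q.2) '' F) (fun p hpp ↦ ?_) _
      (pow_ne_zero _ hne) _ ?_
    · obtain ⟨q, hq, hq'⟩ := hp p hpp
      exact ⟨_, ⟨q, hq, rfl⟩, hq'⟩
    · rintro _ ⟨q, hq, rfl⟩
      exact ⟨n q, by rw [hcross q₀ hq₀ q hq]; exact dvd_mul_right _ _⟩
  have hall (q) (hq : q ∈ F) : π (h q) = π q.2 ^ n q * c := by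
    refine mul_left_cancel₀ (pow_ne_zero (n q₀) hne) ?_
    rw [hcross q hq q₀ hq₀, hc]
    ring
  obtain ⟨c, rfl⟩ := MvPolynomial.map_surjective (residue A) residue_surjective c
  rw [Submodule.mem_sup]
  refine ⟨(gradeHom x c).coeff l • γ, Submodule.smul_mem_smul (coeff_gradeHom_mem x c l)
    (Submodule.mem_span_singleton_self γ), u - (gradeHom x c).coeff l • γ, fun p hp ↦ ⟨n p, ?_⟩,
    add_sub_cancel _ _⟩
  have e1 : h p - p.2 ^ n p * c ∈ annForms x γ B := by
    rw [hK, map_sub, map_mul, map_pow, hall p hp, sub_self]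
  have e2 := e1 (n p * p.1 + l)
  rw [map_sub, Polynomial.coeff_sub, coeff_gradeHom_of_isHomogeneous x (hh p hp), if_pos rfl,
    mul_comm (n p), coeff_gradeHom_mul_of_isHomogeneous x ((hF p hp).pow (n p)), map_pow,
    mul_comm p.1] at e2
  convert add_mem (hmem p hp) e2 using 1
  rw [smul_sub, sub_smul, mul_smul]
  abel

theorem length_quot_formSaturation {γ : M} {B T : Submodule A M}
    (hT : T = Submodule.span A {γ} ⊔ B)
    (hK : ∀ f, f ∈ annForms x γ B ↔ MvPolynomial.map (residue A) f = 0)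
    (hp : ∀ p : MvPolynomial (Fin r) (ResidueField A), Prime p →
      ∃ q ∈ F, ¬ p ∣ MvPolynomial.map (residue A) q.2)
    (h0 : ∃ q ∈ F, MvPolynomial.map (residue A) q.2 ≠ 0) (l : ℕ) :
    length A (M ⧸ formSaturation x F hF l B) = length A (M ⧸ formSaturation x F hF l T) +
      (finrank (ResidueField A) (homogeneousSubmodule (Fin r) (ResidueField A) l) : ℕ∞) := by
  have hle : formSaturation x F hF l B ≤ formSaturation x F hF l T :=
    formSaturation_mono l (hT ▸ le_sup_right)
  have heq : formSaturation x F hF l T =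
      Ideal.span (Set.range x) ^ l • Submodule.span A {γ} ⊔ formSaturation x F hF l B := by
    refine le_antisymm (formSaturation_le_sup hT hK hp h0 l) (sup_le ?_ hle)
    exact (Submodule.smul_mono le_rfl (hT ▸ le_sup_left)).trans (pow_smul_le_formSaturation l T)
  have h1 := length_range_add_finrank (formMap x γ (formSaturation x F hF l B) l) ⊥ ?_
  · rw [length_quot_eq_add_length_map hle, ← h1, range_formMap]
    conv_lhs => rw [heq]
    have hz : finrank (ResidueField A) (gradedPart (⊥ : Ideal (MvPolynomial (Fin r)
        (ResidueField A))) l) = 0 := by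
      rw [Submodule.finrank_eq_zero, Submodule.eq_bot_iff]
      exact fun f hf ↦ (mem_gradedPart.1 hf).1
    rw [hz, Nat.cast_zero, add_zero, Submodule.map_sup, Submodule.mkQ_map_self, sup_bot_eq, heq]
  · intro f
    rw [formMap_eq_zero, Ideal.mem_bot, ← hK]
    refine ⟨fun hf ↦ ?_, fun hf ↦
      pow_smul_le_formSaturation l B ((mem_annForms_of_isHomogeneous f.2).1 hf)⟩
    obtain ⟨q, hq, hne⟩ := h0
    obtain ⟨n, hn⟩ := hf q hq
    have hhom : (q.2 ^ n * f.1).IsHomogeneous (n * q.1 + l) := by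
      rw [mul_comm n]
      exact ((hF q hq).pow n).mul f.2
    rw [← mul_smul, ← map_pow, ← map_mul, ← mem_annForms_of_isHomogeneous hhom, hK, map_mul,
      map_pow] at hn
    rw [hK]
    exact (mul_eq_zero.1 hn).resolve_left (pow_ne_zero n hne)

end Saturation

section GoodFactors

open MvPolynomial Module

variable {A M : Type} [CommRing A] [IsLocalRing A] [AddCommGroup M] [Module A M] {r : ℕ}

theorem sum_finrank_gradedPart_le {K : Type*} [Field K] (hr : 1 ≤ r)
    (J : Ideal (MvPolynomial (Fin r) K)) (L : ℕ) :
    ∑ l ∈ Finset.range (L + 1), finrank K (gradedPart J l) ≤ (L + r).choose r := by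
  rw [← sum_finrank_homogeneousSubmodule (K := K) hr]
  exact Finset.sum_le_sum fun l _ ↦ Submodule.finrank_mono inf_le_right

theorem sum_finrank_gradedPart_le_of_dvd {K : Type*} [Field K] (hr : 1 ≤ r)
    {J : Ideal (MvPolynomial (Fin r) K)} {p : MvPolynomial (Fin r) K} (hp0 : p ≠ 0)
    (hp : ¬ IsUnit p) (hJ : ∀ f ∈ J, p ∣ f) (L : ℕ) :
    ∑ l ∈ Finset.range (L + 1 + 1), finrank K (gradedPart J l) ≤ (L + r).choose r := by
  rw [Finset.sum_range_succ', finrank_gradedPart_zero hp0 hp hJ, add_zero,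
    ← sum_finrank_homogeneousSubmodule (K := K) hr]
  exact Finset.sum_le_sum fun l _ ↦ finrank_gradedPart_le hr hp0 hp hJ l

theorem exists_isHomogeneous_mem_residueForms {x : Fin r → A} {γ : M} {B : Submodule A M}
    (h : ∀ a ∈ maximalIdeal A, a • γ ∈ B) (hne : residueForms x γ B ≠ ⊥) :
    ∃ (d : ℕ) (g : MvPolynomial (Fin r) (ResidueField A)),
      g ≠ 0 ∧ g ∈ residueForms x γ B ∧ g.IsHomogeneous d := by
  obtain ⟨g, hg, hg0⟩ := Submodule.exists_mem_ne_zero_of_ne_bot hne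
  obtain ⟨f, rfl⟩ := MvPolynomial.map_surjective (residue A) residue_surjective g
  rw [map_mem_residueForms h] at hg
  have : ∃ d, MvPolynomial.map (residue A) (homogeneousComponent d f) ≠ 0 := by
    by_contra! hcon
    apply hg0
    rw [← sum_homogeneousComponent f, map_sum]
    exact Finset.sum_eq_zero fun d _ ↦ hcon d
  obtain ⟨d, hd⟩ := this
  exact ⟨d, _, hd, (map_mem_residueForms h).2 (homogeneousComponent_mem_annForms hg d),
    (homogeneousComponent_isHomogeneous d f).map _⟩

theorem exists_choose_le_sum_finrank (hr : 1 ≤ r) {x : Fin r → A} {γ : M} {B : Submodule A M}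
    (h : ∀ a ∈ maximalIdeal A, a • γ ∈ B) (hne : residueForms x γ B ≠ ⊥) :
    ∃ δ, ∀ L ≥ δ, (L - δ + r).choose r ≤ ∑ l ∈ Finset.range (L + 1),
      finrank (ResidueField A) (gradedPart (residueForms x γ B) l) := by
  obtain ⟨d, g, hg0, hg, hd⟩ := exists_isHomogeneous_mem_residueForms h hne
  refine ⟨d, fun L hL ↦ ?_⟩
  rw [show L + 1 = d + (L - d + 1) by omega, Finset.sum_range_add,
    ← sum_finrank_homogeneousSubmodule (K := ResidueField A) hr]
  exact le_add_left (Finset.sum_le_sum fun l _ ↦ finrank_le_gradedPart hg0 hg hd l)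

/-- The steps of a chain whose residue forms vanish. -/
noncomputable def goodSteps (x : Fin r → A) {B : Submodule A M} (S : SocleChain B) : Finset ℕ :=
  open scoped Classical in
  {i ∈ Finset.range S.len | residueForms x (S.gen i) (S.sub (i + 1)) = ⊥}

theorem card_goodSteps (hr : 1 ≤ r) (x : Fin r → A)
    (S : SocleChain (Ideal.span (Set.range x) • (⊤ : Submodule A M))) (e : ℤ) (N : ℕ) (C : ℤ)
    (hlen : ∀ L ≥ N, ∃ l : ℕ,
      length A (M ⧸ (Ideal.span (Set.range x) ^ (L + 1) • (⊤ : Submodule A M))) = l ∧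
      |(l : ℤ) - e * ((L + r).choose r : ℕ)| * ((L : ℤ) + 1) ^ 2 ≤ C * ((L : ℤ) + 1) ^ r) :
    ((goodSteps x S).card : ℤ) = e ∧ ∀ i ∈ Finset.range S.len \ goodSteps x S,
      ∀ p : MvPolynomial (Fin r) (ResidueField A), p ≠ 0 → ¬ IsUnit p →
        ¬ ∀ f ∈ residueForms x (S.gen i) (S.sub (i + 1)), p ∣ f := by
  obtain ⟨s, rfl⟩ : ∃ s, r = s + 1 := ⟨r - 1, by omega⟩
  choose! len hlen1 hlen2 using hlen
  obtain ⟨h1, h2⟩ := card_eq_of_asymptotic (c := S.len) e (goodSteps x S)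
    (Finset.filter_subset _ _)
    (fun i L ↦ ∑ l ∈ Finset.range (L + 1), finrank (ResidueField A)
      (gradedPart (residueForms x (S.gen i) (S.sub (i + 1))) l)) len N C hlen2
    (fun L hL ↦ by
      have := length_quot_pow_add_sum_sum hr x S L
      rw [hlen1 L hL] at this
      exact_mod_cast this)
    (fun i hi L ↦ by
      refine Finset.sum_eq_zero fun l _ ↦ ?_
      rw [(Finset.mem_filter.1 hi).2, Submodule.finrank_eq_zero, Submodule.eq_bot_iff]
      exact fun f hf ↦ (mem_gradedPart.1 hf).1)
    (fun i L ↦ sum_finrank_gradedPart_le hr _ L)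
    (fun i hi ↦ by
      rw [Finset.mem_sdiff] at hi
      exact exists_choose_le_sum_finrank hr (S.smul_gen i (Finset.mem_range.1 hi.1))
        fun h ↦ hi.2 (Finset.mem_filter.2 ⟨hi.1, h⟩))
  exact ⟨h1, fun i hi p hp0 hp hJ ↦
    h2 i hi fun L ↦ sum_finrank_gradedPart_le_of_dvd hr hp0 hp hJ L⟩

/-- The forms annihilating all bad factors of a chain. -/
def commonForms (x : Fin r → A) {B : Submodule A M} (S : SocleChain B) :
    Set (ℕ × MvPolynomial (Fin r) A) :=
  {q | q.2.IsHomogeneous q.1 ∧ ∀ i ∈ Finset.range S.len \ goodSteps x S,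
    q.2 ∈ annForms x (S.gen i) (S.sub (i + 1))}

theorem exists_commonForms_not_dvd {x : Fin r → A} {B : Submodule A M} (S : SocleChain B)
    (h : ∀ i ∈ Finset.range S.len \ goodSteps x S,
      ∀ p : MvPolynomial (Fin r) (ResidueField A), p ≠ 0 → ¬ IsUnit p →
        ¬ ∀ f ∈ residueForms x (S.gen i) (S.sub (i + 1)), p ∣ f)
    (p : MvPolynomial (Fin r) (ResidueField A)) (hp : Prime p) :
    ∃ q ∈ commonForms x S, ¬ p ∣ MvPolynomial.map (residue A) q.2 := by
  by_contra! hcon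
  have hprime : (Ideal.span {p}).IsPrime := (Ideal.span_singleton_prime hp.ne_zero).2 hp
  have hle : (Finset.range S.len \ goodSteps x S).inf
      (fun i ↦ annForms x (S.gen i) (S.sub (i + 1))) ≤
      (Ideal.span {p}).comap (MvPolynomial.map (residue A)) := by
    intro f hf
    rw [Submodule.mem_finsetInf] at hf
    rw [Ideal.mem_comap, ← sum_homogeneousComponent f, map_sum]
    exact sum_mem fun d _ ↦ Ideal.mem_span_singleton.2 (hcon (d, homogeneousComponent d f)
      ⟨homogeneousComponent_isHomogeneous d f,
        fun i hi ↦ homogeneousComponent_mem_annForms (hf i hi) d⟩)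
  obtain ⟨i, hi, hi'⟩ := (Ideal.IsPrime.inf_le' (Ideal.comap_isPrime _ _)).1 hle
  refine h i hi p hp.ne_zero hp.not_isUnit fun f hf ↦ ?_
  rw [← Ideal.mem_span_singleton]
  exact Ideal.map_le_iff_le_comap.2 hi' hf

theorem length_quot_formSaturation_step (hr : 1 ≤ r) {x : Fin r → A}
    (S : SocleChain (Ideal.span (Set.range x) • (⊤ : Submodule A M)))
    (h : ∀ i ∈ Finset.range S.len \ goodSteps x S,
      ∀ p : MvPolynomial (Fin r) (ResidueField A), p ≠ 0 → ¬ IsUnit p →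
        ¬ ∀ f ∈ residueForms x (S.gen i) (S.sub (i + 1)), p ∣ f) (l : ℕ) :
    length A (M ⧸ formSaturation x (commonForms x S) (fun _ h ↦ h.1) (l + 1)
        (⊤ : Submodule A M)) =
      length A (M ⧸ formSaturation x (commonForms x S) (fun _ h ↦ h.1) l (⊤ : Submodule A M)) +
        (((goodSteps x S).card * finrank (ResidueField A)
          (homogeneousSubmodule (Fin r) (ResidueField A) l) : ℕ) : ℕ∞) ∧
    formSaturation x (commonForms x S) (fun _ h ↦ h.1) l (⊤ : Submodule A M) ≤
      Ideal.span (Set.range x) ^ l • (⊤ : Submodule A M) ⊔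
        formSaturation x (commonForms x S) (fun _ h ↦ h.1) (l + 1) (⊤ : Submodule A M) := by
  have hp := exists_commonForms_not_dvd S h
  have h0 : ∃ q ∈ commonForms x S, MvPolynomial.map (residue A) q.2 ≠ 0 := by
    obtain ⟨q, hq, hq'⟩ := hp (X ⟨0, hr⟩) (X_prime)
    exact ⟨q, hq, fun h ↦ hq' (h ▸ dvd_zero _)⟩
  have key (n : ℕ) (hn : n ≤ S.len) :
      length A (M ⧸ formSaturation x (commonForms x S) (fun _ h ↦ h.1) l (S.sub n)) =
        length A (M ⧸ formSaturation x (commonForms x S) (fun _ h ↦ h.1) l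
          (⊤ : Submodule A M)) +
        ((({i ∈ goodSteps x S | i < n}).card * finrank (ResidueField A)
          (homogeneousSubmodule (Fin r) (ResidueField A) l) : ℕ) : ℕ∞) ∧
      formSaturation x (commonForms x S) (fun _ h ↦ h.1) l (⊤ : Submodule A M) ≤
        Ideal.span (Set.range x) ^ l • (⊤ : Submodule A M) ⊔
          formSaturation x (commonForms x S) (fun _ h ↦ h.1) l (S.sub n) := by
    induction n with
    | zero =>
      rw [S.sub_zero]
      exact ⟨by simp, le_sup_right⟩
    | succ n ih =>
      obtain ⟨ih1, ih2⟩ := ih (by omega)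
      have hsoc := S.smul_gen n hn
      by_cases hg : n ∈ goodSteps x S
      · have hK (f) : f ∈ annForms x (S.gen n) (S.sub (n + 1)) ↔
            MvPolynomial.map (residue A) f = 0 := by
          rw [← map_mem_residueForms hsoc, (Finset.mem_filter.1 hg).2, Ideal.mem_bot]
        have e1 : ({i ∈ goodSteps x S | i < n + 1}) = insert n {i ∈ goodSteps x S | i < n} := by
          ext i
          simp only [Finset.mem_filter, Finset.mem_insert]
          constructor
          · rintro ⟨h1, h2⟩
            rcases Nat.lt_succ_iff_lt_or_eq.1 h2 with h3 | h3
            · exact Or.inr ⟨h1, h3⟩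
            · exact Or.inl h3
          · rintro (rfl | ⟨h1, h2⟩)
            · exact ⟨hg, by omega⟩
            · exact ⟨h1, by omega⟩
        constructor
        · rw [length_quot_formSaturation (S.sub_eq n hn) hK hp h0 l, ih1, e1,
            Finset.card_insert_of_notMem (by simp), add_mul, one_mul, Nat.cast_add, add_assoc]
        · refine ih2.trans (sup_le le_sup_left ?_)
          refine (formSaturation_le_sup (S.sub_eq n hn) hK hp h0 l).trans ?_
          exact sup_le_sup_right (Submodule.smul_mono le_rfl le_top) _
      · have hb : n ∈ Finset.range S.len \ goodSteps x S :=
          Finset.mem_sdiff.2 ⟨Finset.mem_range.2 hn, hg⟩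
        have e1 : formSaturation x (commonForms x S) (fun _ h ↦ h.1) l (S.sub (n + 1)) =
            formSaturation x (commonForms x S) (fun _ h ↦ h.1) l (S.sub n) := by
          refine le_antisymm (formSaturation_mono l (S.sub_eq n hn ▸ le_sup_right)) ?_
          exact formSaturation_le_of_forall_mem_annForms (S.sub_eq n hn)
            (fun q hq ↦ hq.2 n hb) l
        have e2 : ({i ∈ goodSteps x S | i < n + 1}) = {i ∈ goodSteps x S | i < n} := by
          refine Finset.filter_congr fun i hi ↦ ?_
          have : i ≠ n := fun h ↦ hg (h ▸ hi)
          omega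
        rw [e1, e2]
        exact ⟨ih1, ih2⟩
  have := key S.len le_rfl
  rw [S.sub_len, formSaturation_smul_top, Finset.filter_true_of_mem] at this
  · exact this
  · exact fun i hi ↦ Finset.mem_range.1 (Finset.mem_filter.1 hi).1

theorem length_quot_formSaturation_top (hr : 1 ≤ r) {x : Fin r → A}
    (S : SocleChain (Ideal.span (Set.range x) • (⊤ : Submodule A M)))
    (h : ∀ i ∈ Finset.range S.len \ goodSteps x S,
      ∀ p : MvPolynomial (Fin r) (ResidueField A), p ≠ 0 → ¬ IsUnit p →
        ¬ ∀ f ∈ residueForms x (S.gen i) (S.sub (i + 1)), p ∣ f) (L : ℕ) :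
    length A (M ⧸ formSaturation x (commonForms x S) (fun _ h ↦ h.1) (L + 1)
        (⊤ : Submodule A M)) = (((goodSteps x S).card * (L + r).choose r : ℕ) : ℕ∞) := by
  rw [← sum_finrank_homogeneousSubmodule (K := ResidueField A) hr]
  generalize L + 1 = n
  induction n with
  | zero =>
    rw [formSaturation_zero_top]
    simp [Module.length_eq_zero]
  | succ n ih =>
    rw [(length_quot_formSaturation_step hr S h n).1, ih, Finset.sum_range_succ, mul_add,
      Nat.cast_add]

end GoodFactors

section Core

open Module

theorem length_quot_quot_smul {A M : Type} [CommRing A] [AddCommGroup M] [Module A M]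
    (U : Submodule A M) (I : Ideal A) :
    length A ((M ⧸ U) ⧸ (I • (⊤ : Submodule A (M ⧸ U)))) =
      length A (M ⧸ (U ⊔ I • (⊤ : Submodule A M))) := by
  have h : I • (⊤ : Submodule A (M ⧸ U)) = (I • (⊤ : Submodule A M)).map U.mkQ := by
    rw [Submodule.map_smul'', Submodule.map_top, Submodule.range_mkQ]
  rw [h]
  exact (Submodule.quotientQuotientEquivQuotientSup U (I • ⊤)).length_eq

variable {A M : Type} [CommRing A] [IsLocalRing A] [IsNoetherianRing A] [AddCommGroup M]
  [Module A M] [Module.Finite A M]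

theorem le_smul_top_sup_iInf [IsPrecomplete (maximalIdeal A) M] {Q : Ideal A}
    (hQ : Q ≤ maximalIdeal A) {F : ℕ → Submodule A M} (hF : Antitone F)
    (hstep : ∀ l, F l ≤ Q ^ l • ⊤ ⊔ F (l + 1)) : F 1 ≤ Q • ⊤ ⊔ ⨅ l, F l := by
  intro u hu
  have hnext (n : ℕ) (v : M) : ∃ w, v ∈ F (n + 1) →
      w ∈ F (n + 2) ∧ v - w ∈ Q ^ (n + 1) • (⊤ : Submodule A M) := by
    by_cases hv : v ∈ F (n + 1)
    · obtain ⟨y, hy, w, hw, rfl⟩ := Submodule.mem_sup.1 (hstep (n + 1) hv)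
      exact ⟨w, fun _ ↦ ⟨hw, by simpa using hy⟩⟩
    · exact ⟨0, fun h ↦ absurd h hv⟩
  choose next hnext using hnext
  let v : ℕ → M := fun n ↦ Nat.rec u next n
  have hv (n : ℕ) : v n ∈ F (n + 1) := by
    induction n with
    | zero => exact hu
    | succ n ih => exact (hnext n _ ih).1
  have hd (n : ℕ) : v n - v (n + 1) ∈ Q ^ (n + 1) • (⊤ : Submodule A M) := (hnext n _ (hv n)).2
  have hd' {m n : ℕ} (hmn : m ≤ n) : v m - v n ∈ Q ^ (m + 1) • (⊤ : Submodule A M) := by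
    induction n, hmn using Nat.le_induction with
    | base => simp
    | succ n hmn ih =>
      rw [← sub_add_sub_cancel (v m) (v n)]
      exact add_mem ih (Submodule.smul_mono_left (Ideal.pow_le_pow_right (by omega)) (hd n))
  have hm {i j : ℕ} (hij : i ≤ j) : Q ^ j • (⊤ : Submodule A M) ≤ maximalIdeal A ^ i • ⊤ :=
    Submodule.smul_mono_left ((Ideal.pow_right_mono hQ j).trans (Ideal.pow_le_pow_right hij))
  obtain ⟨z, hz⟩ := IsPrecomplete.prec (I := maximalIdeal A) (M := M) inferInstance
    (f := fun n ↦ u - v n) (fun {m n} hmn ↦ by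
      rw [SModEq.sub_mem, ← neg_mem_iff]
      simpa using hm m.le_succ (hd' hmn))
  have hz' (n : ℕ) : u - v n - z ∈ maximalIdeal A ^ n • (⊤ : Submodule A M) :=
    SModEq.sub_mem.1 (hz n)
  refine Submodule.mem_sup.2 ⟨z, ?_, u - z, ?_, by simp⟩
  · refine mem_of_forall_mem_sup_pow_smul (maximalIdeal.isMaximal A).ne_top _ fun n ↦ ?_
    rw [← sub_sub_cancel (u - v n) z]
    refine sub_mem (Submodule.mem_sup_left ?_) (Submodule.mem_sup_right (hz' n))
    simpa [v] using hd' n.zero_le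
  · rw [Submodule.mem_iInf]
    intro l
    refine mem_of_forall_mem_sup_pow_smul (maximalIdeal.isMaximal A).ne_top _ fun n ↦ ?_
    rw [show u - z = v (n + l) + (u - v (n + l) - z) by abel]
    refine add_mem (Submodule.mem_sup_left (hF (by omega) (hv (n + l)))) (Submodule.mem_sup_right ?_)
    exact Submodule.smul_mono_left (Ideal.pow_le_pow_right (by omega)) (hz' (n + l))

/-- Over a complete local ring, the vanishing of the first Hilbert coefficient of an ideal
generated by `r` elements splits off a submodule `U` such that these elements behave like a
regular sequence on `M ⧸ U`. -/
theorem exists_submodule_length_quot [IsPrecomplete (maximalIdeal A) M] {r : ℕ} (hr : 1 ≤ r)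
    (x : Fin r → A) (hx : ∀ j, x j ∈ maximalIdeal A)
    (hfin : IsFiniteLength A (M ⧸ (Ideal.span (Set.range x) • (⊤ : Submodule A M))))
    (e : ℤ) (N : ℕ) (C : ℤ)
    (hlen : ∀ L ≥ N, ∃ l : ℕ,
      length A (M ⧸ (Ideal.span (Set.range x) ^ (L + 1) • (⊤ : Submodule A M))) = l ∧
      |(l : ℤ) - e * ((L + r).choose r : ℕ)| * ((L : ℤ) + 1) ^ 2 ≤ C * ((L : ℤ) + 1) ^ r) :
    ∃ (b : ℕ) (U : Submodule A M), (b : ℤ) = e ∧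
      length A ((M ⧸ U) ⧸ (Ideal.span (Set.range x) • (⊤ : Submodule A (M ⧸ U)))) ≤ b ∧
      ∀ l, ((b * (l + r).choose r : ℕ) : ℕ∞) ≤
        length A ((M ⧸ U) ⧸ (Ideal.span (Set.range x) ^ (l + 1) •
          (⊤ : Submodule A (M ⧸ U)))) := by
  have hQ : Ideal.span (Set.range x) ≤ maximalIdeal A :=
    Ideal.span_le.2 (Set.range_subset_iff.2 hx)
  obtain ⟨n, hn⟩ := exists_pow_smul_top_le _ hfin
  obtain ⟨S⟩ := nonempty_socleChain _ hn
  obtain ⟨hcard, hbad⟩ := card_goodSteps hr x S e N C hlen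
  have htop := length_quot_formSaturation_top hr S hbad
  set F : ℕ → Submodule A M :=
    fun l ↦ formSaturation x (commonForms x S) (fun _ h ↦ h.1) l ⊤ with hFdef
  have hF : Antitone F := fun _ _ h ↦ formSaturation_antitone h ⊤
  refine ⟨(goodSteps x S).card, ⨅ l, F l, hcard, ?_, fun l ↦ ?_⟩
  · have := htop 0
    rw [zero_add, zero_add, Nat.choose_self, mul_one] at this
    rw [length_quot_quot_smul, ← this]
    refine length_quot_le_of_le (N := M) ?_
    rw [sup_comm]
    exact le_smul_top_sup_iInf hQ hF fun l ↦ (length_quot_formSaturation_step hr S hbad l).2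
  · rw [length_quot_quot_smul, ← htop l]
    exact length_quot_le_of_le (sup_le (iInf_le F (l + 1)) (pow_smul_le_formSaturation _ _))

end Core

section HilbertCoefficients

theorem exists_abs_sub_mul_pow_le {r k : ℕ} (e : ℕ → ℤ) (hvan : ∀ i, 1 ≤ i → i ≤ k → e i = 0) :
    ∃ C : ℕ, ∀ n : ℕ,
      |∑ i ∈ Finset.range (r + 1), (-1 : ℤ) ^ i * e i * ((n + r - i).choose (r - i) : ℤ) -
        e 0 * ((n + r).choose r : ℕ)| * ((n : ℤ) + 1) ^ (k + 1) ≤ C * ((n : ℤ) + 1) ^ r := by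
  refine ⟨∑ i ∈ Finset.range r, (e (i + 1)).natAbs, fun n ↦ ?_⟩
  rw [Finset.sum_range_succ']
  simp only [pow_zero, one_mul, Nat.sub_zero, add_sub_cancel_right]
  refine (mul_le_mul_of_nonneg_right (Finset.abs_sum_le_sum_abs _ _) (by positivity)).trans ?_
  push_cast
  rw [Finset.sum_mul, Finset.sum_mul]
  refine Finset.sum_le_sum fun i hi ↦ ?_
  rw [Finset.mem_range] at hi
  rw [abs_mul, abs_mul, abs_pow, abs_neg, abs_one, one_pow, one_mul, Nat.abs_cast, mul_assoc]
  by_cases hik : i + 1 ≤ k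
  · simp [hvan (i + 1) (by omega) hik]
  · refine mul_le_mul_of_nonneg_left ?_ (abs_nonneg _)
    have h1 : (n + r - (i + 1)).choose (r - (i + 1)) ≤ (n + 1) ^ (r - (i + 1)) := by
      rw [Nat.add_sub_assoc (by omega)]
      exact choose_add_le_pow n _
    have h2 : (n + r - (i + 1)).choose (r - (i + 1)) * (n + 1) ^ (k + 1) ≤ (n + 1) ^ r :=
      (Nat.mul_le_mul h1 (Nat.pow_le_pow_right n.succ_pos (by omega : k + 1 ≤ i + 1))).trans
        (by rw [← pow_add, Nat.sub_add_cancel (by omega)])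
    exact_mod_cast h2

end HilbertCoefficients

section Growth

open Module

variable {A M : Type} [CommRing A] [IsLocalRing A] [IsNoetherianRing A] [AddCommGroup M]
  [Module A M] [Module.Finite A M]

theorem pow_smul_top_le_pow_smul_top {A M : Type} [CommRing A] [AddCommGroup M] [Module A M]
    {I Q : Ideal A} (h : I • (⊤ : Submodule A M) ≤ Q • ⊤) (j : ℕ) :
    I ^ j • (⊤ : Submodule A M) ≤ Q ^ j • ⊤ := by
  induction j with
  | zero => simp
  | succ j ih =>
    rw [pow_succ', mul_smul, pow_succ, mul_smul]
    refine (Submodule.smul_mono le_rfl ih).trans ?_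
    rw [← mul_smul, mul_comm, mul_smul]
    exact Submodule.smul_mono le_rfl h

theorem length_quot_comap_subtype_add {A M : Type} [CommRing A] [AddCommGroup M] [Module A M]
    (U : Submodule A M) (I : Ideal A) :
    length A (U ⧸ (I • (⊤ : Submodule A M)).comap U.subtype) +
      length A ((M ⧸ U) ⧸ (I • (⊤ : Submodule A (M ⧸ U)))) =
      length A (M ⧸ (I • (⊤ : Submodule A M))) := by
  rw [length_quot_quot_smul, add_comm,
    length_quot_eq_add_length_map (le_sup_right : I • ⊤ ≤ U ⊔ I • (⊤ : Submodule A M))]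
  congr 1
  have h1 : (U ⊔ I • (⊤ : Submodule A M)).map (I • (⊤ : Submodule A M)).mkQ =
      LinearMap.range ((I • (⊤ : Submodule A M)).mkQ ∘ₗ U.subtype) := by
    rw [LinearMap.range_comp, Submodule.range_subtype, Submodule.map_sup, Submodule.mkQ_map_self,
      sup_bot_eq]
  have h2 : (I • (⊤ : Submodule A M)).comap U.subtype =
      LinearMap.ker ((I • (⊤ : Submodule A M)).mkQ ∘ₗ U.subtype) := by
    rw [LinearMap.ker_comp, Submodule.ker_mkQ]
  rw [h1, h2]
  exact (LinearMap.quotKerEquivRange _).length_eq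

theorem growthLe_of_length_quot_comap_subtype {Q : Ideal A} (hQ : Q ≤ maximalIdeal A)
    (U : Submodule A M) (t C N : ℕ)
    (h : ∀ L ≥ N, length A (U ⧸ (Q ^ (L + 1) • (⊤ : Submodule A M)).comap U.subtype) *
      ((L + 1 : ℕ) : ℕ∞) ≤ ((C * (L + 1) ^ t : ℕ) : ℕ∞)) : GrowthLe A t U := by
  obtain ⟨c, hc⟩ := Ideal.exists_pow_inf_eq_pow_smul (maximalIdeal A) U
  refine ⟨C * (c + 1) ^ t, N, fun l hl ↦ ?_⟩
  have h1 : (Q ^ (l + c + 1) • (⊤ : Submodule A M)).comap U.subtype ≤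
      maximalIdeal A ^ l • (⊤ : Submodule A U) := by
    rw [← Submodule.map_le_map_iff_of_injective U.subtype_injective, Submodule.map_comap_subtype,
      Submodule.map_smul'', Submodule.map_top, Submodule.range_subtype, inf_comm]
    have h2 : Q ^ (l + c + 1) • (⊤ : Submodule A M) ≤ maximalIdeal A ^ (l + c) • ⊤ :=
      Submodule.smul_mono_left
        ((Ideal.pow_right_mono hQ _).trans (Ideal.pow_le_pow_right (Nat.le_succ _)))
    refine (inf_le_inf_right U h2).trans ?_
    rw [hc (l + c) (by omega), Nat.add_sub_cancel]
    exact Submodule.smul_mono le_rfl inf_le_right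
  calc _ ≤ length A (U ⧸ (Q ^ (l + c + 1) • (⊤ : Submodule A M)).comap U.subtype) *
        ((l + c + 1 : ℕ) : ℕ∞) := by
        refine mul_le_mul' (length_quot_le_of_le h1) ?_
        exact_mod_cast (by omega : l + 1 ≤ l + c + 1)
    _ ≤ ((C * (l + c + 1) ^ t : ℕ) : ℕ∞) := h (l + c) (by omega)
    _ ≤ _ := by
        refine Nat.cast_le.2 ?_
        rw [mul_assoc, ← mul_pow]
        refine Nat.mul_le_mul_left _ (Nat.pow_le_pow_left ?_ t)
        nlinarith

theorem supportDim_lt_of_isFiniteLength {r : ℕ} (x : Fin r → A) (hx : ∀ j, x j ∈ maximalIdeal A)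
    (hfin : IsFiniteLength A (M ⧸ (Ideal.span (Set.range x) • (⊤ : Submodule A M)))) :
    Module.supportDim A M < ((r + 1 : ℕ) : WithBot ℕ∞) := by
  obtain ⟨b, hb⟩ := ENat.ne_top_iff_exists.1 (Module.length_ne_top_iff.2 hfin)
  have hofn : Ideal.ofList (List.ofFn x) = Ideal.span (Set.range x) := by
    simp [Ideal.ofList, Set.range, List.mem_ofFn]
  have hQ : Ideal.span (Set.range x) ≤ maximalIdeal A :=
    Ideal.span_le.2 (Set.range_subset_iff.2 hx)
  refine supportDim_lt_of_growthLe _ _ ⟨b, 0, fun l _ ↦ ?_⟩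
  have h1 := length_quot_pow_le (List.ofFn x) M b (by rw [hofn, hb]) l
  rw [hofn, List.length_ofFn] at h1
  have h2 : length A (M ⧸ (maximalIdeal A ^ l • (⊤ : Submodule A M))) ≤
      ((b * (l + 1) ^ r : ℕ) : ℕ∞) := by
    refine (length_quot_le_of_le (Submodule.smul_mono_left ((Ideal.pow_right_mono hQ (l + 1)).trans
      (Ideal.pow_le_pow_right l.le_succ)))).trans (h1.trans ?_)
    exact_mod_cast Nat.mul_le_mul_left b (choose_add_le_pow l r)
  refine (mul_le_mul_left h2 _).trans ?_
  rw [← Nat.cast_mul, pow_succ, mul_assoc]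

/-- A structure theorem for modules over complete local rings with vanishing Hilbert coefficients
in degrees `1` to `k`. -/
theorem exists_submodule_supportDim_lt [IsPrecomplete (maximalIdeal A) M] {r k : ℕ} (hk1 : 1 ≤ k)
    (hkr : k ≤ r) (x : Fin r → A) (hx : ∀ j, x j ∈ maximalIdeal A)
    (hfin : IsFiniteLength A (M ⧸ (Ideal.span (Set.range x) • (⊤ : Submodule A M))))
    (e : ℤ) (N C : ℕ)
    (hlen : ∀ L ≥ N, ∃ l : ℕ,
      length A (M ⧸ (Ideal.span (Set.range x) ^ (L + 1) • (⊤ : Submodule A M))) = l ∧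
      |(l : ℤ) - e * ((L + r).choose r : ℕ)| * ((L : ℤ) + 1) ^ (k + 1) ≤ C * ((L : ℤ) + 1) ^ r) :
    ∃ (b : ℕ) (U : Submodule A M),
      length A ((M ⧸ U) ⧸ (Ideal.span (Set.range x) • (⊤ : Submodule A (M ⧸ U)))) ≤ b ∧
      (∀ l, ((b * (l + r).choose r : ℕ) : ℕ∞) ≤
        length A ((M ⧸ U) ⧸ (Ideal.span (Set.range x) ^ (l + 1) •
          (⊤ : Submodule A (M ⧸ U))))) ∧
      RingTheory.Sequence.IsWeaklyRegular (M ⧸ U) (List.ofFn x) ∧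
      Module.supportDim A U < ((r - k : ℕ) : WithBot ℕ∞) := by
  have hofn : Ideal.ofList (List.ofFn x) = Ideal.span (Set.range x) := by
    simp [Ideal.ofList, Set.range, List.mem_ofFn]
  have hQ : Ideal.span (Set.range x) ≤ maximalIdeal A :=
    Ideal.span_le.2 (Set.range_subset_iff.2 hx)
  have hpow (L : ℕ) : ((L : ℤ) + 1) ^ 2 ≤ ((L : ℤ) + 1) ^ (k + 1) :=
    pow_le_pow_right₀ (by omega) (by omega)
  obtain ⟨b, U, rfl, h1, h2⟩ := exists_submodule_length_quot (hk1.trans hkr) x hx hfin e N C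
    fun L hL ↦ (hlen L hL).imp fun l hl ↦
      ⟨hl.1, (mul_le_mul_of_nonneg_left (hpow L) (abs_nonneg _)).trans hl.2⟩
  refine ⟨b, U, h1, h2, ?_, ?_⟩
  · refine isWeaklyRegular_of_length _ ?_ _ b (by rwa [hofn]) 
      fun l ↦ by rw [hofn, List.length_ofFn]; exact h2 l
    intro y hy
    obtain ⟨j, rfl⟩ := List.mem_ofFn.1 hy
    exact hx j
  · refine supportDim_lt_of_growthLe _ _
      (growthLe_of_length_quot_comap_subtype hQ U _ C N fun L hL ↦ ?_)
    obtain ⟨l, hl, hl'⟩ := hlen L hL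
    have hadd := length_quot_comap_subtype_add U (Ideal.span (Set.range x) ^ (L + 1))
    have hle := h2 L
    rw [hl] at hadd
    generalize length A (U ⧸ (_ : Submodule A U)) = d at hadd ⊢
    generalize length A ((M ⧸ U) ⧸ (_ : Submodule A (M ⧸ U))) = c at hadd hle
    lift d to ℕ using by rintro rfl; simp at hadd
    lift c to ℕ using by rintro rfl; simp at hadd
    norm_cast at hadd hle ⊢
    have h3 : (d : ℤ) ≤ |(l : ℤ) - b * ((L + r).choose r : ℕ)| := by
      refine le_trans ?_ (le_abs_self _)
      have h4 : (b : ℤ) * ((L + r).choose r : ℕ) ≤ c := by exact_mod_cast hle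
      have h5 : (d : ℤ) + c = l := by exact_mod_cast hadd
      linarith
    have h6 : (d : ℤ) * ((L : ℤ) + 1) ^ (k + 1) ≤ C * ((L : ℤ) + 1) ^ r :=
      (mul_le_mul_of_nonneg_right h3 (by positivity)).trans hl'
    have h7 : d * (L + 1) ^ (k + 1) ≤ C * (L + 1) ^ r := by exact_mod_cast h6
    refine Nat.le_of_mul_le_mul_right (c := (L + 1) ^ k) ?_ (by positivity)
    rw [mul_assoc, ← pow_succ', mul_assoc, ← pow_add, Nat.sub_add_cancel hkr]
    exact h7

end Growth

section Completion

variable {R M : Type} [CommRing R] [IsLocalRing R] [IsNoetherianRing R] [AddCommGroup M]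
  [Module R M] [Module.Finite R M]

theorem length_completion_quot_pow_smul {Q : Ideal R}
    (hQ : IsFiniteLength R (M ⧸ (Q • (⊤ : Submodule R M)))) (j : ℕ) :
    Module.length (AdicCompletion (maximalIdeal R) R) (AdicCompletion (maximalIdeal R) M ⧸
      (Q.map (algebraMap R (AdicCompletion (maximalIdeal R) R)) ^ j • (⊤ :
        Submodule (AdicCompletion (maximalIdeal R) R) (AdicCompletion (maximalIdeal R) M)))) =
    Module.length R (M ⧸ (Q ^ j • (⊤ : Submodule R M))) := by
  obtain ⟨n, hn⟩ := exists_pow_smul_top_le _ hQ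
  rw [← Ideal.map_pow]
  refine length_completion_quot_map_smul (Q ^ j) (n * j) ?_
  rw [pow_mul]
  exact pow_smul_top_le_pow_smul_top hn j

theorem mDim_eq_supportDim (R M : Type) [CommRing R] [AddCommGroup M] [Module R M]
    [Module.Finite R M] : mDim R M = Module.supportDim R M := by
  rw [mDim, Submodule.annihilator_top, Module.supportDim_eq_ringKrullDim_quotient_annihilator]

theorem eq_bot_or_exists_of_lt_natCast {d : WithBot ℕ∞} {n : ℕ} (h : d < (n : WithBot ℕ∞)) :
    d = ⊥ ∨ ∃ m < n, d = (m : WithBot ℕ∞) := by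
  induction d with
  | bot => exact Or.inl rfl
  | coe d =>
    have h2 : d < (n : ℕ∞) := WithBot.coe_lt_coe.1 h
    lift d to ℕ using h2.ne_top
    exact Or.inr ⟨d, Nat.cast_lt.1 h2, rfl⟩

theorem add_natCast_le_of_lt_natCast {d : WithBot ℕ∞} {r k : ℕ}
    (h : d < ((r - k : ℕ) : WithBot ℕ∞)) :
    d + ((k + 1 : ℕ) : WithBot ℕ∞) ≤ ((r : ℕ) : WithBot ℕ∞) := by
  obtain rfl | ⟨m, hm, rfl⟩ := eq_bot_or_exists_of_lt_natCast h
  · simp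
  · exact_mod_cast (by omega : m + (k + 1) ≤ r)

theorem unmixedComp_le {r : ℕ} (rs : List R) (hrs : ∀ x ∈ rs, x ∈ maximalIdeal R)
    (hlen : rs.length = r) (hM : Module.supportDim R M < ((r + 1 : ℕ) : WithBot ℕ∞))
    (U : Submodule R M) (hU : RingTheory.Sequence.IsWeaklyRegular (M ⧸ U) rs) :
    unmixedComp R M ≤ U := by
  refine sSup_le fun T hT ↦ ?_
  change mDim R T < mDim R M at hT
  rw [mDim_eq_supportDim, mDim_eq_supportDim] at hT
  by_contra hTU
  have hne : T.map U.mkQ ≠ ⊥ := by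
    intro h
    apply hTU
    rw [Submodule.eq_bot_iff] at h
    intro t ht
    exact (Submodule.Quotient.mk_eq_zero U).1 (h _ ⟨t, ht, rfl⟩)
  have h1 := natCast_length_le_supportDim_of_isWeaklyRegular rs hrs (M ⧸ U) hU _ hne
  have h2 : Module.supportDim R (T.map U.mkQ) ≤ Module.supportDim R T :=
    Module.supportDim_le_of_surjective (U.mkQ.submoduleMap T) (U.mkQ.submoduleMap_surjective T)
  rw [hlen] at h1
  have h3 : Module.supportDim R M ≤ (r : WithBot ℕ∞) := by
    obtain h | ⟨m, hm, h⟩ := eq_bot_or_exists_of_lt_natCast hM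
    · exact h ▸ bot_le
    · rw [h]
      exact_mod_cast Nat.le_of_lt_succ hm
  exact absurd ((h1.trans h2).trans_lt hT) (not_lt.2 h3)

end Completion
end VanHilb

theorem statement8 (R : Type) [CommRing R] [IsLocalRing R] [IsNoetherianRing R]
    (M : Type) [AddCommGroup M] [Module R M] [Module.Finite R M]
    (r : ℕ) (hr : mDim R M = (r : ℕ∞)) (hr0 : 0 < r)
    (Q : Ideal R) (hQ : IsParamIdeal R Q M r)
    (k : ℕ) (hk1 : 1 ≤ k) (hkr : k ≤ r)
    (e : ℕ → ℤ) (he : HasHilbCoeffs R Q M r e)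
    (hvan : ∀ i, 1 ≤ i → i ≤ k → e i = 0) :
    (mDim (AdicCompletion (maximalIdeal R) R)
        ↥(unmixedComp (AdicCompletion (maximalIdeal R) R)
          (AdicCompletion (maximalIdeal R) M)) + ((k + 1 : ℕ) : WithBot ℕ∞)
      ≤ ((r : ℕ) : WithBot ℕ∞)) ∧
    (∀ j, 1 ≤ j → j ≤ k → Subsingleton ↥(LC R (r - j) M)) ∧
    (k = r → IsCM R M) := by
  obtain ⟨hQm, ⟨x, rfl⟩, hfin⟩ := hQ
  obtain ⟨N, hN⟩ := he
  obtain ⟨C, hC⟩ := VanHilb.exists_abs_sub_mul_pow_le (r := r) e hvan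
  have hx (j : Fin r) : x j ∈ maximalIdeal R := hQm (Ideal.subset_span ⟨j, rfl⟩)
  have hMnt : Nontrivial M := by
    rw [← Module.supportDim_ne_bot_iff_nontrivial R M, ← VanHilb.mDim_eq_supportDim, hr]
    exact WithBot.coe_ne_bot
  have hmap : (maximalIdeal R).map (algebraMap R (AdicCompletion (maximalIdeal R) R)) =
      maximalIdeal (AdicCompletion (maximalIdeal R) R) :=
    (AdicCompletion.maximalIdeal_eq_map ..).symm
  set y : Fin r → AdicCompletion (maximalIdeal R) R :=
    fun j ↦ algebraMap R (AdicCompletion (maximalIdeal R) R) (x j) with hy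
  have hspan : Ideal.span (Set.range y) = (Ideal.span (Set.range x)).map
      (algebraMap R (AdicCompletion (maximalIdeal R) R)) := by
    rw [Ideal.map_span, ← Set.range_comp]
    rfl
  have hym (j : Fin r) : y j ∈ maximalIdeal (AdicCompletion (maximalIdeal R) R) :=
    hmap ▸ Ideal.mem_map_of_mem _ (hx j)
  have hlength (j : ℕ) := VanHilb.length_completion_quot_pow_smul hfin j
  have hlength1 := hlength 1
  rw [← hspan] at hlength hlength1
  rw [pow_one, pow_one] at hlength1
  have hfin' : IsFiniteLength (AdicCompletion (maximalIdeal R) R)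
      (AdicCompletion (maximalIdeal R) M ⧸ (Ideal.span (Set.range y) • (⊤ : Submodule
        (AdicCompletion (maximalIdeal R) R) (AdicCompletion (maximalIdeal R) M)))) := by
    rw [← Module.length_ne_top_iff, hlength1]
    exact Module.length_ne_top_iff.2 hfin
  obtain ⟨b, U, h1, h2, hreg, hdim⟩ := VanHilb.exists_submodule_supportDim_lt hk1 hkr y hym hfin'
    (e 0) N C fun L hL ↦ by
      obtain ⟨l, hl, hl'⟩ := hN L hL
      refine ⟨l, ?_, ?_⟩
      · rw [hlength]
        exact WithBot.coe_injective ((Module.coe_length R _).trans hl)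
      · rw [hl']
        exact hC L
  have hymem : ∀ z ∈ List.ofFn y, z ∈ maximalIdeal (AdicCompletion (maximalIdeal R) R) := by
    intro z hz
    obtain ⟨j, rfl⟩ := List.mem_ofFn.1 hz
    exact hym j
  have hxmem : ∀ z ∈ List.ofFn x, z ∈ maximalIdeal R := by
    intro z hz
    obtain ⟨j, rfl⟩ := List.mem_ofFn.1 hz
    exact hx j
  refine ⟨?_, fun j hj1 hjk ↦ ?_, ?_⟩
  · refine VanHilb.add_natCast_le_of_lt_natCast (lt_of_le_of_lt ?_ hdim)
    rw [VanHilb.mDim_eq_supportDim]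
    have hle := VanHilb.unmixedComp_le (List.ofFn y) hymem (List.length_ofFn)
      (VanHilb.supportDim_lt_of_isFiniteLength y hym hfin') U hreg
    exact Module.supportDim_le_of_injective (Submodule.inclusion hle)
      (Submodule.inclusion_injective hle)
  · refine VanHilb.subsingleton_localCohomology_of_lcVan _ _ _
      (VanHilb.lcVan_of_lcVan_completion _ _ ?_)
    have hofn : List.ofFn y =
        (List.ofFn x).map (algebraMap R (AdicCompletion (maximalIdeal R) R)) := by
      rw [List.map_ofFn]
      rfl
    rw [hofn, RingTheory.Sequence.isWeaklyRegular_map_algebraMap_iff] at hreg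
    refine VanHilb.lcVan_of_shortExact (U.subtype.restrictScalars R) (U.mkQ.restrictScalars R)
      U.subtype_injective U.mkQ_surjective (LinearMap.exact_subtype_mkQ U) ?_ ?_
    · exact VanHilb.lcVan_of_supportDim_lt hmap _ U hdim _ (by omega)
    · exact VanHilb.lcVan_of_isWeaklyRegular _ hxmem _ hreg _ (by rw [List.length_ofFn]; omega)
  · rintro rfl
    rw [Nat.sub_self] at hdim
    have hU : U = ⊥ := (Submodule.subsingleton_iff_eq_bot).1
      ((Module.supportDim_eq_bot_iff_subsingleton _ _).1 (VanHilb.eq_bot_of_lt_natCast_zero hdim))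
    have hofn : Ideal.ofList (List.ofFn x) = Ideal.span (Set.range x) := by
      simp [Ideal.ofList, Set.range, List.mem_ofFn]
    have hregM : RingTheory.Sequence.IsWeaklyRegular M (List.ofFn x) := by
      refine VanHilb.isWeaklyRegular_of_length _ hxmem M b ?_ fun l ↦ ?_
      · rw [VanHilb.length_quot_quot_smul, hU, bot_sup_eq, hlength1] at h1
        rwa [hofn]
      · have := h2 l
        rw [VanHilb.length_quot_quot_smul, hU, bot_sup_eq, hlength] at this
        rwa [hofn, List.length_ofFn]
    refine ⟨List.ofFn x, hxmem, .of_isWeaklyRegular_of_mem_maximalIdeal M hxmem hregM, ?_⟩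
    rw [hr, List.length_ofFn]
    rfl
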